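/- arXiv:2207.08725 — 2 statements merged into one kernel-verified Lean document; each statement's English description precedes it below -/
import Mathlib

section
/- (Improved bilinear Strichartz estimate II.) Let α ∈ [1,2], 0 < T < 1, and let N₁, N₂ ≥ 1 be dyadic numbers. Let f₁, f₂ ∈ L^∞(]0,T[; L²(T)), let a ∈ L^∞(R²) with ‖a‖_{L^∞} ≤ 1, and let u₁, u₂ ∈ C([0,T]; L²(T)) satisfy ∂_t u_j + L_{α+1}u_j + ∂_x f_j = 0 on ]0,T[ × T in the distributional sense for j = 1, 2. Then there exist K₀ ≥ 1 and C > 0 depending only on p_{α+1} such that, if N₁∨N₂ ≥ K₀(N₁∧N₂), then for every θ ∈ [0,1]: ‖Λ_a(P_{N₁}u₁, P_{N₂}u₂)‖_{L²(]0,T[×T)} ≤ C T^{(θ−1)/2} (N₁∧N₂)^{θ/2} (‖P_{N₁}u₁‖_{L²(]0,T[×T)} + ‖P_{N₁}f₁‖_{L²(]0,T[×T)}) (‖P_{N₂}u₂‖_{L^∞(]0,T[;L²(T))} + ‖P_{N₂}f₂‖_{L^∞(]0,T[;L²(T))}). -/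
open MeasureTheory Complex Real Set Filter
open scoped ENNReal NNReal

noncomputable section

/-- **Hypothesis 1**: `p` is the symbol of the dispersive operator `L_{α+1}`
(the Fourier multiplier by `-i p(ξ)`); `p` is an odd real-valued function of class `C¹`
on `ℝ` and `C²` away from the origin, and for `ξ ≥ ξ₀` the first and second derivatives
of `p` are comparable to `ξ^α` and `ξ^(α-1)` respectively. -/
structure Hyp1 (α ξ₀ c C : ℝ) (p : ℝ → ℝ) : Prop where
  xi0_pos : 0 < ξ₀
  c_pos : 0 < c
  c_le_C : c ≤ C
  smooth1 : ContDiff ℝ 1 p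
  smooth2 : ∀ x : ℝ, x ≠ 0 → ContDiffAt ℝ 2 p x
  odd : ∀ x : ℝ, p (-x) = -p x
  deriv_lb : ∀ ξ : ℝ, ξ₀ ≤ ξ → c * ξ ^ α ≤ deriv p ξ
  deriv_ub : ∀ ξ : ℝ, ξ₀ ≤ ξ → deriv p ξ ≤ C * ξ ^ α
  deriv2_lb : ∀ ξ : ℝ, ξ₀ ≤ ξ → c * ξ ^ (α - 1) ≤ deriv (deriv p) ξ
  deriv2_ub : ∀ ξ : ℝ, ξ₀ ≤ ξ → deriv (deriv p) ξ ≤ C * ξ ^ (α - 1)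

/-- The fixed smooth even cutoff function `χ`: `0 ≤ χ ≤ 1`, `χ ≡ 1` on `[-1,1]`,
`supp χ ⊆ [-2,2]`. -/
structure CutoffFun (χ : ℝ → ℝ) : Prop where
  smooth : ContDiff ℝ (⊤ : ℕ∞) χ
  even : ∀ x : ℝ, χ (-x) = χ x
  nonneg : ∀ x : ℝ, 0 ≤ χ x
  le_one : ∀ x : ℝ, χ x ≤ 1
  eq_one : ∀ x ∈ Set.Icc (-1 : ℝ) 1, χ x = 1
  compact_supp : ∀ x : ℝ, χ x ≠ 0 → x ∈ Set.Icc (-2 : ℝ) 2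

/-- The Littlewood–Paley symbol `φ_N`: for a dyadic `N ≥ 1`, `φ_N(ξ) = χ(ξ/N) - χ(2ξ/N)`,
and `φ_0(ξ) = χ(2ξ)`. -/
def lpSymb (χ : ℝ → ℝ) (N ξ : ℝ) : ℝ :=
  if N = 0 then χ (2 * ξ) else χ (ξ / N) - χ (2 * ξ / N)

/-- The Littlewood–Paley projector `P_N`, acting on the (spatial) Fourier coefficients
of a function on the torus. -/
def PN (χ : ℝ → ℝ) (N : ℝ) (u : ℤ → ℂ) : ℤ → ℂ := fun ξ => (lpSymb χ N ξ : ℂ) * u ξ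

/-- Square of the `L²(𝕋)` norm, computed on Fourier coefficients (Parseval). -/
def l2sq (v : ℤ → ℂ) : ℝ := ∑' ξ : ℤ, ‖v ξ‖ ^ 2

/-- `L²(S × 𝕋)` norm of a space-time function given by its spatial Fourier
coefficients `U t ξ`, `S ⊆ ℝ` a set of times. -/
def L2normOn (S : Set ℝ) (U : ℝ → ℤ → ℂ) : ℝ := (∫ t in S, l2sq (U t)) ^ ((1:ℝ)/2)

/-- `L²(ℝ × 𝕋)` norm. -/
def L2full (U : ℝ → ℤ → ℂ) : ℝ := (∫ t : ℝ, l2sq (U t)) ^ ((1:ℝ)/2)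

/-- `L^∞(]0,T[; L²(𝕋))` norm. -/
def LinfL2 (T : ℝ) (U : ℝ → ℤ → ℂ) : ℝ := ⨆ t : Set.Ioo (0:ℝ) T, (l2sq (U t)) ^ ((1:ℝ)/2)

/-- Membership in `L²(ℝ × 𝕋)`. -/
def MemL2 (U : ℝ → ℤ → ℂ) : Prop :=
  (∀ t : ℝ, Summable fun ξ : ℤ => ‖U t ξ‖ ^ 2) ∧
  (∀ ξ : ℤ, Measurable fun t : ℝ => U t ξ) ∧
  Integrable (fun t : ℝ => l2sq (U t))

/-- Membership in `L^∞(]0,T[; L²(𝕋))`, together with measurability of the coefficients. -/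
def MemLinfL2 (T : ℝ) (U : ℝ → ℤ → ℂ) : Prop :=
  (∀ t ∈ Set.Ioo (0:ℝ) T, Summable fun ξ : ℤ => ‖U t ξ‖ ^ 2) ∧
  (∀ ξ : ℤ, Measurable fun t : ℝ => U t ξ) ∧
  (∃ M : ℝ, ∀ t ∈ Set.Ioo (0:ℝ) T, l2sq (U t) ≤ M)

/-- Continuity with values in `L²(𝕋)` on `[0,T]`. -/
def ContL2On (T : ℝ) (U : ℝ → ℤ → ℂ) : Prop :=
  ∀ t₀ ∈ Set.Icc (0:ℝ) T,
    Filter.Tendsto (fun t => l2sq (fun ξ => U t ξ - U t₀ ξ))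
      (nhdsWithin t₀ (Set.Icc (0:ℝ) T)) (nhds 0)

/-- Time Fourier transform (with the convention `∫ e^{-iτt} g(t) dt`). -/
def FT (g : ℝ → ℂ) (τ : ℝ) : ℂ := ∫ t : ℝ, Complex.exp (-(Complex.I * τ * t)) * g t

/-- Inverse time Fourier transform. -/
def IFT (g : ℝ → ℂ) (t : ℝ) : ℂ :=
  (2 * Real.pi)⁻¹ • ∫ τ : ℝ, Complex.exp (Complex.I * τ * t) * g τ

/-- The modulation projector `Q_L`, a space-time Fourier multiplier with symbol
`ψ_L(τ,ξ) = φ_L(τ - p(ξ))` (acting on spatial Fourier coefficients `U t ξ`). -/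
def QL (χ p : ℝ → ℝ) (L : ℝ) (U : ℝ → ℤ → ℂ) : ℝ → ℤ → ℂ := fun t ξ =>
  IFT (fun τ => (lpSymb χ L (τ - p ξ) : ℂ) * FT (fun s => U s ξ) τ) t

/-- `Q_{≤ 2^l} = Q_0 + ∑_{j ≤ l} Q_{2^j}`. -/
def Qle (χ p : ℝ → ℝ) (l : ℕ) (U : ℝ → ℤ → ℂ) : ℝ → ℤ → ℂ := fun t ξ =>
  QL χ p 0 U t ξ + ∑ j ∈ Finset.range (l + 1), QL χ p ((2:ℝ) ^ j) U t ξ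

/-- The `X^{0,1/2,1}` (Besov–Bourgain) norm:
`‖u‖ = ∑_L max(L,1)^{1/2} ‖Q_L u‖_{L²(ℝ×𝕋)}`, `L` running over `{0} ∪ 2^ℕ`. -/
def Xhalf (χ p : ℝ → ℝ) (U : ℝ → ℤ → ℂ) : ℝ :=
  L2full (QL χ p 0 U) + ∑' l : ℕ, ((2:ℝ) ^ l) ^ ((1:ℝ)/2) * L2full (QL χ p ((2:ℝ) ^ l) U)

/-- Membership in `X^{0,1/2,1}`. -/
def MemX (χ p : ℝ → ℝ) (U : ℝ → ℤ → ℂ) : Prop :=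
  (∀ ξ : ℤ, Measurable fun t : ℝ => U t ξ) ∧
  Integrable (fun t : ℝ => l2sq (QL χ p 0 U t)) ∧
  (∀ l : ℕ, Integrable fun t : ℝ => l2sq (QL χ p ((2:ℝ) ^ l) U t)) ∧
  Summable (fun l : ℕ => ((2:ℝ) ^ l) ^ ((1:ℝ)/2) * L2full (QL χ p ((2:ℝ) ^ l) U))

/-- The bilinear operator `Λ_a`:
`(Λ_a(u,v))^(ξ) = ∑_{ξ₁+ξ₂=ξ} a(ξ₁,ξ₂) û(ξ₁) v̂(ξ₂)`. -/
def Lam (a : ℝ → ℝ → ℂ) (u v : ℤ → ℂ) : ℤ → ℂ := fun ξ =>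
  ∑' ξ₁ : ℤ, a ξ₁ ((ξ : ℝ) - ξ₁) * u ξ₁ * v (ξ - ξ₁)

/-- `u` solves `∂_t u + L_{α+1} u + ∂_x f = 0` on `]0,T[ × 𝕋` (in the distributional
sense), formulated equivalently through the Duhamel formula on each spatial Fourier
mode; `U` and `F` are the spatial Fourier coefficients of `u` and `f`. -/
def Solves (p : ℝ → ℝ) (T : ℝ) (U F : ℝ → ℤ → ℂ) : Prop :=
  ∀ ξ : ℤ, ∀ t ∈ Set.Icc (0:ℝ) T,
    U t ξ = Complex.exp (Complex.I * (p ξ) * t) * U 0 ξ -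
      ∫ s in (0:ℝ)..t,
        Complex.exp (Complex.I * (p ξ) * (t - s)) * (Complex.I * (ξ:ℂ)) * F s ξ

/-- Fourier coefficients of the free evolution `e^{-tL_{α+1}} φ`. -/
def freeEvol (p : ℝ → ℝ) (φ : ℤ → ℂ) : ℝ → ℤ → ℂ := fun t ξ =>
  Complex.exp (Complex.I * (p ξ) * t) * φ ξ



/-! ### Gaussian large sieve -/

theorem gs_integrable (N : ℝ) (hN : 0 < N) (w : ℝ) :
    Integrable (fun x : ℝ => cexp (I * (w:ℂ) * x) * cexp (-((N^2 : ℝ) : ℂ) * (x:ℂ) ^ 2)) := by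
  have h := integrable_cexp_quadratic (b := ((N^2 : ℝ) : ℂ)) (by rw [ofReal_re]; positivity)
    (I * (w:ℂ)) 0
  refine h.congr (Eventually.of_forall fun x => ?_)
  simp only
  rw [← Complex.exp_add]
  congr 1
  ring

theorem gs_norm (N : ℝ) (hN : 0 < N) (w : ℝ) :
    ‖∫ x : ℝ, cexp (I * (w:ℂ) * x) * cexp (-((N^2 : ℝ) : ℂ) * (x:ℂ) ^ 2)‖
      = (√π / N) * rexp (-w^2 / (4 * N^2)) := by
  rw [fourierIntegral_gaussian (by rw [ofReal_re]; positivity)]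
  rw [norm_mul]
  congr 1
  · have : ((π:ℂ) / ((N^2:ℝ):ℂ)) = ((π / N^2 : ℝ) : ℂ) := by push_cast; rfl
    rw [this, show (1/2 : ℂ) = ((1/2 : ℝ) : ℂ) by push_cast; rfl]
    rw [← Complex.ofReal_cpow (by positivity)]
    rw [Complex.norm_real, ← Real.sqrt_eq_rpow, Real.norm_eq_abs, abs_of_nonneg (Real.sqrt_nonneg _),
      Real.sqrt_div (by positivity), Real.sqrt_sq hN.le]
  · rw [show (-(w:ℂ)^2 / (4 * ((N^2:ℝ):ℂ))) = ((-w^2 / (4 * N^2) : ℝ) : ℂ) by push_cast; rfl]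
    rw [Complex.norm_exp, ofReal_re]

theorem gs_expand (A : Finset ℤ) (z : ℤ → ℂ) (ω : ℤ → ℝ) (N t : ℝ) :
    ((‖∑ k ∈ A, z k * cexp (I * (ω k) * t)‖ ^ 2 * rexp (-N^2 * t^2) : ℝ) : ℂ)
      = ∑ k ∈ A, ∑ l ∈ A, (z k * (starRingEnd ℂ) (z l)) *
        (cexp (I * ((ω k - ω l : ℝ):ℂ) * t) * cexp (-((N^2 : ℝ) : ℂ) * (t:ℂ) ^ 2)) := by
  push_cast
  rw [← Complex.mul_conj', map_sum, Finset.sum_mul_sum, Finset.sum_mul]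
  refine Finset.sum_congr rfl fun k _ => ?_
  rw [Finset.sum_mul]
  refine Finset.sum_congr rfl fun l _ => ?_
  rw [map_mul, ← Complex.exp_conj]
  simp only [map_mul, conj_I, conj_ofReal]
  have : cexp (I * ((ω k:ℂ) - ω l) * t) = cexp (I * ω k * t) * cexp (-I * ω l * t) := by
    rw [← Complex.exp_add]; congr 1; ring
  rw [this]; ring

theorem gs_sum (A : Finset ℤ) (z : ℤ → ℂ) (ω : ℤ → ℝ) (N : ℝ) (hN : 0 < N) :
    Integrable (fun t : ℝ => ‖∑ k ∈ A, z k * cexp (I * (ω k) * t)‖ ^ 2 * rexp (-N^2 * t^2)) ∧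
    ∫ t : ℝ, ‖∑ k ∈ A, z k * cexp (I * (ω k) * t)‖ ^ 2 * rexp (-N^2 * t^2) ≤
      (√π / N) * ∑ k ∈ A, ∑ l ∈ A, ‖z k‖ * ‖z l‖ * rexp (-(ω k - ω l)^2 / (4 * N^2)) := by
  have hi : ∀ k l, Integrable (fun t : ℝ => (z k * (starRingEnd ℂ) (z l)) *
        (cexp (I * ((ω k - ω l : ℝ):ℂ) * t) * cexp (-((N^2 : ℝ) : ℂ) * (t:ℂ) ^ 2))) :=
    fun k l => (gs_integrable N hN _).const_mul _
  have hC : Integrable (fun t : ℝ => ((‖∑ k ∈ A, z k * cexp (I * (ω k) * t)‖ ^ 2 *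
      rexp (-N^2 * t^2) : ℝ) : ℂ)) := by
    simp_rw [gs_expand]
    exact integrable_finsetSum _ fun k _ => integrable_finsetSum _ fun l _ => hi k l
  have hR : Integrable (fun t : ℝ => ‖∑ k ∈ A, z k * cexp (I * (ω k) * t)‖ ^ 2 *
      rexp (-N^2 * t^2)) := by
    have := hC.re
    simpa only [RCLike.re_eq_complex_re, ofReal_re] using this
  refine ⟨hR, ?_⟩
  have h1 : ((∫ t : ℝ, ‖∑ k ∈ A, z k * cexp (I * (ω k) * t)‖ ^ 2 * rexp (-N^2 * t^2) : ℝ) : ℂ)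
      = ∑ k ∈ A, ∑ l ∈ A, (z k * (starRingEnd ℂ) (z l)) *
        ∫ t : ℝ, (cexp (I * ((ω k - ω l : ℝ):ℂ) * t) * cexp (-((N^2 : ℝ) : ℂ) * (t:ℂ) ^ 2)) := by
    rw [← integral_complex_ofReal]
    simp_rw [gs_expand]
    rw [integral_finsetSum _ fun k _ => integrable_finsetSum _ fun l _ => hi k l]
    refine Finset.sum_congr rfl fun k _ => ?_
    rw [integral_finsetSum _ fun l _ => hi k l]
    refine Finset.sum_congr rfl fun l _ => ?_
    rw [integral_const_mul]
  have h2 := Complex.norm_real (∫ t : ℝ, ‖∑ k ∈ A, z k * cexp (I * (ω k) * t)‖ ^ 2 *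
    rexp (-N^2 * t^2))
  calc _ ≤ ‖(∫ t : ℝ, ‖∑ k ∈ A, z k * cexp (I * (ω k) * t)‖ ^ 2 * rexp (-N^2 * t^2))‖ :=
        Real.le_norm_self _
    _ = _ := h2.symm
    _ ≤ _ := by
        rw [h1, Finset.mul_sum]
        refine (norm_sum_le _ _).trans (Finset.sum_le_sum fun k _ => ?_)
        rw [Finset.mul_sum]
        refine (norm_sum_le _ _).trans (Finset.sum_le_sum fun l _ => ?_)
        rw [norm_mul, norm_mul, RCLike.norm_conj, gs_norm N hN]
        apply le_of_eq; ring

/-- the sum of the Gaussian over the integers -/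
def gSum (c : ℝ) : ℝ := ∑' m : ℤ, rexp (-(c^2/4) * (m:ℝ)^2)

theorem gSum_summable (c : ℝ) (hc : 0 < c) : Summable fun m : ℤ => rexp (-(c^2/4) * (m:ℝ)^2) := by
  have h0 : Summable fun m : ℕ => rexp (-(c^2/4) * (m:ℝ)) := by
    have := Real.summable_exp_nat_mul_iff.mpr (show -(c^2/4) < 0 by nlinarith [sq_pos_of_pos hc])
    refine this.congr fun m => ?_
    congr 1; ring
  have h1 : Summable fun m : ℕ => rexp (-(c^2/4) * (m:ℝ)^2) := by
    refine Summable.of_nonneg_of_le (fun _ => (Real.exp_pos _).le) (fun m => ?_) h0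
    apply Real.exp_le_exp.mpr
    have : (m:ℝ) ≤ (m:ℝ)^2 := by
      exact_mod_cast (Nat.le_self_pow two_ne_zero m)
    nlinarith [sq_pos_of_pos hc]
  refine Summable.of_nat_of_neg ?_ ?_
  · simpa using h1
  · simpa using h1

theorem gSum_pos (c : ℝ) (hc : 0 < c) : 0 < gSum c :=
  (gSum_summable c hc).tsum_pos (fun _ => (Real.exp_pos _).le) 0 (Real.exp_pos _)

theorem gSum_shift (c : ℝ) (hc : 0 < c) (A : Finset ℤ) (k : ℤ) :
    ∑ l ∈ A, rexp (-(c^2/4) * ((k:ℝ) - l)^2) ≤ gSum c := by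
  have hs := gSum_summable c hc
  have hs' : Summable fun l : ℤ => rexp (-(c^2/4) * ((k:ℝ) - l)^2) := by
    have := (Equiv.subLeft k).summable_iff.mpr hs
    refine this.congr fun l => ?_
    simp
  have : gSum c = ∑' l : ℤ, rexp (-(c^2/4) * ((k:ℝ) - l)^2) := by
    unfold gSum
    rw [← (Equiv.subLeft k).tsum_eq]
    refine tsum_congr fun l => ?_
    simp
  rw [this]
  exact hs'.sum_le_tsum _ fun _ _ => (Real.exp_pos _).le

theorem gs_whole (c : ℝ) (hc : 0 < c) (A : Finset ℤ) (z : ℤ → ℂ) (ω : ℤ → ℝ) (N : ℝ) (hN : 0 < N)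
    (hsep : ∀ k ∈ A, ∀ l ∈ A, c * N * |(k:ℝ) - l| ≤ |ω k - ω l|) :
    ∫ t : ℝ, ‖∑ k ∈ A, z k * cexp (I * (ω k) * t)‖ ^ 2 * rexp (-N^2 * t^2) ≤
      (√π / N) * (gSum c * ∑ k ∈ A, ‖z k‖^2) := by
  refine (gs_sum A z ω N hN).2.trans ?_
  refine mul_le_mul_of_nonneg_left ?_ (by positivity)
  set m : ℤ → ℤ → ℝ := fun k l => rexp (-(c^2/4) * ((k:ℝ) - l)^2) with hm
  have hmsymm : ∀ k l, m k l = m l k := by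
    intro k l; simp only [hm]; congr 2; ring
  have hm0 : ∀ k l, 0 < m k l := fun k l => Real.exp_pos _
  have hle : ∀ k ∈ A, ∀ l ∈ A, rexp (-(ω k - ω l)^2 / (4 * N^2)) ≤ m k l := by
    intro k hk l hl
    apply Real.exp_le_exp.mpr
    have h := hsep k hk l hl
    have h2 : (c * N * |(k:ℝ) - l|)^2 ≤ (ω k - ω l)^2 := by
      rw [← sq_abs (ω k - ω l)]
      exact pow_le_pow_left₀ (by positivity) h 2
    rw [mul_pow, sq_abs] at h2
    rw [div_le_iff₀ (by positivity)]
    nlinarith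
  calc _ ≤ ∑ k ∈ A, ∑ l ∈ A, (m k l * (‖z k‖^2 / 2) + m k l * (‖z l‖^2/2)) := by
        refine Finset.sum_le_sum fun k hk => Finset.sum_le_sum fun l hl => ?_
        have h1 := hle k hk l hl
        have h2 : ‖z k‖ * ‖z l‖ * rexp (-(ω k - ω l)^2 / (4 * N^2)) ≤ ‖z k‖ * ‖z l‖ * m k l :=
          mul_le_mul_of_nonneg_left h1 (by positivity)
        nlinarith [hm0 k l, mul_nonneg (hm0 k l).le (sq_nonneg (‖z k‖ - ‖z l‖))]
    _ = ∑ k ∈ A, (∑ l ∈ A, m k l) * (‖z k‖^2/2) + ∑ l ∈ A, (∑ k ∈ A, m l k) * (‖z l‖^2/2) := by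
        simp_rw [Finset.sum_add_distrib]
        congr 1
        · simp_rw [Finset.sum_mul]
        · rw [Finset.sum_comm]
          simp_rw [Finset.sum_mul]
          refine Finset.sum_congr rfl fun k _ => Finset.sum_congr rfl fun l _ => ?_
          rw [hmsymm]
    _ ≤ ∑ k ∈ A, gSum c * (‖z k‖^2/2) + ∑ l ∈ A, gSum c * (‖z l‖^2/2) := by
        gcongr with k hk k hk
        · exact gSum_shift c hc A k
        · exact gSum_shift c hc A k
    _ = _ := by rw [← Finset.sum_add_distrib, Finset.mul_sum]; congr 1; ext k; ring

/-- the constant of the large sieve -/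
def KG (c : ℝ) : ℝ := rexp 1 * √π * gSum c

theorem KG_pos (c : ℝ) (hc : 0 < c) : 0 < KG c := by
  have := gSum_pos c hc
  have := Real.pi_pos
  unfold KG; positivity

theorem large_sieve (c : ℝ) (hc : 0 < c) (A : Finset ℤ) (z : ℤ → ℂ) (ω : ℤ → ℝ) (N : ℝ)
    (hN : 0 < N) (hsep : ∀ k ∈ A, ∀ l ∈ A, c * N * |(k:ℝ) - l| ≤ |ω k - ω l|)
    (a b : ℝ) (hab : a ≤ b) (hlen : (b - a) * N ≤ 1) :
    ∫ t in a..b, ‖∑ k ∈ A, z k * cexp (I * (ω k) * t)‖ ^ 2 ≤ KG c / N * ∑ k ∈ A, ‖z k‖^2 := by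
  set z' : ℤ → ℂ := fun k => z k * cexp (I * (ω k) * a) with hz'
  have hn : ∀ k, ‖z' k‖ = ‖z k‖ := by
    intro k
    simp only [hz', norm_mul]
    rw [show I * (ω k : ℂ) * a = ((ω k * a : ℝ) : ℂ) * I by push_cast; ring,
      Complex.norm_exp_ofReal_mul_I, mul_one]
  have hshift : ∫ t in a..b, ‖∑ k ∈ A, z k * cexp (I * (ω k) * t)‖ ^ 2 =
      ∫ t in (0:ℝ)..(b-a), ‖∑ k ∈ A, z' k * cexp (I * (ω k) * t)‖ ^ 2 := by
    have h := intervalIntegral.integral_comp_add_right (a := 0) (b := b - a)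
      (fun t : ℝ => ‖∑ k ∈ A, z k * cexp (I * (ω k) * t)‖ ^ 2) a
    rw [zero_add, sub_add_cancel] at h
    rw [← h]
    refine intervalIntegral.integral_congr fun t _ => ?_
    simp only [hz']
    congr 2
    refine Finset.sum_congr rfl fun k _ => ?_
    rw [mul_assoc (z k), ← Complex.exp_add]
    congr 2
    push_cast; ring
  obtain ⟨hgint, _⟩ := gs_sum A z' ω N hN
  have hw := gs_whole c hc A z' ω N hN hsep
  simp_rw [hn] at hw
  rw [hshift, intervalIntegral.integral_of_le (by linarith)]
  calc _ ≤ ∫ t in Ioc 0 (b-a), rexp 1 * (‖∑ k ∈ A, z' k * cexp (I * (ω k) * t)‖ ^ 2 *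
            rexp (-N^2 * t^2)) := by
        refine setIntegral_mono_on ?_ ?_ measurableSet_Ioc ?_
        · apply Continuous.integrableOn_Ioc
          fun_prop
        · exact (hgint.const_mul _).integrableOn
        · intro t ht
          have h1 : 1 ≤ rexp 1 * rexp (-N^2 * t^2) := by
            rw [← Real.exp_add, Real.one_le_exp_iff]
            have h2 : t * N ≤ 1 := by nlinarith [ht.1, ht.2]
            have h3 : 0 ≤ t * N := by nlinarith [ht.1]
            nlinarith
          nlinarith [sq_nonneg ‖∑ k ∈ A, z' k * cexp (I * (ω k) * t)‖]
    _ ≤ ∫ t : ℝ, rexp 1 * (‖∑ k ∈ A, z' k * cexp (I * (ω k) * t)‖ ^ 2 *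
            rexp (-N^2 * t^2)) := by
        apply setIntegral_le_integral (hgint.const_mul _)
        exact Eventually.of_forall fun t => by positivity
    _ ≤ _ := by
        rw [integral_const_mul]
        unfold KG
        calc _ ≤ rexp 1 * ((√π / N) * (gSum c * ∑ k ∈ A, ‖z k‖^2)) := by gcongr
          _ = _ := by ring

/-! ### Bounded measurable functions, product rule -/

/-- bounded measurable complex-valued functions on the line -/
def BM (f : ℝ → ℂ) : Prop := Measurable f ∧ ∃ B : ℝ, ∀ t, ‖f t‖ ≤ B

theorem BM.ii {f : ℝ → ℂ} (hf : BM f) (a b : ℝ) : IntervalIntegrable f volume a b := by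
  obtain ⟨hm, B, hB⟩ := hf
  refine (intervalIntegrable_const (c := B)).mono_fun hm.aestronglyMeasurable ?_
  exact Eventually.of_forall fun t => (hB t).trans (Real.le_norm_self _)

theorem BM.li {f : ℝ → ℂ} (hf : BM f) : LocallyIntegrable f volume := by
  obtain ⟨hm, B, hB⟩ := hf
  refine (locallyIntegrable_const B).mono hm.aestronglyMeasurable ?_
  exact Eventually.of_forall fun t => (hB t).trans (Real.le_norm_self _)

theorem bdd_ii {f : ℝ → ℝ} (hm : Measurable f) {B : ℝ} (hB : ∀ t, |f t| ≤ B) (a b : ℝ) :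
    IntervalIntegrable f volume a b := by
  refine (intervalIntegrable_const (c := B)).mono_fun hm.aestronglyMeasurable ?_
  exact Eventually.of_forall fun t => (hB t).trans (Real.le_norm_self _)

/-- `v` is a primitive of `g`. -/
def Prim (v g : ℝ → ℂ) : Prop := ∀ s t : ℝ, v t - v s = ∫ r in s..t, g r

theorem Prim.lip {v g : ℝ → ℂ} (h : Prim v g) {B : ℝ} (hB : ∀ t, ‖g t‖ ≤ B) (s t : ℝ) :
    ‖v t - v s‖ ≤ B * |t - s| := by
  rw [h s t]
  exact intervalIntegral.norm_integral_le_of_norm_le_const fun r _ => hB r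

theorem Prim.cont {v g : ℝ → ℂ} (h : Prim v g) (hg : BM g) : Continuous v := by
  obtain ⟨hm, B, hB⟩ := hg
  have hB0 : 0 ≤ B := (norm_nonneg _).trans (hB 0)
  have : LipschitzWith (Real.toNNReal B) v := LipschitzWith.of_dist_le_mul fun x y => by
    rw [dist_eq_norm, Real.dist_eq, Real.coe_toNNReal _ hB0]; exact h.lip hB y x
  exact this.continuous

theorem Prim.ae_deriv {v g : ℝ → ℂ} (h : Prim v g) (hg : BM g) :
    ∀ᵐ x, HasDerivAt v (g x) x := by
  filter_upwards [_root_.LocallyIntegrable.ae_hasDerivAt_integral hg.li] with x hx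
  have h1 := (hx 0).const_add (v 0)
  refine h1.congr_of_eventuallyEq (Eventually.of_forall fun t => ?_)
  simp only
  rw [← h 0 t]; ring

/-- the product rule on a bounded interval -/
theorem prim_mul {v w g h : ℝ → ℂ} (hv : Prim v g) (hw : Prim w h) (hg : BM g) (hh : BM h)
    (s t : ℝ) : v t * w t - v s * w s = ∫ r in s..t, (g r * w r + v r * h r) := by
  have hvc := hv.cont hg
  have hwc := hw.cont hh
  obtain ⟨hgm, Bg, hBg⟩ := id hg
  obtain ⟨hhm, Bh, hBh⟩ := id hh
  obtain ⟨Mv, hMv⟩ := (isCompact_uIcc (a := s) (b := t)).exists_bound_of_continuousOn hvc.continuousOn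
  obtain ⟨Mw, hMw⟩ := (isCompact_uIcc (a := s) (b := t)).exists_bound_of_continuousOn hwc.continuousOn
  have hMv0 : 0 ≤ Mv := (norm_nonneg _).trans (hMv s left_mem_uIcc)
  have hMw0 : 0 ≤ Mw := (norm_nonneg _).trans (hMw s left_mem_uIcc)
  have hBg0 : 0 ≤ Bg := (norm_nonneg _).trans (hBg 0)
  have hBh0 : 0 ≤ Bh := (norm_nonneg _).trans (hBh 0)
  have hli : LocallyIntegrable (fun r => g r * w r + v r * h r) volume := by
    intro x
    obtain ⟨U, hU, hUc⟩ := exists_compact_mem_nhds x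
    refine ⟨U, hUc, IntegrableOn.add ?_ ?_⟩
    · exact (hg.li.integrableOn_isCompact hU).mul_continuousOn hwc.continuousOn hU
    · exact (hh.li.integrableOn_isCompact hU).continuousOn_mul hvc.continuousOn hU
  have hii : ∀ x y, IntervalIntegrable (fun r => g r * w r + v r * h r) volume x y := by
    intro x y
    exact intervalIntegrable_iff.mpr <|
      (hli.integrableOn_isCompact isCompact_uIcc).mono_set uIoc_subset_uIcc
  set Φ : ℝ → ℂ := fun x => v x * w x - ∫ r in s..x, (g r * w r + v r * h r) with hΦ
  have hlip : LipschitzOnWith (Real.toNNReal (2 * (Bg * Mw + Mv * Bh))) Φ (uIcc s t) := by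
    refine LipschitzOnWith.of_dist_le_mul fun x hx y hy => ?_
    rw [dist_eq_norm, Real.dist_eq]
    have e1 : Φ x - Φ y = (v x - v y) * w x + v y * (w x - w y) -
        ∫ r in y..x, (g r * w r + v r * h r) := by
      simp only [hΦ]
      rw [← intervalIntegral.integral_add_adjacent_intervals (hii s y) (hii y x)]
      ring
    have e2 : ‖∫ r in y..x, (g r * w r + v r * h r)‖ ≤ (Bg * Mw + Mv * Bh) * |x - y| := by
      refine intervalIntegral.norm_integral_le_of_norm_le_const fun r hr => ?_
      have hr' : r ∈ uIcc s t := uIcc_subset_uIcc hy hx (uIoc_subset_uIcc hr)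
      refine (norm_add_le _ _).trans ?_
      rw [norm_mul, norm_mul]
      exact add_le_add (mul_le_mul (hBg r) (hMw r hr') (norm_nonneg _) hBg0)
        (mul_le_mul (hMv r hr') (hBh r) (norm_nonneg _) hMv0)
    rw [e1]
    have e3 : ‖(v x - v y) * w x‖ ≤ Bg * |x - y| * Mw := by
      rw [norm_mul]
      exact mul_le_mul (hv.lip hBg y x) (hMw x hx) (norm_nonneg _) (by positivity)
    have e4 : ‖v y * (w x - w y)‖ ≤ Mv * (Bh * |x - y|) := by
      rw [norm_mul]
      exact mul_le_mul (hMv y hy) (hw.lip hBh y x) (norm_nonneg _) hMv0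
    have := norm_sub_le ((v x - v y) * w x + v y * (w x - w y))
      (∫ r in y..x, (g r * w r + v r * h r))
    have := norm_add_le ((v x - v y) * w x) (v y * (w x - w y))
    rw [Real.coe_toNNReal _ (by positivity)]
    nlinarith
  have hder : ∀ᵐ x, x ∈ uIcc s t → HasDerivAt Φ 0 x := by
    filter_upwards [hv.ae_deriv hg, hw.ae_deriv hh, _root_.LocallyIntegrable.ae_hasDerivAt_integral hli] with x h1 h2 h3 _
    have := (h1.mul h2).sub (h3 s)
    rw [sub_self] at this
    exact this
  obtain ⟨C, hC⟩ := hlip.absolutelyContinuousOnInterval.const_of_ae_hasDerivAt_zero hder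
  have e1 := hC s left_mem_uIcc
  have e2 := hC t right_mem_uIcc
  simp only [hΦ, intervalIntegral.integral_same, sub_zero] at e1 e2
  rw [← e1] at e2
  linear_combination e2

theorem cs_int {f : ℝ → ℝ} (hm : Measurable f) {B : ℝ} (hB : ∀ t, |f t| ≤ B) (a b : ℝ)
    (hab : a ≤ b) : (∫ t in a..b, f t)^2 ≤ (b - a) * ∫ t in a..b, (f t)^2 := by
  rcases eq_or_lt_of_le hab with h | h
  · subst h; simp
  have hB0 : 0 ≤ B := (abs_nonneg _).trans (hB 0)
  have i1 := bdd_ii hm hB a b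
  have i2 : IntervalIntegrable (fun t => (f t)^2) volume a b :=
    bdd_ii (hm.pow_const 2) (B := B^2) (fun t => by
      rw [abs_pow]; exact pow_le_pow_left₀ (abs_nonneg _) (hB t) 2) a b
  set m := (∫ t in a..b, f t) / (b - a) with hmdef
  have hba : 0 < b - a := by linarith
  have h0 : 0 ≤ ∫ t in a..b, (f t - m)^2 :=
    intervalIntegral.integral_nonneg hab fun t _ => sq_nonneg _
  have h1 : ∫ t in a..b, (f t - m)^2 = (∫ t in a..b, (f t)^2) - 2 * m * (∫ t in a..b, f t)
      + (b - a) * m^2 := by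
    have : ∀ t, (f t - m)^2 = ((f t)^2 - 2 * m * f t) + m^2 := fun t => by ring
    simp_rw [this]
    rw [intervalIntegral.integral_add (i2.sub (i1.const_mul _)) intervalIntegrable_const,
      intervalIntegral.integral_sub i2 (i1.const_mul _), intervalIntegral.integral_const_mul,
      intervalIntegral.integral_const, smul_eq_mul]
  have h2 : (∫ t in a..b, f t) = m * (b - a) := by rw [hmdef]; field_simp
  rw [h1, h2] at h0
  rw [h2]
  nlinarith [mul_nonneg hba.le h0]

/-! ### Time-dependent coefficients -/

theorem lemE (c : ℝ) (hc : 0 < c) (A : Finset ℤ) (ω : ℤ → ℝ) (N : ℝ)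
    (hN : 0 < N) (hsep : ∀ k ∈ A, ∀ l ∈ A, c * N * |(k:ℝ) - l| ≤ |ω k - ω l|)
    (a b : ℝ) (hab : a ≤ b) (hlen : (b - a) * N ≤ 1)
    (C D : ℝ → ℤ → ℂ) (hD : ∀ k, BM (fun t => D t k))
    (hC : ∀ k, Prim (fun t => C t k) (fun t => D t k)) (t₀ : ℝ) (ht₀ : t₀ ∈ Icc a b) :
    ∫ t in a..b, ‖∑ k ∈ A, C t k * cexp (I * (ω k) * t)‖ ^ 2 ≤
      2 * (KG c / N) * ∑ k ∈ A, ‖C t₀ k‖^2 +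
      2 * (b - a) * (KG c / N) * ∫ s in a..b, ∑ k ∈ A, ‖D s k‖^2 := by
  have hCc : ∀ k, Continuous fun t => C t k := fun k => (hC k).cont (hD k)
  choose hDm B hB using hD
  have hDm' : ∀ k, Measurable fun t => D t k := hDm
  set H : ℝ → ℝ → ℂ := fun t s => ∑ k ∈ A, D s k * cexp (I * (ω k) * t) with hH
  have he : ∀ (k : ℤ) (t : ℝ), ‖cexp (I * (ω k) * t)‖ = 1 := by
    intro k t
    rw [show I * (ω k : ℂ) * t = ((ω k * t : ℝ) : ℂ) * I by push_cast; ring,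
      Complex.norm_exp_ofReal_mul_I]
  set BB := ∑ k ∈ A, B k with hBB
  have hHb : ∀ t s, ‖H t s‖ ≤ BB := by
    intro t s
    refine (norm_sum_le _ _).trans (Finset.sum_le_sum fun k _ => ?_)
    rw [norm_mul, he, mul_one]; exact hB k s
  have hBB0 : 0 ≤ BB := (norm_nonneg _).trans (hHb 0 0)
  have hHm : ∀ t, Measurable (H t) := by
    intro t
    simp only [hH]
    exact Finset.measurable_sum _ fun k _ => (hDm k).mul_const _
  have hHc : ∀ s, Continuous fun t => H t s := by
    intro s; simp only [hH]; fun_prop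
  have hHuncurry : Measurable (Function.uncurry fun t s => ‖H t s‖^2) := by
    refine (Measurable.norm ?_).pow_const 2
    refine Finset.measurable_fun_sum _ fun k _ => ?_
    refine Measurable.mul ((hDm' k).comp measurable_snd) ?_
    have : Continuous fun x : ℝ => cexp (I * (ω k) * x) := by fun_prop
    exact this.measurable.comp measurable_fst
  have hsq : ∀ t s, ‖H t s‖^2 ≤ BB^2 := fun t s => pow_le_pow_left₀ (norm_nonneg _) (hHb t s) 2
  have hprod : Integrable (Function.uncurry fun t s => ‖H t s‖^2)
      ((volume.restrict (Ioc a b)).prod (volume.restrict (Ioc a b))) := by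
    refine Integrable.of_bound hHuncurry.aestronglyMeasurable (BB^2) ?_
    refine Eventually.of_forall fun x => ?_
    show ‖‖H x.1 x.2‖^2‖ ≤ BB^2
    rw [Real.norm_eq_abs, abs_of_nonneg (sq_nonneg _)]
    exact hsq _ _
  have hpt : ∀ t ∈ Icc a b, ‖∑ k ∈ A, C t k * cexp (I * (ω k) * t)‖ ^ 2 ≤
      2 * ‖∑ k ∈ A, C t₀ k * cexp (I * (ω k) * t)‖ ^ 2 +
      2 * (b - a) * ∫ s in a..b, ‖H t s‖^2 := by
    intro t ht
    have e1 : ∑ k ∈ A, C t k * cexp (I * (ω k) * t) =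
        ∑ k ∈ A, C t₀ k * cexp (I * (ω k) * t) + ∫ s in t₀..t, H t s := by
      simp only [hH]
      rw [intervalIntegral.integral_finsetSum]
      · rw [← Finset.sum_add_distrib]
        refine Finset.sum_congr rfl fun k _ => ?_
        rw [intervalIntegral.integral_mul_const, ← hC k t₀ t]
        ring
      · intro k _
        exact (BM.ii ⟨hDm k, B k, hB k⟩ _ _).mul_const _
    have e2 : ‖∫ s in t₀..t, H t s‖ ≤ ∫ s in a..b, ‖H t s‖ := by
      refine (intervalIntegral.norm_integral_le_integral_norm_uIoc).trans ?_
      rw [intervalIntegral.integral_of_le hab]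
      refine setIntegral_mono_set ?_ ?_ ?_
      · have := (bdd_ii (hHm t).norm (B := BB) (fun s => by rw [abs_norm]; exact hHb t s) a b)
        exact (intervalIntegrable_iff_integrableOn_Ioc_of_le hab).mp this
      · exact Eventually.of_forall fun s => norm_nonneg _
      · refine Eventually.of_forall fun x hx => ?_
        rcases hx with ⟨h1, h2⟩
        refine ⟨lt_of_le_of_lt (le_min ht₀.1 ht.1) h1, h2.trans (max_le ht₀.2 ht.2)⟩
    have e3 := cs_int (hHm t).norm (B := BB) (fun s => by rw [abs_norm]; exact hHb t s) a b hab
    have e4 : ‖∫ s in t₀..t, H t s‖^2 ≤ (b - a) * ∫ s in a..b, ‖H t s‖^2 :=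
      (pow_le_pow_left₀ (norm_nonneg _) e2 2).trans e3
    rw [e1]
    have e5 := norm_add_le (∑ k ∈ A, C t₀ k * cexp (I * (ω k) * t)) (∫ s in t₀..t, H t s)
    have e6 := pow_le_pow_left₀ (norm_nonneg _) e5 2
    nlinarith [sq_nonneg (‖∑ k ∈ A, C t₀ k * cexp (I * (ω k) * t)‖ - ‖∫ s in t₀..t, H t s‖)]
  have hgint2 : IntervalIntegrable (fun t => ∫ s in a..b, ‖H t s‖^2) volume a b := by
    rw [intervalIntegrable_iff_integrableOn_Ioc_of_le hab]
    simp_rw [intervalIntegral.integral_of_le hab]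
    exact hprod.integral_prod_left
  have hc0 : Continuous fun t : ℝ => 2 * ‖∑ k ∈ A, C t₀ k * cexp (I * (ω k) * t)‖ ^ 2 := by fun_prop
  have hc1 : Continuous fun t : ℝ => ‖∑ k ∈ A, C t k * cexp (I * (ω k) * t)‖ ^ 2 := by fun_prop
  have hswap : ∫ t in a..b, ∫ s in a..b, ‖H t s‖^2 = ∫ s in a..b, ∫ t in a..b, ‖H t s‖^2 := by
    simp_rw [intervalIntegral.integral_of_le hab]
    exact integral_integral_swap hprod
  have hinner : ∫ s in a..b, ∫ t in a..b, ‖H t s‖^2 ≤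
      ∫ s in a..b, KG c / N * ∑ k ∈ A, ‖D s k‖^2 := by
    refine intervalIntegral.integral_mono_on hab ?_ ?_ ?_
    · rw [intervalIntegrable_iff_integrableOn_Ioc_of_le hab]
      simp_rw [intervalIntegral.integral_of_le hab]
      exact hprod.integral_prod_right
    · refine IntervalIntegrable.const_mul ?_ _
      refine bdd_ii (B := ∑ k ∈ A, (B k)^2) ?_ ?_ a b
      · exact Finset.measurable_fun_sum _ fun k _ => (hDm' k).norm.pow_const 2
      · intro s
        rw [abs_of_nonneg (by positivity)]
        exact Finset.sum_le_sum fun k _ => pow_le_pow_left₀ (norm_nonneg _) (hB k s) 2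
    · intro s _
      exact large_sieve c hc A (D s) ω N hN hsep a b hab hlen
  calc _ ≤ ∫ t in a..b, (2 * ‖∑ k ∈ A, C t₀ k * cexp (I * (ω k) * t)‖ ^ 2 +
      2 * (b - a) * ∫ s in a..b, ‖H t s‖^2) := by
        refine intervalIntegral.integral_mono_on hab (hc1.intervalIntegrable _ _) ?_ hpt
        exact (hc0.intervalIntegrable _ _).add (hgint2.const_mul _)
    _ = 2 * (∫ t in a..b, ‖∑ k ∈ A, C t₀ k * cexp (I * (ω k) * t)‖ ^ 2) +
        2 * (b - a) * ∫ t in a..b, ∫ s in a..b, ‖H t s‖^2 := by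
        rw [intervalIntegral.integral_add (hc0.intervalIntegrable _ _) (hgint2.const_mul _),
          intervalIntegral.integral_const_mul, intervalIntegral.integral_const_mul]
    _ ≤ _ := by
        rw [hswap]
        have h1 := large_sieve c hc A (C t₀) ω N hN hsep a b hab hlen
        rw [intervalIntegral.integral_const_mul] at hinner
        have h2 := mul_le_mul_of_nonneg_left hinner (show 0 ≤ 2 * (b - a) by linarith)
        linarith

theorem conv_le (X A B : Finset ℤ) (f h : ℤ → ℝ) (hf : ∀ k, 0 ≤ f k) (hh : ∀ k, 0 ≤ h k) :
    ∑ ξ ∈ X, ∑ k ∈ A with ξ - k ∈ B, f k * h (ξ - k) ≤ (∑ k ∈ A, f k) * ∑ l ∈ B, h l := by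
  simp_rw [Finset.sum_filter]
  rw [Finset.sum_comm, Finset.sum_mul]
  refine Finset.sum_le_sum fun k _ => ?_
  rw [← Finset.sum_filter, ← Finset.mul_sum]
  refine mul_le_mul_of_nonneg_left ?_ (hf k)
  have : ∑ ξ ∈ X with ξ - k ∈ B, h (ξ - k) = ∑ l ∈ (X.filter (fun ξ => ξ - k ∈ B)).image (· - k), h l := by
    rw [Finset.sum_image]
    intro x _ y _ hxy
    simpa using hxy
  rw [this]
  refine Finset.sum_le_sum_of_subset_of_nonneg ?_ fun l _ _ => hh l
  intro l hl
  simp only [Finset.mem_image, Finset.mem_filter] at hl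
  obtain ⟨ξ, ⟨_, h⟩, rfl⟩ := hl
  exact h

/-! ### The bilinear estimate on a short interval -/

/-- finite `ℓ²` norm squared -/
def nrm (A : Finset ℤ) (z : ℤ → ℂ) : ℝ := ∑ k ∈ A, ‖z k‖^2

theorem nrm_nonneg (A : Finset ℤ) (z : ℤ → ℂ) : 0 ≤ nrm A z :=
  Finset.sum_nonneg fun _ _ => by positivity

theorem nrm_bdd {A : Finset ℤ} {z : ℝ → ℤ → ℂ} (h : ∀ k, BM fun t => z t k) :
    Measurable (fun t => nrm A (z t)) ∧ ∃ B : ℝ, ∀ t, |nrm A (z t)| ≤ B := by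
  choose hm B hB using h
  have hm' : ∀ k, Measurable fun t => z t k := hm
  refine ⟨Finset.measurable_fun_sum _ fun k _ => (hm' k).norm.pow_const 2, ∑ k ∈ A, (B k)^2, ?_⟩
  intro t
  rw [abs_of_nonneg (nrm_nonneg _ _)]
  exact Finset.sum_le_sum fun k _ => pow_le_pow_left₀ (norm_nonneg _) (hB k t) 2

theorem nrm_ii {A : Finset ℤ} {z : ℝ → ℤ → ℂ} (h : ∀ k, BM fun t => z t k) (a b : ℝ) :
    IntervalIntegrable (fun t => nrm A (z t)) volume a b := by
  obtain ⟨hm, B, hB⟩ := nrm_bdd (A := A) h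
  exact bdd_ii hm hB a b

theorem BM.mul {f g : ℝ → ℂ} (hf : BM f) (hg : BM g) : BM (fun t => f t * g t) := by
  obtain ⟨hm, B, hB⟩ := hf
  obtain ⟨hm', B', hB'⟩ := hg
  refine ⟨hm.mul hm', B * B', fun t => ?_⟩
  rw [norm_mul]
  exact mul_le_mul (hB t) (hB' t) (norm_nonneg _) ((norm_nonneg _).trans (hB 0))

theorem BM.add {f g : ℝ → ℂ} (hf : BM f) (hg : BM g) : BM (fun t => f t + g t) := by
  obtain ⟨hm, B, hB⟩ := hf
  obtain ⟨hm', B', hB'⟩ := hg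
  exact ⟨hm.add hm', B + B', fun t => (norm_add_le _ _).trans (add_le_add (hB t) (hB' t))⟩

theorem BM.const (z : ℂ) : BM (fun _ => z) := ⟨measurable_const, ‖z‖, fun _ => le_rfl⟩

/-- the bilinear expression -/
def bil (A B : Finset ℤ) (p : ℝ → ℝ) (α : ℤ → ℤ → ℂ) (v₁ v₂ : ℝ → ℤ → ℂ) (t : ℝ) (ξ : ℤ) : ℂ :=
  ∑ k ∈ A with ξ - k ∈ B, (α ξ k * (v₁ t k * v₂ t (ξ - k))) *
    cexp (I * ((p k + p ((ξ - k : ℤ):ℝ) : ℝ) : ℂ) * t)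

theorem nrm_sum_mul_le (X A B : Finset ℤ) (α : ℤ → ℤ → ℂ) (hα : ∀ ξ k, ‖α ξ k‖ ≤ 1)
    (x y : ℤ → ℂ) :
    ∑ ξ ∈ X, ∑ k ∈ A with ξ - k ∈ B, ‖α ξ k * (x k * y (ξ - k))‖^2 ≤ nrm A x * nrm B y := by
  refine le_trans ?_ (conv_le X A B (fun k => ‖x k‖^2) (fun k => ‖y k‖^2)
    (fun _ => by positivity) (fun _ => by positivity))
  refine Finset.sum_le_sum fun ξ _ => Finset.sum_le_sum fun k _ => ?_
  rw [norm_mul, norm_mul, mul_pow, mul_pow]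
  have : ‖α ξ k‖^2 ≤ 1 := pow_le_one₀ (norm_nonneg _) (hα ξ k)
  have h2 : 0 ≤ ‖x k‖^2 * ‖y (ξ - k)‖^2 := by positivity
  nlinarith

theorem core_pt (c : ℝ) (hc : 0 < c) (X A B : Finset ℤ) (p : ℝ → ℝ) (N : ℝ) (hN : 0 < N)
    (hsep : ∀ ξ : ℤ, ∀ k ∈ A, ∀ l ∈ A, ξ - k ∈ B → ξ - l ∈ B →
      c * N * |(k:ℝ) - l| ≤ |(p k + p ((ξ - k : ℤ):ℝ)) - (p l + p ((ξ - l : ℤ):ℝ))|)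
    (α : ℤ → ℤ → ℂ) (hα : ∀ ξ k, ‖α ξ k‖ ≤ 1)
    (v₁ v₂ g₁ g₂ : ℝ → ℤ → ℂ)
    (hv₁ : ∀ k, BM fun t => v₁ t k) (hv₂ : ∀ k, BM fun t => v₂ t k)
    (hg₁ : ∀ k, BM fun t => g₁ t k) (hg₂ : ∀ k, BM fun t => g₂ t k)
    (hp₁ : ∀ k, Prim (fun t => v₁ t k) (fun t => g₁ t k))
    (hp₂ : ∀ k, Prim (fun t => v₂ t k) (fun t => g₂ t k))
    (a b : ℝ) (hab : a ≤ b) (hlen : (b - a) * N ≤ 1) (t₀ : ℝ) (ht₀ : t₀ ∈ Icc a b) :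
    ∫ t in a..b, nrm X (bil A B p α v₁ v₂ t) ≤
      2 * (KG c / N) * (nrm A (v₁ t₀) * nrm B (v₂ t₀)) +
      2 * (b - a) * (KG c / N) * ∫ s in a..b,
        2 * (nrm A (g₁ s) * nrm B (v₂ s) + nrm A (v₁ s) * nrm B (g₂ s)) := by
  have hκ : 0 ≤ KG c / N := by have := KG_pos c hc; positivity
  set D : ℤ → ℝ → ℤ → ℂ := fun ξ t k => α ξ k * (g₁ t k * v₂ t (ξ - k) + v₁ t k * g₂ t (ξ - k))
    with hDdef
  have hD : ∀ ξ k, BM (fun t => D ξ t k) := fun ξ k =>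
    (BM.const (α ξ k)).mul (((hg₁ k).mul (hv₂ (ξ - k))).add ((hv₁ k).mul (hg₂ (ξ - k))))
  have hC : ∀ ξ k, Prim (fun t => α ξ k * (v₁ t k * v₂ t (ξ - k))) (fun t => D ξ t k) := by
    intro ξ k s t
    simp only [hDdef]
    rw [intervalIntegral.integral_const_mul,
      ← prim_mul (hp₁ k) (hp₂ (ξ - k)) (hg₁ k) (hg₂ (ξ - k)) s t]
    ring
  have hE : ∀ ξ : ℤ, _ := fun ξ => lemE c hc (A.filter fun k => ξ - k ∈ B)
    (fun k => p k + p ((ξ - k : ℤ):ℝ)) N hN (by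
      intro k hk l hl
      rw [Finset.mem_filter] at hk hl
      exact hsep ξ k hk.1 l hl.1 hk.2 hl.2) a b hab hlen
    (fun t k => α ξ k * (v₁ t k * v₂ t (ξ - k))) (D ξ) (hD ξ) (hC ξ) t₀ ht₀
  have hbc : ∀ ξ, Continuous fun t => ‖bil A B p α v₁ v₂ t ξ‖^2 := by
    intro ξ
    have h1 : ∀ k, Continuous fun t => v₁ t k := fun k => (hp₁ k).cont (hg₁ k)
    have h2 : ∀ k, Continuous fun t => v₂ t k := fun k => (hp₂ k).cont (hg₂ k)
    unfold bil
    fun_prop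
  have hDii : ∀ ξ, IntervalIntegrable
      (fun s => ∑ k ∈ A with ξ - k ∈ B, ‖D ξ s k‖^2) volume a b := fun ξ => nrm_ii (hD ξ) a b
  have hnn : ∀ (x y : ℝ → ℤ → ℂ), (∀ k, BM fun t => x t k) → (∀ k, BM fun t => y t k) →
      IntervalIntegrable (fun s => nrm A (x s) * nrm B (y s)) volume a b := by
    intro x y hx hy
    obtain ⟨m1, B1, hB1⟩ := nrm_bdd (A := A) hx
    obtain ⟨m2, B2, hB2⟩ := nrm_bdd (A := B) hy
    refine bdd_ii (m1.mul m2) (B := B1 * B2) (fun t => ?_) a b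
    simp only [Pi.mul_apply]
    rw [abs_mul]
    exact mul_le_mul (hB1 t) (hB2 t) (abs_nonneg _) ((abs_nonneg _).trans (hB1 0))
  have hrhs : IntervalIntegrable (fun s => 2 * (nrm A (g₁ s) * nrm B (v₂ s) +
      nrm A (v₁ s) * nrm B (g₂ s))) volume a b :=
    ((hnn _ _ hg₁ hv₂).add (hnn _ _ hv₁ hg₂)).const_mul 2
  have hsumD : ∑ ξ ∈ X, ∫ s in a..b, ∑ k ∈ A with ξ - k ∈ B, ‖D ξ s k‖^2 ≤
      ∫ s in a..b, 2 * (nrm A (g₁ s) * nrm B (v₂ s) + nrm A (v₁ s) * nrm B (g₂ s)) := by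
    rw [← intervalIntegral.integral_finsetSum fun ξ _ => hDii ξ]
    have hS : IntervalIntegrable (fun s => ∑ ξ ∈ X, ∑ k ∈ A with ξ - k ∈ B, ‖D ξ s k‖^2)
        volume a b := by
      have := IntervalIntegrable.sum X (f := fun ξ s => ∑ k ∈ A with ξ - k ∈ B, ‖D ξ s k‖^2)
        (μ := volume) (a := a) (b := b) (fun ξ _ => hDii ξ)
      have e : (fun s => ∑ ξ ∈ X, ∑ k ∈ A with ξ - k ∈ B, ‖D ξ s k‖^2) =
          ∑ ξ ∈ X, fun s => ∑ k ∈ A with ξ - k ∈ B, ‖D ξ s k‖^2 := by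
        ext s
        simp
      rw [e]
      exact this
    refine intervalIntegral.integral_mono_on hab hS hrhs ?_
    intro s _
    calc _ ≤ ∑ ξ ∈ X, ∑ k ∈ A with ξ - k ∈ B, (2 * ‖α ξ k * (g₁ s k * v₂ s (ξ - k))‖^2 +
          2 * ‖α ξ k * (v₁ s k * g₂ s (ξ - k))‖^2) := by
          refine Finset.sum_le_sum fun ξ _ => Finset.sum_le_sum fun k _ => ?_
          simp only [hDdef, mul_add]
          have e5 := norm_add_le (α ξ k * (g₁ s k * v₂ s (ξ - k))) (α ξ k * (v₁ s k * g₂ s (ξ - k)))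
          have e6 := pow_le_pow_left₀ (norm_nonneg _) e5 2
          nlinarith [sq_nonneg (‖α ξ k * (g₁ s k * v₂ s (ξ - k))‖ -
            ‖α ξ k * (v₁ s k * g₂ s (ξ - k))‖)]
      _ = 2 * (∑ ξ ∈ X, ∑ k ∈ A with ξ - k ∈ B, ‖α ξ k * (g₁ s k * v₂ s (ξ - k))‖^2) +
          2 * ∑ ξ ∈ X, ∑ k ∈ A with ξ - k ∈ B, ‖α ξ k * (v₁ s k * g₂ s (ξ - k))‖^2 := by
          simp_rw [Finset.sum_add_distrib, Finset.mul_sum]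
      _ ≤ _ := by
          have := nrm_sum_mul_le X A B α hα (g₁ s) (v₂ s)
          have := nrm_sum_mul_le X A B α hα (v₁ s) (g₂ s)
          linarith
  unfold nrm at *
  rw [intervalIntegral.integral_finsetSum fun ξ _ => (hbc ξ).intervalIntegrable _ _]
  refine (Finset.sum_le_sum fun ξ _ => hE ξ).trans ?_
  rw [Finset.sum_add_distrib, ← Finset.mul_sum, ← Finset.mul_sum]
  refine add_le_add (mul_le_mul_of_nonneg_left ?_ (by positivity))
    (mul_le_mul_of_nonneg_left hsumD (mul_nonneg (by linarith) hκ))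
  exact nrm_sum_mul_le X A B α hα (v₁ t₀) (v₂ t₀)

/-- structural hypotheses on the profile `v` and its time derivative `g` -/
structure Prof (v g : ℝ → ℤ → ℂ) : Prop where
  hv : ∀ k, BM fun t => v t k
  hg : ∀ k, BM fun t => g t k
  hp : ∀ k, Prim (fun t => v t k) (fun t => g t k)

theorem bil_cont (A B : Finset ℤ) (p : ℝ → ℝ) (α : ℤ → ℤ → ℂ) (v₁ v₂ g₁ g₂ : ℝ → ℤ → ℂ)
    (h₁ : Prof v₁ g₁) (h₂ : Prof v₂ g₂) (X : Finset ℤ) :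
    Continuous fun t => nrm X (bil A B p α v₁ v₂ t) := by
  have h1 : ∀ k, Continuous fun t => v₁ t k := fun k => (h₁.hp k).cont (h₁.hg k)
  have h2 : ∀ k, Continuous fun t => v₂ t k := fun k => (h₂.hp k).cont (h₂.hg k)
  unfold nrm bil
  fun_prop

theorem core_int (c : ℝ) (hc : 0 < c) (X A B : Finset ℤ) (p : ℝ → ℝ) (N : ℝ) (hN : 0 < N)
    (hsep : ∀ ξ : ℤ, ∀ k ∈ A, ∀ l ∈ A, ξ - k ∈ B → ξ - l ∈ B →
      c * N * |(k:ℝ) - l| ≤ |(p k + p ((ξ - k : ℤ):ℝ)) - (p l + p ((ξ - l : ℤ):ℝ))|)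
    (α : ℤ → ℤ → ℂ) (hα : ∀ ξ k, ‖α ξ k‖ ≤ 1)
    (v₁ v₂ g₁ g₂ : ℝ → ℤ → ℂ) (h₁ : Prof v₁ g₁) (h₂ : Prof v₂ g₂)
    (y : ℝ → ℝ) (M L : ℝ) (hM0 : 0 ≤ M) (hL0 : 0 ≤ L)
    (a b : ℝ) (hab : a ≤ b) (hlen : (b - a) * N ≤ 1)
    (hyi : IntervalIntegrable y volume a b) (hy0 : ∀ s, 0 ≤ y s)
    (hy : ∀ s ∈ Ioo a b, nrm A (g₁ s) ≤ 4 * N^2 * y s)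
    (hM : ∀ s ∈ Ioo a b, nrm B (v₂ s) ≤ M)
    (hL : ∀ s ∈ Ioo a b, nrm B (g₂ s) ≤ 4 * N^2 * L) :
    (b - a) * ∫ t in a..b, nrm X (bil A B p α v₁ v₂ t) ≤
      18 * (KG c / N) * (((∫ t in a..b, nrm A (v₁ t)) + ∫ t in a..b, y t) * (M + L)) := by
  set κ := KG c / N with hκdef
  have hκ : 0 ≤ κ := by have := KG_pos c hc; positivity
  set Q := ∫ t in a..b, nrm X (bil A B p α v₁ v₂ t) with hQ
  set n1 := ∫ t in a..b, nrm A (v₁ t) with hn1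
  set y1 := ∫ t in a..b, y t with hy1
  have hn10 : 0 ≤ n1 := intervalIntegral.integral_nonneg hab fun t _ => nrm_nonneg _ _
  have hy10 : 0 ≤ y1 := intervalIntegral.integral_nonneg hab fun t _ => hy0 _
  have hnn : ∀ (x y : ℝ → ℤ → ℂ), (∀ k, BM fun t => x t k) → (∀ k, BM fun t => y t k) →
      IntervalIntegrable (fun s => nrm A (x s) * nrm B (y s)) volume a b := by
    intro x y hx hy
    obtain ⟨m1, B1, hB1⟩ := nrm_bdd (A := A) hx
    obtain ⟨m2, B2, hB2⟩ := nrm_bdd (A := B) hy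
    refine bdd_ii (m1.mul m2) (B := B1 * B2) (fun t => ?_) a b
    simp only [Pi.mul_apply]
    rw [abs_mul]
    exact mul_le_mul (hB1 t) (hB2 t) (abs_nonneg _) ((abs_nonneg _).trans (hB1 0))
  have hn1i : IntervalIntegrable (fun t => nrm A (v₁ t)) volume a b := nrm_ii h₁.hv a b
  have hI : ∫ s in a..b, 2 * (nrm A (g₁ s) * nrm B (v₂ s) + nrm A (v₁ s) * nrm B (g₂ s)) ≤
      8 * N^2 * (M * y1 + L * n1) := by
    calc _ ≤ ∫ s in a..b, 8 * N^2 * (M * y s + L * nrm A (v₁ s)) := by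
          refine intervalIntegral.integral_mono_on_of_le_Ioo hab
            (((hnn _ _ h₁.hg h₂.hv).add (hnn _ _ h₁.hv h₂.hg)).const_mul 2)
            (((hyi.const_mul M).add (hn1i.const_mul L)).const_mul _) ?_
          intro s hs
          have e1 := mul_le_mul (hy s hs) (hM s hs) (nrm_nonneg _ _)
            (mul_nonneg (by positivity) (hy0 s))
          have e2 := mul_le_mul_of_nonneg_left (hL s hs) (nrm_nonneg A (v₁ s))
          nlinarith
      _ = _ := by
          rw [intervalIntegral.integral_const_mul, intervalIntegral.integral_add
            (hyi.const_mul M) (hn1i.const_mul L), intervalIntegral.integral_const_mul,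
            intervalIntegral.integral_const_mul]
  have hpt : ∀ t₀ ∈ Ioo a b, Q ≤ 2 * κ * M * nrm A (v₁ t₀) +
      2 * (b - a) * κ * (8 * N^2 * (M * y1 + L * n1)) := by
    intro t₀ ht₀
    have h := core_pt c hc X A B p N hN hsep α hα v₁ v₂ g₁ g₂ h₁.hv h₂.hv h₁.hg h₂.hg h₁.hp h₂.hp
      a b hab hlen t₀ (Ioo_subset_Icc_self ht₀)
    refine h.trans (add_le_add ?_ (mul_le_mul_of_nonneg_left hI
      (mul_nonneg (by linarith) hκ)))
    have := mul_le_mul_of_nonneg_left (hM t₀ ht₀)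
      (mul_nonneg (mul_nonneg zero_le_two hκ) (nrm_nonneg A (v₁ t₀)))
    calc _ = 2 * κ * nrm A (v₁ t₀) * nrm B (v₂ t₀) := by ring
      _ ≤ _ := this
      _ = _ := by ring
  have hgint := intervalIntegral.integral_mono_on_of_le_Ioo hab
    (intervalIntegrable_const (c := Q) (μ := volume))
    ((hn1i.const_mul (2 * κ * M)).add intervalIntegrable_const) hpt
  rw [intervalIntegral.integral_const, smul_eq_mul, intervalIntegral.integral_add
    (hn1i.const_mul (2 * κ * M)) intervalIntegrable_const, intervalIntegral.integral_const_mul,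
    intervalIntegral.integral_const, smul_eq_mul] at hgint
  have hd : ((b - a) * N)^2 ≤ 1 := pow_le_one₀ (mul_nonneg (by linarith) hN.le) hlen
  have hz : 0 ≤ M * y1 + L * n1 := by positivity
  calc _ ≤ _ := hgint
    _ = 2 * κ * (M * n1) + 16 * κ * (((b - a) * N)^2 * (M * y1 + L * n1)) := by ring
    _ ≤ 2 * κ * (M * n1) + 16 * κ * (1 * (M * y1 + L * n1)) := by gcongr
    _ ≤ _ := by
      have h3 : 0 ≤ κ * (M * n1) := by positivity
      have h4 : 0 ≤ κ * (M * y1) := by positivity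
      have h5 : 0 ≤ κ * (L * n1) := by positivity
      have h6 : 0 ≤ κ * (L * y1) := by positivity
      nlinarith

theorem core_total (c : ℝ) (hc : 0 < c) (X A B : Finset ℤ) (p : ℝ → ℝ) (N : ℝ) (hN : 1 ≤ N)
    (hsep : ∀ ξ : ℤ, ∀ k ∈ A, ∀ l ∈ A, ξ - k ∈ B → ξ - l ∈ B →
      c * N * |(k:ℝ) - l| ≤ |(p k + p ((ξ - k : ℤ):ℝ)) - (p l + p ((ξ - l : ℤ):ℝ))|)
    (α : ℤ → ℤ → ℂ) (hα : ∀ ξ k, ‖α ξ k‖ ≤ 1)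
    (v₁ v₂ g₁ g₂ : ℝ → ℤ → ℂ) (h₁ : Prof v₁ g₁) (h₂ : Prof v₂ g₂)
    (y : ℝ → ℝ) (M L : ℝ) (hM0 : 0 ≤ M) (hL0 : 0 ≤ L)
    (T : ℝ) (hT : 0 < T) (hT1 : T < 1)
    (hyi : ∀ a b, IntervalIntegrable y volume a b) (hy0 : ∀ s, 0 ≤ y s)
    (hy : ∀ s ∈ Ioo 0 T, nrm A (g₁ s) ≤ 4 * N^2 * y s)
    (hM : ∀ s ∈ Ioo 0 T, nrm B (v₂ s) ≤ M)
    (hL : ∀ s ∈ Ioo 0 T, nrm B (g₂ s) ≤ 4 * N^2 * L) :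
    ∫ t in (0:ℝ)..T, nrm X (bil A B p α v₁ v₂ t) ≤
      36 * KG c * T⁻¹ * (((∫ t in (0:ℝ)..T, nrm A (v₁ t)) + ∫ t in (0:ℝ)..T, y t) * (M + L)) := by
  have hN0 : 0 < N := by linarith
  have hK := KG_pos c hc
  set n := ⌈T * N⌉₊ with hn
  have hnpos : 0 < n := Nat.ceil_pos.mpr (by positivity)
  have hn' : (0:ℝ) < n := by exact_mod_cast hnpos
  have hn1 : T * N ≤ n := Nat.le_ceil _
  have hn2 : (n:ℝ) ≤ 2 * N := by
    have := (Nat.ceil_lt_add_one (show 0 ≤ T * N by positivity)).le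
    nlinarith
  set δ := T / n with hδ
  have hδ0 : 0 < δ := by positivity
  have hδN : δ * N ≤ 1 := by
    rw [hδ, div_mul_eq_mul_div, div_le_one hn']; exact hn1
  have hnδ : n * δ = T := by rw [hδ]; field_simp
  set a : ℕ → ℝ := fun i => i * δ with ha
  have ha0 : a 0 = 0 := by simp [ha]
  have han : a n = T := hnδ
  have hstep : ∀ i, a (i+1) - a i = δ := by intro i; simp only [ha]; push_cast; ring
  have hsub : ∀ i < n, Ioo (a i) (a (i+1)) ⊆ Ioo 0 T := by
    intro i hi
    refine Ioo_subset_Ioo ?_ ?_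
    · simp only [ha]; positivity
    · rw [← hnδ]; simp only [ha]
      refine mul_le_mul_of_nonneg_right ?_ hδ0.le
      exact_mod_cast hi
  have hci : ∀ x y, IntervalIntegrable (fun t => nrm X (bil A B p α v₁ v₂ t)) volume x y :=
    fun x y => (bil_cont A B p α v₁ v₂ g₁ g₂ h₁ h₂ X).intervalIntegrable _ _
  have s1 := intervalIntegral.sum_integral_adjacent_intervals (a := a) (n := n) (μ := volume)
    (f := fun t => nrm X (bil A B p α v₁ v₂ t)) fun k _ => hci _ _
  have s2 := intervalIntegral.sum_integral_adjacent_intervals (a := a) (n := n) (μ := volume)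
    (f := fun t => nrm A (v₁ t)) fun k _ => nrm_ii h₁.hv _ _
  have s3 := intervalIntegral.sum_integral_adjacent_intervals (a := a) (n := n) (μ := volume)
    (f := y) fun k _ => hyi _ _
  rw [ha0, han] at s1 s2 s3
  have key : δ * ∫ t in (0:ℝ)..T, nrm X (bil A B p α v₁ v₂ t) ≤ 18 * (KG c / N) *
      (((∫ t in (0:ℝ)..T, nrm A (v₁ t)) + ∫ t in (0:ℝ)..T, y t) * (M + L)) := by
    rw [← s1, ← s2, ← s3, Finset.mul_sum, ← Finset.sum_add_distrib, Finset.sum_mul, Finset.mul_sum]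
    refine Finset.sum_le_sum fun i hi => ?_
    have hi' := hsub i (Finset.mem_range.mp hi)
    have := core_int c hc X A B p N hN0 hsep α hα v₁ v₂ g₁ g₂ h₁ h₂ y M L hM0 hL0 (a i) (a (i+1))
      (by linarith [hstep i]) (by rw [hstep]; exact hδN) (hyi _ _) hy0
      (fun s hs => hy s (hi' hs)) (fun s hs => hM s (hi' hs)) (fun s hs => hL s (hi' hs))
    rwa [hstep] at this
  set Z := (((∫ t in (0:ℝ)..T, nrm A (v₁ t)) + ∫ t in (0:ℝ)..T, y t) * (M + L)) with hZ
  have hZ0 : 0 ≤ Z := by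
    refine mul_nonneg (add_nonneg ?_ ?_) (by linarith)
    · exact intervalIntegral.integral_nonneg hT.le fun t _ => nrm_nonneg _ _
    · exact intervalIntegral.integral_nonneg hT.le fun t _ => hy0 _
  set Q := ∫ t in (0:ℝ)..T, nrm X (bil A B p α v₁ v₂ t) with hQ
  have h1 : Q ≤ 18 * (KG c / N) * Z / δ := by
    rw [le_div_iff₀ hδ0, mul_comm]; exact key
  refine h1.trans ?_
  have h2 : 18 * (KG c / N) * Z / δ = 18 * KG c * T⁻¹ * Z * (n / N) := by
    rw [hδ]; field_simp
  have h3 : (n:ℝ) / N ≤ 2 := by rw [div_le_iff₀ hN0]; exact hn2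
  rw [h2]
  calc _ ≤ 18 * KG c * T⁻¹ * Z * 2 := by gcongr
    _ = _ := by ring

theorem bil_bernstein (X A B : Finset ℤ) (p : ℝ → ℝ)
    (α : ℤ → ℤ → ℂ) (hα : ∀ ξ k, ‖α ξ k‖ ≤ 1)
    (v₁ v₂ : ℝ → ℤ → ℂ) (R : ℝ) (hR : min (A.card : ℝ) B.card ≤ R) (t : ℝ) :
    nrm X (bil A B p α v₁ v₂ t) ≤ R * (nrm A (v₁ t) * nrm B (v₂ t)) := by
  have hR0 : 0 ≤ R := le_trans (le_min (by positivity) (by positivity)) hR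
  have he : ∀ (w : ℝ), ‖cexp (I * w * t)‖ = 1 := by
    intro w
    rw [show I * (w : ℂ) * t = ((w * t : ℝ) : ℂ) * I by push_cast; ring,
      Complex.norm_exp_ofReal_mul_I]
  refine le_trans ?_ (mul_le_mul_of_nonneg_left
    (nrm_sum_mul_le X A B α hα (v₁ t) (v₂ t)) hR0)
  unfold nrm
  rw [Finset.mul_sum]
  refine Finset.sum_le_sum fun ξ _ => ?_
  have hcard : ((A.filter fun k => ξ - k ∈ B).card : ℝ) ≤ R := by
    refine le_trans (le_min ?_ ?_) hR
    · exact_mod_cast Finset.card_filter_le _ _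
    · have : (A.filter fun k => ξ - k ∈ B).card ≤ B.card := by
        refine Finset.card_le_card_of_injOn (fun k => ξ - k) ?_ ?_
        · intro k hk
          exact (Finset.mem_filter.mp hk).2
        · intro x _ y _ hxy
          simpa using hxy
      exact_mod_cast this
  have h1 : ‖bil A B p α v₁ v₂ t ξ‖ ≤ ∑ k ∈ A with ξ - k ∈ B, ‖α ξ k * (v₁ t k * v₂ t (ξ - k))‖ := by
    refine (norm_sum_le _ _).trans (le_of_eq (Finset.sum_congr rfl fun k _ => ?_))
    rw [norm_mul, he, mul_one]
  refine (pow_le_pow_left₀ (norm_nonneg _) h1 2).trans ?_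
  refine sq_sum_le_card_mul_sum_sq.trans ?_
  exact mul_le_mul_of_nonneg_right hcard (Finset.sum_nonneg fun _ _ => by positivity)

/-! ### Separation of the resonance function -/

theorem sep_real (α ξ₀ c₀ C₀ : ℝ) (hα : α ∈ Set.Icc (1:ℝ) 2)
    (p : ℝ → ℝ) (hp : Hyp1 α ξ₀ c₀ C₀ p) :
    ∃ K₀ : ℝ, 1 ≤ K₀ ∧ ∃ c : ℝ, 0 < c ∧ ∀ N m : ℝ, 1 ≤ m → K₀ * m ≤ N → ∀ ξ x y : ℝ,
      N / 2 ≤ |x| → N / 2 ≤ |y| → |ξ - x| ≤ 2 * m → |ξ - y| ≤ 2 * m →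
      c * N * |x - y| ≤ |(p x + p (ξ - x)) - (p y + p (ξ - y))| := by
  obtain ⟨hξ0, hc0, hcC, hsm, -, hodd, hlb, hub, -, -⟩ := hp
  have hdiff : Differentiable ℝ p := hsm.differentiable one_ne_zero
  have hdc : Continuous (deriv p) := hsm.continuous_deriv le_rfl
  have heven : ∀ z, deriv p (-z) = deriv p z := by
    intro z
    have h1 : (fun x => p (-x)) = fun x => - p x := funext hodd
    have h2 := congrArg (fun f => deriv f z) h1
    simp only [deriv_comp_neg, deriv.fun_neg] at h2
    linarith
  have habs : ∀ z, deriv p |z| = deriv p z := by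
    intro z
    rcases abs_choice z with h | h <;> rw [h]
    exact heven z
  obtain ⟨M, hM⟩ := (isCompact_Icc (a := -ξ₀) (b := ξ₀)).exists_bound_of_continuousOn
    hdc.continuousOn
  have hM0 : 0 ≤ M := (norm_nonneg _).trans (hM 0 ⟨by linarith, hξ0.le⟩)
  have hC0 : 0 < C₀ := lt_of_lt_of_le hc0 hcC
  have hMc : 0 ≤ M / c₀ := by positivity
  have hCc : 0 ≤ C₀ / c₀ := by positivity
  set K₀ := 16 + 2 * ξ₀ + 8 * (M / c₀) + 16 * (C₀ / c₀) with hK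
  refine ⟨K₀, by linarith, c₀ / 4, by positivity, ?_⟩
  intro N m hm hNm
  have hKN : K₀ ≤ N := by nlinarith
  have hN16 : 16 ≤ N := by linarith
  have hNm16 : 16 * m ≤ N := by nlinarith
  set G := (N / 2) ^ α with hG
  have hG1 : N / 2 ≤ G := by
    have := Real.rpow_le_rpow_of_exponent_le (show 1 ≤ N / 2 by linarith) hα.1
    rwa [Real.rpow_one] at this
  have hlarge : ∀ z, N / 2 ≤ |z| → c₀ * G ≤ deriv p z := by
    intro z hz
    rw [← habs z]
    refine le_trans ?_ (hlb |z| (by linarith))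
    refine mul_le_mul_of_nonneg_left ?_ hc0.le
    exact Real.rpow_le_rpow (by linarith) hz (by linarith [hα.1])
  have hsmall : ∀ z, |z| ≤ 2 * m → deriv p z ≤ c₀ / 2 * G := by
    intro z hz
    rcases le_total |z| ξ₀ with h | h
    · have h1 := hM z (abs_le.mp h)
      have h2 := (Real.le_norm_self _).trans h1
      have h3 : 4 * (M / c₀) ≤ G := by linarith
      have h4 : c₀ * (M / c₀) = M := by field_simp
      nlinarith
    · rw [← habs z]
      refine (hub |z| h).trans ?_
      have h1 : |z| ^ α ≤ (2 * m) ^ α :=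
        Real.rpow_le_rpow (abs_nonneg _) hz (by linarith [hα.1])
      have h2 : G = (2 * m) ^ α * (N / (4 * m)) ^ α := by
        rw [hG, ← Real.mul_rpow (by positivity) (by positivity)]
        congr 1
        field_simp
        ring
      have h3 : K₀ / 4 ≤ N / (4 * m) := by
        rw [div_le_div_iff₀ (by norm_num) (by positivity)]
        nlinarith
      have h4 : N / (4 * m) ≤ (N / (4 * m)) ^ α := by
        have := Real.rpow_le_rpow_of_exponent_le (show 1 ≤ N / (4 * m) by linarith) hα.1
        rwa [Real.rpow_one] at this
      have h5 : 4 * (C₀ / c₀) ≤ (N / (4 * m)) ^ α := by linarith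
      have h6 : 0 ≤ (2 * m) ^ α := by positivity
      have h7 : (2 * m) ^ α * (4 * (C₀ / c₀)) ≤ G := by
        rw [h2]; exact mul_le_mul_of_nonneg_left h5 h6
      have h8 : c₀ * (C₀ / c₀) = C₀ := by field_simp
      have h9 : C₀ * |z|^α ≤ C₀ * (2 * m)^α := mul_le_mul_of_nonneg_left h1 hC0.le
      have h10 := mul_le_mul_of_nonneg_left h7 hc0.le
      have h11 : c₀ * ((2 * m) ^ α * (4 * (C₀ / c₀))) = 4 * (C₀ * (2*m)^α) := by
        rw [← h8]; field_simp
      have h12 : 0 ≤ C₀ * (2 * m)^α := by positivity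
      linarith
  have main : ∀ ξ x y : ℝ, x ≤ y →
      N / 2 ≤ |x| → N / 2 ≤ |y| → |ξ - x| ≤ 2 * m → |ξ - y| ≤ 2 * m →
      c₀ / 4 * N * (y - x) ≤ (p y + p (ξ - y)) - (p x + p (ξ - x)) := by
    intro ξ x y hxy hx hy hξx hξy
    rw [abs_le] at hξx hξy
    have hz : ∀ z ∈ Icc x y, N / 2 ≤ |z| := by
      intro z hz
      rcases le_abs.mp hx with h1 | h1
      · exact le_abs.mpr (Or.inl (h1.trans hz.1))
      · rcases le_abs.mp hy with h2 | h2
        · linarith [hξx.1, hξx.2, hξy.1, hξy.2]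
        · exact le_abs.mpr (Or.inr (by linarith [hz.2]))
    have hd : ∀ z, HasDerivAt (fun z => p z + p (ξ - z)) (deriv p z - deriv p (ξ - z)) z := by
      intro z
      have h1 := (hdiff z).hasDerivAt
      have h2 := (hdiff (ξ - z)).hasDerivAt.comp_const_sub ξ z
      have h3 := h1.fun_add h2
      rw [← sub_eq_add_neg] at h3
      exact h3
    refine Convex.mul_sub_le_image_sub_of_le_deriv (convex_Icc x y)
      (f := fun z => p z + p (ξ - z))
      (fun z _ => (hd z).continuousAt.continuousWithinAt)
      (fun z _ => (hd z).differentiableAt.differentiableWithinAt) ?_ x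
      (left_mem_Icc.mpr hxy) y (right_mem_Icc.mpr hxy) hxy
    intro z hz'
    have hz'' := interior_subset hz'
    rw [(hd z).deriv]
    have h1 := hlarge z (hz z hz'')
    have h2 := hsmall (ξ - z) (abs_le.mpr ⟨by linarith [hz''.1, hz''.2], by linarith [hz''.1, hz''.2]⟩)
    nlinarith
  intro ξ x y hx hy hξx hξy
  rcases le_total x y with h | h
  · have := main ξ x y h hx hy hξx hξy
    rw [abs_sub_comm x y, abs_of_nonneg (sub_nonneg.mpr h), abs_sub_comm]
    exact this.trans (le_abs_self _)
  · have := main ξ y x h hy hx hξy hξx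
    rw [abs_of_nonneg (sub_nonneg.mpr h)]
    exact this.trans (le_abs_self _)

/-- the frequency annulus at scale `2^n` -/
def Ann (n : ℕ) : Finset ℤ :=
  (Finset.Icc (-(2^(n+1))) (2^(n+1))).filter fun k => (2:ℝ)^n / 2 ≤ |(k:ℝ)|

theorem mem_Ann_iff (n : ℕ) (k : ℤ) :
    k ∈ Ann n ↔ |(k:ℝ)| ≤ 2 * 2^n ∧ (2:ℝ)^n / 2 ≤ |(k:ℝ)| := by
  unfold Ann
  rw [Finset.mem_filter, Finset.mem_Icc, abs_le]
  refine and_congr_left fun _ => and_congr ?_ ?_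
  · rw [← Int.cast_le (R := ℝ)]
    push_cast
    rw [pow_succ, mul_comm]
  · rw [← Int.cast_le (R := ℝ)]
    push_cast
    rw [pow_succ, mul_comm]

theorem card_Ann (n : ℕ) : ((Ann n).card : ℝ) ≤ 5 * 2^n := by
  have h1 : (Ann n).card ≤ (Finset.Icc (-(2^(n+1)) : ℤ) (2^(n+1))).card := Finset.card_filter_le _ _
  rw [Int.card_Icc] at h1
  have h2 : ((2^(n+1) + 1 - -(2^(n+1)) : ℤ).toNat : ℤ) = 2^(n+1) + 1 - -(2^(n+1)) :=
    Int.toNat_of_nonneg (by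
      have : (0:ℤ) < 2^(n+1) := by positivity
      linarith)
  have h3 : ((Ann n).card : ℤ) ≤ 2^(n+1) + 1 - -(2^(n+1)) := by rw [← h2]; exact_mod_cast h1
  have h4 : ((Ann n).card : ℝ) ≤ 2^(n+1) + 1 - -(2^(n+1)) := by exact_mod_cast h3
  have h5 : (1:ℝ) ≤ 2^n := one_le_pow₀ (by norm_num)
  rw [pow_succ] at h4
  linarith

theorem lpSymb_supp (χ : ℝ → ℝ) (hχ : CutoffFun χ) (n : ℕ) (k : ℤ) (hk : k ∉ Ann n) :
    lpSymb χ ((2:ℝ)^n) k = 0 := by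
  have h2 : (0:ℝ) < 2^n := by positivity
  unfold lpSymb
  rw [if_neg h2.ne']
  rw [mem_Ann_iff, not_and_or, not_le, not_le] at hk
  rcases hk with h | h
  · have z1 : χ (k / 2^n) = 0 := by
      by_contra hne
      have := hχ.compact_supp _ hne
      rw [Set.mem_Icc, ← abs_le, abs_div, abs_of_pos h2, div_le_iff₀ h2] at this
      linarith
    have z2 : χ (2 * k / 2^n) = 0 := by
      by_contra hne
      have := hχ.compact_supp _ hne
      rw [Set.mem_Icc, ← abs_le, abs_div, abs_of_pos h2, div_le_iff₀ h2, abs_mul, abs_two] at this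
      linarith
    rw [z1, z2, sub_zero]
  · have z1 : χ (k / 2^n) = 1 := by
      apply hχ.eq_one
      rw [Set.mem_Icc, ← abs_le, abs_div, abs_of_pos h2, div_le_iff₀ h2]
      linarith
    have z2 : χ (2 * k / 2^n) = 1 := by
      apply hχ.eq_one
      rw [Set.mem_Icc, ← abs_le, abs_div, abs_of_pos h2, div_le_iff₀ h2, abs_mul, abs_two]
      linarith
    rw [z1, z2, sub_self]

theorem interp_min (Q q T m θ : ℝ) (hq : 0 ≤ q) (hT : 0 < T) (hm : 0 < m)
    (hθ : θ ∈ Set.Icc (0:ℝ) 1) (h1 : Q ≤ q * T⁻¹) (h2 : Q ≤ q * m) :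
    Q ≤ q * (T ^ (θ - 1) * m ^ θ) := by
  have hmin : Q ≤ q * min T⁻¹ m := by
    rcases min_choice T⁻¹ m with h | h <;> rw [h] <;> assumption
  refine hmin.trans (mul_le_mul_of_nonneg_left ?_ hq)
  have hp : 0 < min T⁻¹ m := lt_min (inv_pos.mpr hT) hm
  have e1 : T ^ (θ - 1) = (T⁻¹) ^ (1 - θ) := by
    rw [Real.inv_rpow hT.le, ← Real.rpow_neg hT.le, neg_sub]
  rw [e1]
  calc min T⁻¹ m = (min T⁻¹ m)^(1 - θ) * (min T⁻¹ m)^θ := by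
        rw [← Real.rpow_add hp, sub_add_cancel, Real.rpow_one]
    _ ≤ _ := by
        refine mul_le_mul (Real.rpow_le_rpow hp.le (min_le_left _ _) (by linarith [hθ.2]))
          (Real.rpow_le_rpow hp.le (min_le_right _ _) hθ.1) (by positivity) (by positivity)

/-! ### From the frozen statement to profiles -/

theorem sep_int (p : ℝ → ℝ) (K₀ c : ℝ)
    (hs : ∀ N m : ℝ, 1 ≤ m → K₀ * m ≤ N → ∀ ξ x y : ℝ,
      N / 2 ≤ |x| → N / 2 ≤ |y| → |ξ - x| ≤ 2 * m → |ξ - y| ≤ 2 * m →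
      c * N * |x - y| ≤ |(p x + p (ξ - x)) - (p y + p (ξ - y))|)
    (n₁ n₂ : ℕ) (hK : K₀ * min ((2:ℝ) ^ n₁) ((2:ℝ) ^ n₂) ≤ max ((2:ℝ) ^ n₁) ((2:ℝ) ^ n₂)) :
    ∀ ξ : ℤ, ∀ k ∈ Ann n₁, ∀ l ∈ Ann n₁, ξ - k ∈ Ann n₂ → ξ - l ∈ Ann n₂ →
      c * max ((2:ℝ) ^ n₁) ((2:ℝ) ^ n₂) * |(k:ℝ) - l| ≤
        |(p k + p ((ξ - k : ℤ):ℝ)) - (p l + p ((ξ - l : ℤ):ℝ))| := by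
  intro ξ k hk l hl hk2 hl2
  rw [mem_Ann_iff] at hk hl hk2 hl2
  push_cast at hk2 hl2 ⊢
  have o1 : (1:ℝ) ≤ 2^n₁ := one_le_pow₀ (by norm_num)
  have o2 : (1:ℝ) ≤ 2^n₂ := one_le_pow₀ (by norm_num)
  rcases le_total ((2:ℝ)^n₁) ((2:ℝ)^n₂) with h | h
  · rw [min_eq_left h, max_eq_right h] at hK
    rw [max_eq_right h]
    have := hs _ _ o1 hK ξ ((ξ:ℝ) - k) ((ξ:ℝ) - l) hk2.2 hl2.2
      (by rw [sub_sub_cancel]; exact hk.1) (by rw [sub_sub_cancel]; exact hl.1)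
    rw [sub_sub_cancel, sub_sub_cancel, sub_sub_sub_cancel_left, abs_sub_comm (l:ℝ) k] at this
    rw [add_comm (p k), add_comm (p l)]
    exact this
  · rw [min_eq_right h, max_eq_left h] at hK
    rw [max_eq_left h]
    exact hs _ _ o2 hK ξ k l hk.2 hl.2 hk2.1 hl2.1

theorem norm_cexp_I (a t : ℝ) : ‖cexp (I * (a:ℂ) * t)‖ = 1 := by
  rw [show I * (a : ℂ) * t = ((a * t : ℝ) : ℂ) * I by push_cast; ring,
    Complex.norm_exp_ofReal_mul_I]

theorem profile (p χ : ℝ → ℝ) (T : ℝ) (U F : ℝ → ℤ → ℂ) (hF : MemLinfL2 T F)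
    (hS : Solves p T U F) (N : ℝ) :
    ∃ v g f : ℝ → ℤ → ℂ, Prof v g ∧ (∀ k, BM fun t => f t k) ∧
      (∀ t ∈ Icc (0:ℝ) T, ∀ k : ℤ, PN χ N (U t) k = cexp (I * (p k) * t) * v t k) ∧
      (∀ s ∈ Ioo (0:ℝ) T, ∀ k : ℤ, f s k = PN χ N (F s) k) ∧
      (∀ s (k : ℤ), ‖g s k‖ = |(k:ℝ)| * ‖f s k‖) := by
  obtain ⟨hsum, hmeas, M, hM⟩ := hF
  set f : ℝ → ℤ → ℂ := fun s k => (Ioo (0:ℝ) T).indicator (fun s => PN χ N (F s) k) s with hf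
  set g : ℝ → ℤ → ℂ := fun s k => (-(I * (k:ℂ)) * cexp (I * ((-p k : ℝ):ℂ) * s)) * f s k with hg
  have hfB : ∀ k, BM fun t => f t k := by
    intro k
    refine ⟨?_, ‖(lpSymb χ N k : ℂ)‖ * √ M, fun t => ?_⟩
    · have : Measurable fun s => PN χ N (F s) k := (hmeas k).const_mul _
      exact this.indicator measurableSet_Ioo
    · by_cases ht : t ∈ Ioo (0:ℝ) T
      · simp only [hf, indicator_of_mem ht]
        unfold PN
        rw [norm_mul]
        refine mul_le_mul_of_nonneg_left (Real.le_sqrt_of_sq_le ?_) (norm_nonneg _)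
        refine le_trans ?_ (hM t ht)
        exact (hsum t ht).le_tsum k fun _ _ => by positivity
      · simp only [hf, indicator_of_notMem ht, norm_zero]
        positivity
  have hgn : ∀ s (k : ℤ), ‖g s k‖ = |(k:ℝ)| * ‖f s k‖ := by
    intro s k
    simp only [hg]
    rw [norm_mul, norm_mul, norm_cexp_I, mul_one, norm_neg, norm_mul, norm_I, one_mul,
      Complex.norm_intCast]
  have hgB : ∀ k, BM fun t => g t k := by
    intro k
    refine BM.mul ⟨by fun_prop, |(k:ℝ)|, fun t => ?_⟩ (hfB k)
    rw [norm_mul, norm_cexp_I, mul_one, norm_neg, norm_mul, norm_I, one_mul,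
      Complex.norm_intCast]
  have hgI : ∀ k, Integrable fun t => g t k := by
    intro k
    obtain ⟨hm, B, hB⟩ := hgB k
    have h1 : IntegrableOn (fun t => g t k) (Ioo 0 T) :=
      Measure.integrableOn_of_bounded (M := B) (by simp) hm.aestronglyMeasurable
        (Eventually.of_forall hB)
    refine h1.integrable_of_forall_notMem_eq_zero fun t ht => ?_
    simp only [hg, hf, indicator_of_notMem ht, mul_zero]
  set v : ℝ → ℤ → ℂ := fun t k => PN χ N (U 0) k + ∫ s in (0:ℝ)..t, g s k with hv
  have hP : ∀ k, Prim (fun t => v t k) (fun t => g t k) := by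
    intro k s t
    simp only [hv]
    rw [add_sub_add_left_eq_sub]
    exact intervalIntegral.integral_interval_sub_left ((hgB k).ii _ _) ((hgB k).ii _ _)
  refine ⟨v, g, f, ⟨fun k => ⟨((hP k).cont (hgB k)).measurable,
    ‖PN χ N (U 0) k‖ + ∫ s, ‖g s k‖, fun t => ?_⟩, hgB, hP⟩, hfB, ?_, ?_, hgn⟩
  · simp only [hv]
    refine (norm_add_le _ _).trans (add_le_add le_rfl ?_)
    refine intervalIntegral.norm_integral_le_integral_norm_uIoc.trans ?_
    exact setIntegral_le_integral (hgI k).norm (Eventually.of_forall fun _ => norm_nonneg _)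
  · intro t ht k
    simp only [hv, PN]
    rw [hS k t ht]
    have h1 : ∫ s in (0:ℝ)..t, g s k = - ((lpSymb χ N k : ℂ) * (cexp (-(I * (p k) * t)) * ∫ s in (0:ℝ)..t,
        cexp (I * (p k) * (t - s)) * (I * (k:ℂ)) * F s k)) := by
      rw [← intervalIntegral.integral_const_mul, ← intervalIntegral.integral_const_mul,
        ← intervalIntegral.integral_neg]
      rw [intervalIntegral.integral_of_le ht.1, intervalIntegral.integral_of_le ht.1,
        integral_Ioc_eq_integral_Ioo, integral_Ioc_eq_integral_Ioo]
      refine setIntegral_congr_fun measurableSet_Ioo fun s hs => ?_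
      have hs' : s ∈ Ioo (0:ℝ) T := ⟨hs.1, hs.2.trans_le ht.2⟩
      simp only [hg, hf, indicator_of_mem hs', PN]
      have h2 : cexp (I * ((-p k : ℝ):ℂ) * s) = cexp (-(I * (p k) * t)) * cexp (I * (p k) * (t - s)) := by
        rw [← Complex.exp_add]
        congr 1
        push_cast
        ring
      rw [h2]
      ring
    rw [h1]
    have h3 : cexp (I * (p k) * t) * cexp (-(I * (p k) * t)) = 1 := by
      rw [← Complex.exp_add, add_neg_cancel, Complex.exp_zero]
    linear_combination ((lpSymb χ N k : ℂ) * ∫ s in (0:ℝ)..t,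
        cexp (I * (p k) * (t - s)) * (I * (k:ℂ)) * F s k) * h3
  · intro s hs k
    simp only [hf, indicator_of_mem hs]

theorem PN_zero (χ : ℝ → ℝ) (hχ : CutoffFun χ) (n : ℕ) (u : ℤ → ℂ) (k : ℤ) (hk : k ∉ Ann n) :
    PN χ ((2:ℝ)^n) u k = 0 := by
  unfold PN
  rw [lpSymb_supp χ hχ n k hk, ofReal_zero, zero_mul]

theorem l2sq_eq_nrm (χ : ℝ → ℝ) (hχ : CutoffFun χ) (n : ℕ) (u z : ℤ → ℂ)
    (h : ∀ k, ‖PN χ ((2:ℝ)^n) u k‖ = ‖z k‖) : l2sq (PN χ ((2:ℝ)^n) u) = nrm (Ann n) z := by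
  unfold l2sq nrm
  rw [tsum_eq_sum (s := Ann n)]
  · exact Finset.sum_congr rfl fun k _ => by rw [h k]
  · intro k hk
    rw [PN_zero χ hχ n u k hk, norm_zero, zero_pow two_ne_zero]

theorem l2sq_Lam (χ : ℝ → ℝ) (hχ : CutoffFun χ) (p : ℝ → ℝ) (n₁ n₂ : ℕ) (a : ℝ → ℝ → ℂ)
    (u₁ u₂ : ℤ → ℂ) (v₁ v₂ : ℝ → ℤ → ℂ) (t : ℝ)
    (h₁ : ∀ k : ℤ, PN χ ((2:ℝ)^n₁) u₁ k = cexp (I * (p k) * t) * v₁ t k)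
    (h₂ : ∀ k : ℤ, PN χ ((2:ℝ)^n₂) u₂ k = cexp (I * (p k) * t) * v₂ t k) :
    l2sq (Lam a (PN χ ((2:ℝ)^n₁) u₁) (PN χ ((2:ℝ)^n₂) u₂)) =
      nrm (Finset.Icc (-(2^(n₁+1) + 2^(n₂+1))) (2^(n₁+1) + 2^(n₂+1)))
        (bil (Ann n₁) (Ann n₂) p (fun ξ k => a k ((ξ:ℝ) - k)) v₁ v₂ t) := by
  have hL : ∀ ξ, Lam a (PN χ ((2:ℝ)^n₁) u₁) (PN χ ((2:ℝ)^n₂) u₂) ξ =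
      bil (Ann n₁) (Ann n₂) p (fun ξ k => a k ((ξ:ℝ) - k)) v₁ v₂ t ξ := by
    intro ξ
    unfold Lam bil
    rw [tsum_eq_sum (s := (Ann n₁).filter fun k => ξ - k ∈ Ann n₂)]
    · refine Finset.sum_congr rfl fun k _ => ?_
      rw [h₁, h₂]
      have : cexp (I * ((p k + p ((ξ - k : ℤ):ℝ) : ℝ) : ℂ) * t) =
          cexp (I * (p k) * t) * cexp (I * (p ((ξ - k : ℤ):ℝ)) * t) := by
        rw [← Complex.exp_add]
        congr 1
        push_cast
        ring
      rw [this]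
      ring
    · intro k hk
      rw [Finset.mem_filter, not_and_or] at hk
      rcases hk with h | h
      · rw [PN_zero χ hχ n₁ u₁ k h, mul_zero, zero_mul]
      · rw [PN_zero χ hχ n₂ u₂ _ h, mul_zero]
  unfold l2sq nrm
  rw [tsum_eq_sum (s := Finset.Icc (-(2^(n₁+1) + 2^(n₂+1))) (2^(n₁+1) + 2^(n₂+1)))]
  · exact Finset.sum_congr rfl fun ξ _ => by rw [hL ξ]
  · intro ξ hξ
    rw [hL ξ]
    unfold bil
    rw [Finset.sum_eq_zero, norm_zero, zero_pow two_ne_zero]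
    intro k hk
    exfalso
    rw [Finset.mem_filter] at hk
    have e1 := (Finset.mem_Icc.mp (Finset.mem_filter.mp hk.1).1)
    have e2 := (Finset.mem_Icc.mp (Finset.mem_filter.mp hk.2).1)
    exact hξ (Finset.mem_Icc.mpr ⟨by linarith [e1.1, e2.1], by linarith [e1.2, e2.2]⟩)

theorem nrm_g_le (n : ℕ) (N : ℝ) (hN : (2:ℝ)^n ≤ N) (g f : ℤ → ℂ)
    (h : ∀ k : ℤ, ‖g k‖ = |(k:ℝ)| * ‖f k‖) : nrm (Ann n) g ≤ 4 * N^2 * nrm (Ann n) f := by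
  unfold nrm
  rw [Finset.mul_sum]
  refine Finset.sum_le_sum fun k hk => ?_
  rw [h k, mul_pow]
  refine mul_le_mul_of_nonneg_right ?_ (by positivity)
  have h1 := ((mem_Ann_iff n k).mp hk).1
  calc |(k:ℝ)|^2 ≤ (2 * N)^2 := pow_le_pow_left₀ (abs_nonneg _) (by linarith) 2
    _ = _ := by ring

theorem linf_bound (T : ℝ) (V : ℝ → ℤ → ℂ) (w : ℝ → ℝ) (h0 : ∀ t, 0 ≤ w t)
    (hB : ∃ B, ∀ t, |w t| ≤ B) (h : ∀ t ∈ Ioo (0:ℝ) T, l2sq (V t) = w t) :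
    0 ≤ LinfL2 T V ∧ ∀ t ∈ Ioo (0:ℝ) T, w t ≤ (LinfL2 T V)^2 := by
  obtain ⟨B, hB⟩ := hB
  have hn : 0 ≤ LinfL2 T V := by
    refine Real.iSup_nonneg fun t => ?_
    rw [h t t.2]
    exact Real.rpow_nonneg (h0 _) _
  refine ⟨hn, fun t ht => ?_⟩
  have hle : (l2sq (V t)) ^ ((1:ℝ)/2) ≤ LinfL2 T V := by
    refine le_ciSup (f := fun t : Set.Ioo (0:ℝ) T => (l2sq (V t)) ^ ((1:ℝ)/2)) ⟨B ^ ((1:ℝ)/2), ?_⟩ ⟨t, ht⟩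
    rintro _ ⟨s, rfl⟩
    simp only
    rw [h s s.2]
    exact Real.rpow_le_rpow (h0 _) ((le_abs_self _).trans (hB _)) (by norm_num)
  rw [h t ht, ← Real.sqrt_eq_rpow] at hle
  exact (Real.sqrt_le_left hn).mp hle

theorem L2normOn_eq (T : ℝ) (hT : 0 < T) (V : ℝ → ℤ → ℂ) (w : ℝ → ℝ)
    (h : ∀ t ∈ Ioo (0:ℝ) T, l2sq (V t) = w t) :
    L2normOn (Ioo 0 T) V = √ (∫ t in (0:ℝ)..T, w t) := by
  unfold L2normOn
  rw [← Real.sqrt_eq_rpow, intervalIntegral.integral_of_le hT.le, integral_Ioc_eq_integral_Ioo,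
    setIntegral_congr_fun measurableSet_Ioo h]

theorem final_alg (D Q T m θ x y A B : ℝ) (hD0 : 0 < D) (hT : 0 < T) (hm0 : 0 < m)
    (hx0 : 0 ≤ x) (hy0 : 0 ≤ y) (hA0 : 0 ≤ A) (hB0 : 0 ≤ B)
    (k3 : Q ≤ D * ((x + y) * (A^2 + B^2)) * (T ^ (θ - 1) * m ^ θ)) :
    √ Q ≤ √ D * T ^ ((θ - 1)/2) * m ^ (θ/2) * (√ x + √ y) * (A + B) := by
  have s1 : (T ^ ((θ - 1)/2))^2 = T ^ (θ - 1) := by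
    rw [← Real.rpow_natCast, ← Real.rpow_mul hT.le]
    congr 1
    push_cast
    ring
  have s2 : (m ^ (θ/2))^2 = m ^ θ := by
    rw [← Real.rpow_natCast, ← Real.rpow_mul hm0.le]
    congr 1
    push_cast
    ring
  refine Real.sqrt_le_iff.mpr ⟨by positivity, k3.trans ?_⟩
  rw [mul_pow, mul_pow, mul_pow, mul_pow, s1, s2, Real.sq_sqrt hD0.le]
  have z1 : x + y ≤ (√ x + √ y)^2 := by
    rw [add_sq, Real.sq_sqrt hx0, Real.sq_sqrt hy0]
    have : 0 ≤ 2 * √ x * √ y := by positivity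
    linarith
  have z2 : A^2 + B^2 ≤ (A + B)^2 := by nlinarith [mul_nonneg hA0 hB0]
  calc D * ((x + y) * (A^2 + B^2)) * (T ^ (θ - 1) * m ^ θ)
      = D * T ^ (θ - 1) * m ^ θ * ((x + y) * (A^2 + B^2)) := by ring
    _ ≤ D * T ^ (θ - 1) * m ^ θ * ((√ x + √ y)^2 * (A + B)^2) := by
        refine mul_le_mul_of_nonneg_left (mul_le_mul z1 z2 (by positivity) (by positivity)) ?_
        positivity
    _ = _ := by ring
/-- Improved bilinear Strichartz estimate II:
in the non-balanced case `N₁∨N₂ ≥ K₀ (N₁∧N₂)`, for every `θ ∈ [0,1]`,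
`‖Λ_a(P_{N₁}u₁,P_{N₂}u₂)‖_{L²(]0,T[×𝕋)} ≤ C T^{(θ-1)/2}(N₁∧N₂)^{θ/2} ⋯`. -/
theorem improved_bilinear_strichartz_II
    (α ξ₀ c₀ C₀ : ℝ) (hα : α ∈ Set.Icc (1:ℝ) 2)
    (p : ℝ → ℝ) (hp : Hyp1 α ξ₀ c₀ C₀ p)
    (χ : ℝ → ℝ) (hχ : CutoffFun χ) :
    ∃ K₀ : ℝ, 1 ≤ K₀ ∧ ∃ C : ℝ, 0 < C ∧
      ∀ (T : ℝ), 0 < T → T < 1 →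
      ∀ (a : ℝ → ℝ → ℂ), (∀ x y : ℝ, ‖a x y‖ ≤ 1) →
      ∀ (U₁ U₂ F₁ F₂ : ℝ → ℤ → ℂ),
        ContL2On T U₁ → ContL2On T U₂ →
        MemLinfL2 T F₁ → MemLinfL2 T F₂ →
        Solves p T U₁ F₁ → Solves p T U₂ F₂ →
        ∀ (n₁ n₂ : ℕ),
          K₀ * min ((2:ℝ) ^ n₁) ((2:ℝ) ^ n₂) ≤ max ((2:ℝ) ^ n₁) ((2:ℝ) ^ n₂) →
          ∀ θ : ℝ, θ ∈ Set.Icc (0:ℝ) 1 →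
          L2normOn (Set.Ioo 0 T)
              (fun t => Lam a (PN χ ((2:ℝ) ^ n₁) (U₁ t)) (PN χ ((2:ℝ) ^ n₂) (U₂ t))) ≤
            C * T ^ ((θ - 1)/2) *
              (min ((2:ℝ) ^ n₁) ((2:ℝ) ^ n₂)) ^ (θ/2) *
              (L2normOn (Set.Ioo 0 T) (fun t => PN χ ((2:ℝ) ^ n₁) (U₁ t)) +
                L2normOn (Set.Ioo 0 T) (fun t => PN χ ((2:ℝ) ^ n₁) (F₁ t))) *
              (LinfL2 T (fun t => PN χ ((2:ℝ) ^ n₂) (U₂ t)) +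
                LinfL2 T (fun t => PN χ ((2:ℝ) ^ n₂) (F₂ t))) := by
  obtain ⟨K₀, hK₀, c, hc, hs⟩ := sep_real α ξ₀ c₀ C₀ hα p hp
  have hKG := KG_pos c hc
  set D := 36 * KG c + 5 with hD
  have hD0 : 0 < D := by linarith
  refine ⟨K₀, hK₀, √ D, Real.sqrt_pos.mpr hD0, ?_⟩
  intro T hT hT1 a ha U₁ U₂ F₁ F₂ _ _ hF₁ hF₂ hS₁ hS₂ n₁ n₂ hK θ hθ
  obtain ⟨v₁, g₁, f₁, hP₁, hf₁, hU₁, hfF₁, hg₁⟩ := profile p χ T U₁ F₁ hF₁ hS₁ ((2:ℝ)^n₁)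
  obtain ⟨v₂, g₂, f₂, hP₂, hf₂, hU₂, hfF₂, hg₂⟩ := profile p χ T U₂ F₂ hF₂ hS₂ ((2:ℝ)^n₂)
  have hsep := sep_int p K₀ c hs n₁ n₂ hK
  have o1 : (1:ℝ) ≤ 2^n₁ := one_le_pow₀ (by norm_num)
  have o2 : (1:ℝ) ≤ 2^n₂ := one_le_pow₀ (by norm_num)
  set N := max ((2:ℝ) ^ n₁) ((2:ℝ) ^ n₂) with hN
  set m := min ((2:ℝ) ^ n₁) ((2:ℝ) ^ n₂) with hm
  have hm0 : 0 < m := lt_min (by positivity) (by positivity)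
  have hN1 : 1 ≤ N := o1.trans (le_max_left _ _)
  set α' : ℤ → ℤ → ℂ := fun ξ k => a k ((ξ:ℝ) - k) with hα'
  have hα1 : ∀ ξ k, ‖α' ξ k‖ ≤ 1 := fun ξ k => ha _ _
  set X : Finset ℤ := Finset.Icc (-(2^(n₁+1) + 2^(n₂+1))) (2^(n₁+1) + 2^(n₂+1)) with hX
  have eL : ∀ t ∈ Ioo (0:ℝ) T,
      l2sq (Lam a (PN χ ((2:ℝ) ^ n₁) (U₁ t)) (PN χ ((2:ℝ) ^ n₂) (U₂ t))) =
        nrm X (bil (Ann n₁) (Ann n₂) p α' v₁ v₂ t) := fun t ht =>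
    l2sq_Lam χ hχ p n₁ n₂ a (U₁ t) (U₂ t) v₁ v₂ t (hU₁ t (Ioo_subset_Icc_self ht))
      (hU₂ t (Ioo_subset_Icc_self ht))
  have eU₁ : ∀ t ∈ Ioo (0:ℝ) T, l2sq (PN χ ((2:ℝ) ^ n₁) (U₁ t)) = nrm (Ann n₁) (v₁ t) :=
    fun t ht => l2sq_eq_nrm χ hχ n₁ _ _ fun k => by
      rw [hU₁ t (Ioo_subset_Icc_self ht), norm_mul, norm_cexp_I, one_mul]
  have eU₂ : ∀ t ∈ Ioo (0:ℝ) T, l2sq (PN χ ((2:ℝ) ^ n₂) (U₂ t)) = nrm (Ann n₂) (v₂ t) :=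
    fun t ht => l2sq_eq_nrm χ hχ n₂ _ _ fun k => by
      rw [hU₂ t (Ioo_subset_Icc_self ht), norm_mul, norm_cexp_I, one_mul]
  have eF₁ : ∀ t ∈ Ioo (0:ℝ) T, l2sq (PN χ ((2:ℝ) ^ n₁) (F₁ t)) = nrm (Ann n₁) (f₁ t) :=
    fun t ht => l2sq_eq_nrm χ hχ n₁ _ _ fun k => by rw [hfF₁ t ht]
  have eF₂ : ∀ t ∈ Ioo (0:ℝ) T, l2sq (PN χ ((2:ℝ) ^ n₂) (F₂ t)) = nrm (Ann n₂) (f₂ t) :=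
    fun t ht => l2sq_eq_nrm χ hχ n₂ _ _ fun k => by rw [hfF₂ t ht]
  rw [L2normOn_eq T hT _ _ eL, L2normOn_eq T hT _ _ eU₁, L2normOn_eq T hT _ _ eF₁]
  obtain ⟨hA0, hA⟩ := linf_bound T (fun t => PN χ ((2:ℝ) ^ n₂) (U₂ t)) _
    (fun t => nrm_nonneg _ _) (nrm_bdd (A := Ann n₂) hP₂.hv).2 eU₂
  obtain ⟨hB0, hB⟩ := linf_bound T (fun t => PN χ ((2:ℝ) ^ n₂) (F₂ t)) _
    (fun t => nrm_nonneg _ _) (nrm_bdd (A := Ann n₂) hf₂).2 eF₂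
  set A := LinfL2 T (fun t => PN χ ((2:ℝ) ^ n₂) (U₂ t)) with hAdef
  set B := LinfL2 T (fun t => PN χ ((2:ℝ) ^ n₂) (F₂ t)) with hBdef
  have h1 := core_total c hc X (Ann n₁) (Ann n₂) p N hN1 hsep α' hα1 v₁ v₂ g₁ g₂ hP₁ hP₂
    (fun t => nrm (Ann n₁) (f₁ t)) (A^2) (B^2) (sq_nonneg _) (sq_nonneg _) T hT hT1
    (fun a b => nrm_ii hf₁ a b) (fun s => nrm_nonneg _ _)
    (fun s _ => nrm_g_le n₁ N (le_max_left _ _) _ _ (hg₁ s)) hA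
    (fun s hs => (nrm_g_le n₂ N (le_max_right _ _) _ _ (hg₂ s)).trans
      (mul_le_mul_of_nonneg_left (hB s hs) (by positivity)))
  have hcard : min ((Ann n₁).card : ℝ) (Ann n₂).card ≤ 5 * m := by
    rw [hm, mul_min_of_nonneg _ _ (by norm_num : (0:ℝ) ≤ 5)]
    exact min_le_min (card_Ann n₁) (card_Ann n₂)
  have h2 : ∫ t in (0:ℝ)..T, nrm X (bil (Ann n₁) (Ann n₂) p α' v₁ v₂ t) ≤
      5 * m * A^2 * ∫ t in (0:ℝ)..T, nrm (Ann n₁) (v₁ t) := by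
    rw [← intervalIntegral.integral_const_mul]
    refine intervalIntegral.integral_mono_on_of_le_Ioo hT.le
      ((bil_cont _ _ p α' v₁ v₂ g₁ g₂ hP₁ hP₂ X).intervalIntegrable _ _)
      ((nrm_ii hP₁.hv _ _).const_mul _) fun t ht => ?_
    refine (bil_bernstein X _ _ p α' hα1 v₁ v₂ _ hcard t).trans ?_
    have := mul_le_mul_of_nonneg_left (hA t ht) (nrm_nonneg (Ann n₁) (v₁ t))
    calc _ ≤ 5 * m * (nrm (Ann n₁) (v₁ t) * A^2) := mul_le_mul_of_nonneg_left this (by positivity)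
      _ = _ := by ring
  have hx0 : 0 ≤ ∫ t in (0:ℝ)..T, nrm (Ann n₁) (v₁ t) :=
    intervalIntegral.integral_nonneg hT.le fun t _ => nrm_nonneg _ _
  have hy0 : 0 ≤ ∫ t in (0:ℝ)..T, nrm (Ann n₁) (f₁ t) :=
    intervalIntegral.integral_nonneg hT.le fun t _ => nrm_nonneg _ _
  set Q := ∫ t in (0:ℝ)..T, nrm X (bil (Ann n₁) (Ann n₂) p α' v₁ v₂ t) with hQ
  set x := ∫ t in (0:ℝ)..T, nrm (Ann n₁) (v₁ t) with hx
  set y := ∫ t in (0:ℝ)..T, nrm (Ann n₁) (f₁ t) with hy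
  have hTi : 0 < T⁻¹ := inv_pos.mpr hT
  have hZ0 : 0 ≤ (x + y) * (A^2 + B^2) := by positivity
  have k1 : Q ≤ D * ((x + y) * (A^2 + B^2)) * T⁻¹ := by
    refine h1.trans ?_
    have : 0 ≤ 5 * ((x + y) * (A^2 + B^2)) * T⁻¹ := by positivity
    rw [hD]
    linarith
  have k2 : Q ≤ D * ((x + y) * (A^2 + B^2)) * m := by
    refine h2.trans ?_
    have e1 : x * A^2 ≤ (x + y) * (A^2 + B^2) := by
      refine mul_le_mul (by linarith) (by nlinarith [sq_nonneg B]) (by positivity) (by positivity)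
    calc 5 * m * A^2 * x = 5 * (x * A^2) * m := by ring
      _ ≤ D * ((x + y) * (A^2 + B^2)) * m := by
        refine mul_le_mul_of_nonneg_right ?_ hm0.le
        exact mul_le_mul (by linarith) e1 (by positivity) hD0.le
  have k3 := interp_min Q _ T m θ (mul_nonneg hD0.le hZ0) hT hm0 hθ k1 k2
  exact final_alg D Q T m θ x y A B hD0 hT hm0 hx0 hy0 hA0 hB0 k3

end
end

section
/- Let α ∈ [1,2] and let a ∈ L^∞(R²) with ‖a‖_{L^∞} ≤ 1. Then there exists C = C(ξ₀) > 0 such that for all real-valued u₁, u₂ ∈ L²(R×T) and all dyadic numbers N₁, N₂, L₁, L₂ ≥ 1: ‖Λ_a(Q_{≤L₁}P_{N₁}u₁, Q_{≤L₂}P_{N₂}u₂)‖_{L²(R×T)} ≤ C (L₁∧L₂)^{1/2} { (L₁∨L₂)^{1/4} / (N₁∨N₂)^{(α−1)/4} + 1 } ‖Q_{≤L₁}P_{N₁}u₁‖_{L²(R×T)} ‖Q_{≤L₂}P_{N₂}u₂‖_{L²(R×T)}. -/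
open MeasureTheory Complex Real Set Filter
open scoped ENNReal NNReal

noncomputable section

section BilinearProof


lemma hderiv_neg {f : ℝ → ℝ} {f' x : ℝ} (h : HasDerivAt f f' (-x)) :
    HasDerivAt (fun z => f (-z)) (-f') x := by
  have h' : HasDerivAt f f' (0 - x) := by simpa using h
  simpa using h'.comp_const_sub 0 x

lemma quad_growth {q q' q'' : ℝ → ℝ} {A B m : ℝ}
    (hq : ∀ x ∈ Icc A B, HasDerivAt q (q' x) x) (hq' : ∀ x ∈ Icc A B, HasDerivAt q' (q'' x) x)
    (hm : ∀ x ∈ Icc A B, m ≤ q'' x) (h0 : 0 ≤ q' A) (hAB : A ≤ B) :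
    m / 2 * (B - A) ^ 2 ≤ q B - q A := by
  have hA : A ∈ Icc A B := ⟨le_rfl, hAB⟩
  have hB : B ∈ Icc A B := ⟨hAB, le_rfl⟩
  have mono1 : MonotoneOn (fun z => q' z - m * (z - A)) (Icc A B) := by
    have hd : ∀ x ∈ Icc A B, HasDerivAt (fun z => q' z - m * (z - A)) (q'' x - m * 1) x := fun x hx =>
      (hq' x hx).sub (((hasDerivAt_id x).sub_const A).const_mul m)
    refine monotoneOn_of_hasDerivWithinAt_nonneg (convex_Icc A B)
      (fun x hx => (hd x hx).continuousAt.continuousWithinAt)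
      (fun x hx => (hd x (interior_subset hx)).hasDerivWithinAt) (fun x hx => ?_)
    have := hm x (interior_subset hx)
    linarith
  have mono2 : MonotoneOn (fun z => q z - m / 2 * (z - A) ^ 2) (Icc A B) := by
    have hd : ∀ x ∈ Icc A B, HasDerivAt (fun z => q z - m / 2 * (z - A) ^ 2)
        (q' x - m / 2 * ((2 : ℕ) * (x - A) ^ (2 - 1) * 1)) x := fun x hx =>
      (hq x hx).sub ((((hasDerivAt_id x).sub_const A).pow 2).const_mul (m / 2))
    refine monotoneOn_of_hasDerivWithinAt_nonneg (convex_Icc A B)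
      (fun x hx => (hd x hx).continuousAt.continuousWithinAt)
      (fun x hx => (hd x (interior_subset hx)).hasDerivWithinAt) (fun x hx => ?_)
    have hx' := interior_subset hx
    have := mono1 hA hx' hx'.1
    simp at this ⊢
    linarith
  have := mono2 hA hB hAB
  simp at this
  linarith

lemma card_le_of_diam (S : Finset ℤ) (D : ℝ) (hD : 0 ≤ D)
    (h : ∀ x ∈ S, ∀ y ∈ S, x ≤ y → ((y : ℝ) - x) ≤ D) : (S.card : ℝ) ≤ D + 1 := by
  rcases S.eq_empty_or_nonempty with rfl | hne
  · simp; linarith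
  have hsub : S ⊆ Finset.Icc (S.min' hne) (S.max' hne) := fun x hx =>
    Finset.mem_Icc.2 ⟨S.min'_le x hx, S.le_max' x hx⟩
  have hle := S.min'_le_max' hne
  have h1 := Finset.card_le_card hsub
  rw [Int.card_Icc] at h1
  have h2 := h _ (S.min'_mem hne) _ (S.max'_mem hne) hle
  have h3 : ((S.max' hne + 1 - S.min' hne).toNat : ℝ) = (S.max' hne : ℝ) + 1 - S.min' hne := by
    have : ((S.max' hne + 1 - S.min' hne).toNat : ℤ) = S.max' hne + 1 - S.min' hne :=
      Int.toNat_of_nonneg (by omega)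
    exact_mod_cast this
  have h4 : (S.card : ℝ) ≤ ((S.max' hne + 1 - S.min' hne).toNat : ℝ) := by exact_mod_cast h1
  linarith

lemma count_convex {q q' q'' : ℝ → ℝ} {A B m M T : ℝ} (hm0 : 0 < m)
    (hq : ∀ x ∈ Icc A B, HasDerivAt q (q' x) x) (hq' : ∀ x ∈ Icc A B, HasDerivAt q' (q'' x) x)
    (hm : ∀ x ∈ Icc A B, m ≤ q'' x) (S : Finset ℤ)
    (hS : ∀ k ∈ S, (k : ℝ) ∈ Icc A B ∧ |T + q k| ≤ M) :
    (S.card : ℝ) ≤ 2 + 4 * √(M / m) := by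
  classical
  have bound : ∀ x y : ℝ, 0 ≤ y → m / 2 * y ^ 2 ≤ 2 * M → y ≤ 2 * √(M / m) := by
    intro x y hy h
    have : (y / 2) ^ 2 ≤ M / m := by
      rw [le_div_iff₀ hm0]; nlinarith
    have := Real.le_sqrt_of_sq_le this
    linarith
  have hsplit := Finset.card_filter_add_card_filter_not (s := S) (fun k : ℤ => 0 ≤ q' k)
  have h1 : ((S.filter (fun k : ℤ => 0 ≤ q' k)).card : ℝ) ≤ 2 * √(M / m) + 1 := by
    refine card_le_of_diam _ _ (by positivity) ?_
    intro x hx y hy hxy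
    rw [Finset.mem_filter] at hx hy
    obtain ⟨hxI, hxM⟩ := hS x hx.1
    obtain ⟨hyI, hyM⟩ := hS y hy.1
    have hxy' : (x : ℝ) ≤ y := by exact_mod_cast hxy
    have hsub : Icc (x : ℝ) y ⊆ Icc A B := Icc_subset_Icc hxI.1 hyI.2
    have := quad_growth (fun z hz => hq z (hsub hz)) (fun z hz => hq' z (hsub hz))
      (fun z hz => hm z (hsub hz)) hx.2 hxy'
    refine bound 0 _ (by linarith) ?_
    rw [abs_le] at hxM hyM
    linarith
  have h2 : ((S.filter (fun k : ℤ => ¬ 0 ≤ q' k)).card : ℝ) ≤ 2 * √(M / m) + 1 := by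
    refine card_le_of_diam _ _ (by positivity) ?_
    intro x hx y hy hxy
    rw [Finset.mem_filter] at hx hy
    obtain ⟨hxI, hxM⟩ := hS x hx.1
    obtain ⟨hyI, hyM⟩ := hS y hy.1
    have hxy' : (x : ℝ) ≤ y := by exact_mod_cast hxy
    have hsub : ∀ z, z ∈ Icc (-(y : ℝ)) (-x) → -z ∈ Icc A B := fun z hz =>
      ⟨by linarith [hz.2, hxI.1], by linarith [hz.1, hyI.2]⟩
    have := quad_growth (q := fun z => q (-z)) (q' := fun z => - q' (-z)) (q'' := fun z => q'' (-z))
      (A := -(y : ℝ)) (B := -x) (m := m)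
      (fun z hz => hderiv_neg (hq (-z) (hsub z hz)))
      (fun z hz => by simpa using (hderiv_neg (hq' (-z) (hsub z hz))).fun_neg)
      (fun z hz => hm _ (hsub z hz)) (by simp; linarith [not_le.1 hy.2]) (by linarith)
    simp only [neg_neg] at this
    refine bound 0 _ (by linarith) ?_
    rw [abs_le] at hxM hyM
    have e : (-(x : ℝ) - -y) = y - x := by ring
    rw [e] at this
    linarith
  have : (S.card : ℝ) = ((S.filter (fun k : ℤ => 0 ≤ q' k)).card : ℝ) +
      ((S.filter (fun k : ℤ => ¬ 0 ≤ q' k)).card : ℝ) := by exact_mod_cast hsplit.symm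
  linarith

lemma card_small (S : Finset ℤ) (X : ℝ) (hX : 0 < X) (h : ∀ k ∈ S, 1 ≤ k ∧ (k : ℝ) < X) :
    (S.card : ℝ) ≤ X := by
  have hsub : S ⊆ Finset.Icc 1 (⌊X⌋) := fun k hk =>
    Finset.mem_Icc.2 ⟨(h k hk).1, Int.le_floor.2 (h k hk).2.le⟩
  have h1 := Finset.card_le_card hsub
  rw [Int.card_Icc] at h1
  have hf : 0 ≤ ⌊X⌋ := Int.floor_nonneg.2 hX.le
  have h3 : (((⌊X⌋ + 1 - 1).toNat : ℕ) : ℝ) = (⌊X⌋ : ℝ) := by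
    have : (((⌊X⌋ + 1 - 1).toNat : ℕ) : ℤ) = ⌊X⌋ := by omega
    exact_mod_cast this
  have h4 : (S.card : ℝ) ≤ (((⌊X⌋ + 1 - 1).toNat : ℕ) : ℝ) := by exact_mod_cast h1
  have := Int.floor_le X
  linarith

lemma count_pos {α ξ₀ c₀ C₀ : ℝ} (hα : α ∈ Set.Icc (1:ℝ) 2) {p : ℝ → ℝ} (hp : Hyp1 α ξ₀ c₀ C₀ p)
    {N M T : ℝ} (hN : 1 ≤ N) (s : ℤ) (S : Finset ℤ)
    (hS : ∀ k ∈ S, 1 ≤ k ∧ 1 ≤ s - k ∧ N / 2 ≤ k ∧ |T + (p k + p ((s : ℝ) - k))| ≤ M) :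
    (S.card : ℝ) ≤ 2 * ξ₀ + 2 + 4 * √(M / (c₀ * (N / 2) ^ (α - 1))) := by
  classical
  have hm0 : 0 < c₀ * (N / 2) ^ (α - 1) := mul_pos hp.c_pos (Real.rpow_pos_of_pos (by linarith) _)
  let S1 := S.filter (fun k : ℤ => (k : ℝ) < ξ₀)
  let S2 := S.filter (fun k : ℤ => ((s : ℝ) - k) < ξ₀)
  let S3 := S.filter (fun k : ℤ => ξ₀ ≤ k ∧ ξ₀ ≤ (s : ℝ) - k)
  have hcov : S ⊆ (S1 ∪ S2) ∪ S3 := by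
    intro k hk
    simp only [S1, S2, S3, Finset.mem_union, Finset.mem_filter, hk, true_and]
    by_cases h1 : (k : ℝ) < ξ₀
    · simp [h1]
    by_cases h2 : ((s : ℝ) - k) < ξ₀
    · simp [h2]
    · right; exact ⟨not_lt.1 h1, not_lt.1 h2⟩
  have hc : S.card ≤ S1.card + S2.card + S3.card :=
    (Finset.card_le_card hcov).trans ((Finset.card_union_le _ _).trans
      (Nat.add_le_add_right (Finset.card_union_le _ _) _))
  have h1 : (S1.card : ℝ) ≤ ξ₀ := by
    refine card_small _ _ hp.xi0_pos fun k hk => ?_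
    rw [Finset.mem_filter] at hk
    exact ⟨(hS k hk.1).1, hk.2⟩
  have h2 : (S2.card : ℝ) ≤ ξ₀ := by
    rw [← Finset.card_image_of_injective S2 (f := fun k : ℤ => s - k) (fun a b h => by simpa using h)]
    refine card_small _ _ hp.xi0_pos fun k hk => ?_
    obtain ⟨j, hj, rfl⟩ := Finset.mem_image.1 hk
    rw [Finset.mem_filter] at hj
    refine ⟨(hS j hj.1).2.1, ?_⟩
    push_cast; exact hj.2
  have h3 : (S3.card : ℝ) ≤ 2 + 4 * √(M / (c₀ * (N / 2) ^ (α - 1))) := by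
    have hd1 : ∀ x : ℝ, HasDerivAt p (deriv p x) x := fun x =>
      ((hp.smooth1.differentiable (by norm_num)) x).hasDerivAt
    have hd2 : ∀ x : ℝ, x ≠ 0 → HasDerivAt (deriv p) (deriv (deriv p) x) x := fun x hx => by
      have h := (hp.smooth2 x hx).derivWithin (m := 1) (by norm_num)
      exact (h.differentiableAt (by norm_num)).hasDerivAt
    refine count_convex (q := fun x => p x + p ((s : ℝ) - x))
      (q' := fun x => deriv p x - deriv p ((s : ℝ) - x))
      (q'' := fun x => deriv (deriv p) x + deriv (deriv p) ((s : ℝ) - x))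
      (A := max ξ₀ (N / 2)) (B := s - ξ₀) (T := T) hm0 ?_ ?_ ?_ S3 ?_
    · intro x hx
      have := (hd1 (s - x)).comp_const_sub (s : ℝ) x
      simpa [sub_eq_add_neg] using (hd1 x).fun_add this
    · intro x hx
      have hx0 : x ≠ 0 := by have := (le_max_left _ _).trans hx.1; linarith [hp.xi0_pos]
      have hx1 : (s : ℝ) - x ≠ 0 := by have := hx.2; linarith [hp.xi0_pos]
      have := (hd2 (s - x) hx1).comp_const_sub (s : ℝ) x
      simpa [sub_eq_add_neg] using (hd2 x hx0).fun_sub this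
    · intro x hx
      have hx0 := (le_max_left _ _).trans hx.1
      have hx1 := (le_max_right _ _).trans hx.1
      have hx2 : ξ₀ ≤ (s : ℝ) - x := by linarith [hx.2]
      have a1 := hp.deriv2_lb x hx0
      have a2 := hp.deriv2_lb _ hx2
      have a3 : 0 ≤ c₀ * ((s : ℝ) - x) ^ (α - 1) :=
        mul_nonneg hp.c_pos.le (Real.rpow_nonneg (by linarith [hp.xi0_pos]) _)
      have a4 : c₀ * (N / 2) ^ (α - 1) ≤ c₀ * x ^ (α - 1) :=
        mul_le_mul_of_nonneg_left (Real.rpow_le_rpow (by linarith) hx1 (by linarith [hα.1])) hp.c_pos.le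
      linarith
    · intro k hk
      rw [Finset.mem_filter] at hk
      obtain ⟨_, _, b3, b4⟩ := hS k hk.1
      exact ⟨⟨max_le hk.2.1 b3, by linarith [hk.2.2]⟩, b4⟩
  have : (S.card : ℝ) ≤ S1.card + S2.card + S3.card := by exact_mod_cast hc
  linarith

section ConvLemmas
variable {G : Type*} [AddCommGroup G] [MeasurableSpace G] [MeasurableAdd₂ G] [MeasurableNeg G]
  (μ : Measure G)

/-- Convolution of nonnegative functions. -/
noncomputable def cnv (f g : G → ℝ≥0∞) (x : G) : ℝ≥0∞ := ∫⁻ y, f y * g (x - y) ∂μ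

variable {μ}

lemma cauchy_sq {β : Type*} [MeasurableSpace β] {ν : Measure β} {F : β → ℝ≥0∞} (hF : Measurable F)
    {K : ℝ≥0∞} (hK : ν {y | F y ≠ 0} ≤ K) :
    (∫⁻ y, F y ∂ν) ^ 2 ≤ K * ∫⁻ y, F y ^ 2 ∂ν := by
  have hms : MeasurableSet {y | F y ≠ 0} := (hF (measurableSet_singleton 0)).compl
  have h := ENNReal.lintegral_mul_le_Lp_mul_Lq ν Real.HolderConjugate.two_two
    (f := Set.indicator {y | F y ≠ 0} 1) (g := F) (measurable_one.indicator hms).aemeasurable hF.aemeasurable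
  have e1 : ∀ y, (Set.indicator {y | F y ≠ 0} (1 : β → ℝ≥0∞) * F) y = F y := by
    intro y
    by_cases hy : F y = 0 <;> simp [Set.indicator, hy]
  have e2 : ∀ y, (Set.indicator {y | F y ≠ 0} (1 : β → ℝ≥0∞) y) ^ (2:ℝ) =
      Set.indicator {y | F y ≠ 0} 1 y := by
    intro y
    by_cases hy : F y = 0 <;> simp [Set.indicator, hy]
  simp_rw [e1, e2] at h
  rw [lintegral_indicator_one hms] at h
  calc (∫⁻ y, F y ∂ν) ^ 2 ≤ (ν {y | F y ≠ 0} ^ (1 / 2 : ℝ) * (∫⁻ a, F a ^ (2:ℝ) ∂ν) ^ (1 / 2 : ℝ)) ^ 2 := by gcongr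
    _ = ν {y | F y ≠ 0} * ∫⁻ y, F y ^ 2 ∂ν := by
        rw [mul_pow, ← ENNReal.rpow_mul_natCast, ← ENNReal.rpow_mul_natCast]
        norm_num
    _ ≤ _ := by gcongr

variable [SFinite μ] [μ.IsAddLeftInvariant] [μ.IsNegInvariant]

lemma conv_bound {f g : G → ℝ≥0∞} (hf : Measurable f) (hg : Measurable g) {K : ℝ≥0∞}
    (hK : ∀ x, μ {y | f y ≠ 0 ∧ g (x - y) ≠ 0} ≤ K) :
    ∫⁻ x, cnv μ f g x ^ 2 ∂μ ≤ K * ((∫⁻ x, f x ^ 2 ∂μ) * ∫⁻ x, g x ^ 2 ∂μ) := by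
  calc ∫⁻ x, cnv μ f g x ^ 2 ∂μ
      ≤ ∫⁻ x, K * ∫⁻ y, (f y * g (x - y)) ^ 2 ∂μ ∂μ := by
        refine lintegral_mono fun x => ?_
        refine cauchy_sq (by fun_prop) ?_
        refine le_trans (measure_mono ?_) (hK x)
        intro y hy
        simpa using hy
    _ = K * ∫⁻ x, ∫⁻ y, (f y * g (x - y)) ^ 2 ∂μ ∂μ := by
        rw [lintegral_const_mul]
        exact Measurable.lintegral_prod_right' (f := fun p : G × G => (f p.2 * g (p.1 - p.2)) ^ 2) (by fun_prop)
    _ = K * ∫⁻ y, ∫⁻ x, (f y * g (x - y)) ^ 2 ∂μ ∂μ := by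
        rw [lintegral_lintegral_swap]
        exact Measurable.aemeasurable (by fun_prop)
    _ = K * ∫⁻ y, f y ^ 2 * ∫⁻ x, g x ^ 2 ∂μ ∂μ := by
        congr 2; ext y
        simp_rw [mul_pow]
        rw [lintegral_const_mul _ (by fun_prop)]
        rw [lintegral_sub_right_eq_self (fun x => g x ^ 2)]
    _ = _ := by rw [lintegral_mul_const _ (by fun_prop)]

lemma conv_sq_expand {f g : G → ℝ≥0∞} (hf : Measurable f) (hg : Measurable g) :
    ∫⁻ x, cnv μ f g x ^ 2 ∂μ =
      ∫⁻ y, ∫⁻ z, f y * f z * ∫⁻ x, g (x - y) * g (x - z) ∂μ ∂μ ∂μ := by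
  calc ∫⁻ x, cnv μ f g x ^ 2 ∂μ
    = ∫⁻ x, ∫⁻ y, ∫⁻ z, (f y * g (x - y)) * (f z * g (x - z)) ∂μ ∂μ ∂μ := by
        congr 1; ext x
        unfold cnv
        rw [sq, ← lintegral_mul_const _ (by fun_prop)]
        congr 1; ext y
        rw [lintegral_const_mul _ (by fun_prop)]
    _ = ∫⁻ y, ∫⁻ x, ∫⁻ z, (f y * g (x - y)) * (f z * g (x - z)) ∂μ ∂μ ∂μ := by
        rw [lintegral_lintegral_swap]
        refine Measurable.aemeasurable ?_
        exact Measurable.lintegral_prod_right' (f := fun p : (G × G) × G => (f p.1.2 * g (p.1.1 - p.1.2)) * (f p.2 * g (p.1.1 - p.2))) (by fun_prop)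
    _ = _ := by
        congr 1; ext y
        rw [lintegral_lintegral_swap]
        · congr 1; ext z
          rw [← lintegral_const_mul _ (by fun_prop)]
          congr 1; ext x; ring
        · exact Measurable.aemeasurable (by fun_prop)

lemma conv_swap {f g : G → ℝ≥0∞} (hf : Measurable f) (hg : Measurable g) :
    ∫⁻ x, cnv μ f g x ^ 2 ∂μ = ∫⁻ x, cnv μ f (fun y => g (-y)) x ^ 2 ∂μ := by
  rw [conv_sq_expand hf hg, conv_sq_expand hf (by fun_prop)]
  congr 1; ext y; congr 1; ext z; congr 1
  rw [← lintegral_sub_left_eq_self _ (y + z)]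
  congr 1; ext x
  rw [mul_comm]
  congr 2 <;> abel
end ConvLemmas

open scoped FourierTransform SchwartzMap Convolution

lemma plancherel_aux {g : ℝ → ℂ} (h1 : Integrable g) (h2 : MemLp g 2) :
    ∫⁻ t, ‖𝓕 g t‖ₑ ^ 2 = ∫⁻ t, ‖g t‖ₑ ^ 2 := by
  set f : Lp ℂ 2 (volume : Measure ℝ) := h2.toLp g with hf
  have key : ∀ᵐ x : ℝ, (𝓕 f : Lp ℂ 2 (volume : Measure ℝ)) x = 𝓕 g x := by
    refine ae_eq_of_integral_contDiff_smul_eq ((Lp.memLp _).locallyIntegrable (by norm_num)) ?_ ?_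
    · exact (VectorFourier.fourierIntegral_continuous Real.continuous_fourierChar (by exact continuous_inner) h1).locallyIntegrable
    · intro φ hφ hc
      let φc : ℝ → ℂ := fun x => (φ x : ℂ)
      have hφc : ContDiff ℝ (⊤ : ℕ∞) φc := by
        exact Complex.ofRealCLM.contDiff.comp hφ
      have hcc : HasCompactSupport φc := hc.comp_left (g := fun x : ℝ => (x : ℂ)) (by simp)
      let s : 𝓢(ℝ, ℂ) := hcc.toSchwartzMap hφc
      have hs : ∀ x, s x = (φ x : ℂ) := fun x => rfl
      have e := congrArg (fun T : 𝓢'(ℝ, ℂ) => T s) (MeasureTheory.Lp.fourier_toTemperedDistribution_eq f)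
      simp only [TemperedDistribution.fourier_apply, Lp.toTemperedDistribution_apply] at e
      have e2 := VectorFourier.integral_fourierIntegral_smul_eq_flip (μ := volume) (ν := volume) (L := innerₗ ℝ)
        (e := 𝐞) (f := (s : ℝ → ℂ)) (g := g) Real.continuous_fourierChar (by exact continuous_inner) s.integrable h1
      have e3 : ∫ x, (𝓕 s) x • f x = ∫ x, (𝓕 s) x • g x := by
        refine integral_congr_ae ?_
        filter_upwards [h2.coeFn_toLp] with x hx
        rw [hf, hx]
      simp only [flip_innerₗ] at e2
      have e4 : ∫ x, (𝓕 s) x • g x = ∫ x, s x • 𝓕 g x := e2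
      rw [e3, e4] at e
      simp only [hs] at e
      exact e.symm
  have hn := Lp.norm_fourier_eq f
  have hn' : eLpNorm (𝓕 f : Lp ℂ 2 (volume : Measure ℝ)) 2 volume = eLpNorm f 2 volume := by
    rw [← Lp.enorm_def, ← Lp.enorm_def, ← ofReal_norm, ← ofReal_norm, hn]
  rw [eLpNorm_congr_ae key, eLpNorm_congr_ae h2.coeFn_toLp] at hn'
  have h3 := congrArg (fun x => x ^ 2) hn'
  simpa [eLpNorm_eq_lintegral_rpow_enorm_toReal, ← ENNReal.rpow_mul_natCast] using h3

/-- The measure `count × Lebesgue` on `ℤ × ℝ`. -/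
noncomputable abbrev gm : Measure (ℤ × ℝ) := (Measure.count : Measure ℤ).prod volume

/-- Support condition on the (rescaled) space-time Fourier side. -/
def SuppIn (p : ℝ → ℝ) (N L : ℝ) (f : ℤ × ℝ → ℝ≥0∞) : Prop :=
  ∀ z : ℤ × ℝ, f z ≠ 0 → N / 2 ≤ |(z.1 : ℝ)| ∧ z.1 ≠ 0 ∧ |2 * π * z.2 + p z.1| ≤ 2 * L

lemma SuppIn.neg {p : ℝ → ℝ} (hodd : ∀ x, p (-x) = - p x) {N L : ℝ} {f : ℤ × ℝ → ℝ≥0∞}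
    (h : SuppIn p N L f) : SuppIn p N L (fun z => f (-z)) := by
  intro z hz
  obtain ⟨h1, h2, h3⟩ := h _ hz
  simp only [Prod.fst_neg, Prod.snd_neg, Int.cast_neg, abs_neg, hodd] at h1 h2 h3
  refine ⟨h1, by simpa using h2, ?_⟩
  rw [← abs_neg]
  convert h3 using 2
  ring

/-- The counting constant. -/
noncomputable def Kc (α ξ₀ c₀ N₁ N₂ L₁ L₂ : ℝ) : ℝ :=
  (2 * ξ₀ + 2 + 4 * √((2 * L₁ + 2 * L₂) / (c₀ * (max N₁ N₂ / 2) ^ (α - 1)))) * (4 * min L₁ L₂)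

lemma slice_vol (a L : ℝ) (hL : 0 ≤ L) (A : Set ℝ) (hA : ∀ σ ∈ A, |2 * π * σ + a| ≤ 2 * L) :
    volume A ≤ ENNReal.ofReal (4 * L) := by
  have hpi : 1 ≤ 2 * π := by linarith [Real.pi_gt_three]
  have hpi0 : 0 < 2 * π := by linarith
  have hsub : A ⊆ Icc ((-a - 2 * L) / (2 * π)) ((-a + 2 * L) / (2 * π)) := by
    intro σ hσ
    have := abs_le.1 (hA σ hσ)
    constructor
    · rw [div_le_iff₀ hpi0]; linarith [this.1]
    · rw [le_div_iff₀ hpi0]; linarith [this.2]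
  refine (measure_mono hsub).trans ?_
  rw [Real.volume_Icc]
  refine ENNReal.ofReal_le_ofReal ?_
  rw [← sub_div, div_le_iff₀ hpi0]
  nlinarith

lemma meas_pos {α ξ₀ c₀ C₀ : ℝ} (hα : α ∈ Set.Icc (1:ℝ) 2) {p : ℝ → ℝ} (hp : Hyp1 α ξ₀ c₀ C₀ p)
    {N₁ N₂ L₁ L₂ : ℝ} (hN₁ : 1 ≤ N₁) (hN₂ : 1 ≤ N₂) (hL₁ : 1 ≤ L₁) (hL₂ : 1 ≤ L₂)
    {f g : ℤ × ℝ → ℝ≥0∞} (hf : Measurable f) (hg : Measurable g)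
    (sf : SuppIn p N₁ L₁ f) (sg : SuppIn p N₂ L₂ g)
    (pf : ∀ z, f z ≠ 0 → 0 < z.1) (pg : ∀ z, g z ≠ 0 → 0 < z.1) (x : ℤ × ℝ) :
    gm {y | f y ≠ 0 ∧ g (x - y) ≠ 0} ≤ ENNReal.ofReal (Kc α ξ₀ c₀ N₁ N₂ L₁ L₂) := by
  classical
  obtain ⟨s, τ⟩ := x
  set A : Set (ℤ × ℝ) := {y | f y ≠ 0 ∧ g ((s, τ) - y) ≠ 0} with hA
  have hAm : MeasurableSet A := by
    have h1 : MeasurableSet {y | f y ≠ 0} := (hf (measurableSet_singleton 0)).compl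
    have h2 : MeasurableSet {y | g ((s, τ) - y) ≠ 0} :=
      ((hg.comp (measurable_const.sub measurable_id)) (measurableSet_singleton 0)).compl
    exact h1.inter h2
  set S : Finset ℤ := (Finset.Icc 1 (s - 1)).filter (fun k : ℤ => N₁ / 2 ≤ (k : ℝ) ∧
    N₂ / 2 ≤ (s : ℝ) - k ∧ |2 * π * τ + (p k + p ((s : ℝ) - k))| ≤ 2 * L₁ + 2 * L₂) with hS
  have facts : ∀ k σ, (k, σ) ∈ A → 0 < k ∧ 0 < s - k ∧ N₁ / 2 ≤ (k : ℝ) ∧ N₂ / 2 ≤ (s : ℝ) - k ∧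
      |2 * π * σ + p k| ≤ 2 * L₁ ∧ |2 * π * (τ - σ) + p ((s : ℝ) - k)| ≤ 2 * L₂ := by
    rintro k σ ⟨h1, h2⟩
    obtain ⟨a1, a2, a3⟩ := sf _ h1
    obtain ⟨b1, b2, b3⟩ := sg _ h2
    have a4 := pf _ h1
    have b4 := pg _ h2
    simp only [Prod.mk_sub_mk] at a1 a3 a4 b1 b3 b4
    have a5 : (0 : ℝ) < k := by exact_mod_cast a4
    have b5 : (0 : ℝ) < ((s - k : ℤ) : ℝ) := by exact_mod_cast b4
    rw [abs_of_pos a5] at a1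
    rw [abs_of_pos b5] at b1
    push_cast at b1 b3
    exact ⟨a4, b4, a1, b1, a3, b3⟩
  have hslice : ∀ k : ℤ, volume (Prod.mk k ⁻¹' A) ≤
      (if k ∈ S then ENNReal.ofReal (4 * min L₁ L₂) else 0) := by
    intro k
    by_cases hk : k ∈ S
    · rw [if_pos hk]
      rcases min_choice L₁ L₂ with h | h <;> rw [h]
      · exact slice_vol (p k) L₁ (by linarith) _ fun σ hσ => (facts k σ hσ).2.2.2.2.1
      · refine slice_vol (-(2 * π * τ + p ((s : ℝ) - k))) L₂ (by linarith) _ fun σ hσ => ?_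
        have := (facts k σ hσ).2.2.2.2.2
        rw [← abs_neg]
        convert this using 2
        ring
    · rw [if_neg hk]
      have : Prod.mk k ⁻¹' A = ∅ := by
        ext σ
        simp only [mem_empty_iff_false, iff_false]
        intro hσ
        obtain ⟨h1, h2, h3, h4, h5, h6⟩ := facts k σ hσ
        apply hk
        rw [hS, Finset.mem_filter, Finset.mem_Icc]
        refine ⟨⟨by omega, by omega⟩, h3, h4, ?_⟩
        rw [abs_le] at h5 h6 ⊢
        constructor <;> linarith [h5.1, h5.2, h6.1, h6.2]
      rw [this]; simp
  have hcard : (S.card : ℝ) ≤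
      2 * ξ₀ + 2 + 4 * √((2 * L₁ + 2 * L₂) / (c₀ * (max N₁ N₂ / 2) ^ (α - 1))) := by
    have mem : ∀ k ∈ S, 1 ≤ k ∧ 1 ≤ s - k ∧ N₁ / 2 ≤ (k : ℝ) ∧ N₂ / 2 ≤ (s : ℝ) - k ∧
        |2 * π * τ + (p k + p ((s : ℝ) - k))| ≤ 2 * L₁ + 2 * L₂ := by
      intro k hk
      rw [hS, Finset.mem_filter, Finset.mem_Icc] at hk
      exact ⟨hk.1.1, by omega, hk.2.1, hk.2.2.1, hk.2.2.2⟩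
    rcases max_choice N₁ N₂ with h | h <;> rw [h]
    · refine count_pos hα hp (T := 2 * π * τ) hN₁ s S fun k hk => ?_
      obtain ⟨h1, h2, h3, h4, h5⟩ := mem k hk
      exact ⟨h1, h2, h3, h5⟩
    · rw [← Finset.card_image_of_injective S (f := fun k : ℤ => s - k) (fun a b h => by simpa using h)]
      refine count_pos hα hp (T := 2 * π * τ) hN₂ s _ fun k hk => ?_
      obtain ⟨j, hj, rfl⟩ := Finset.mem_image.1 hk
      obtain ⟨h1, h2, h3, h4, h5⟩ := mem j hj
      refine ⟨h2, by omega, by push_cast; exact h4, ?_⟩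
      push_cast
      rw [sub_sub_cancel, add_comm (p ((s : ℝ) - j))]
      exact h5
  calc gm A = ∑' k : ℤ, volume (Prod.mk k ⁻¹' A) := by
        rw [Measure.prod_apply hAm, lintegral_count]
    _ ≤ ∑' k : ℤ, (if k ∈ S then ENNReal.ofReal (4 * min L₁ L₂) else 0) :=
        ENNReal.tsum_le_tsum hslice
    _ = S.card * ENNReal.ofReal (4 * min L₁ L₂) := by
        rw [tsum_eq_sum (s := S) (fun k hk => by simp [hk])]
        rw [Finset.sum_congr rfl (fun k hk => if_pos hk)]
        simp
    _ ≤ ENNReal.ofReal (2 * ξ₀ + 2 + 4 * √((2 * L₁ + 2 * L₂) / (c₀ * (max N₁ N₂ / 2) ^ (α - 1)))) *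
          ENNReal.ofReal (4 * min L₁ L₂) := by
        gcongr
        rw [← ENNReal.ofReal_natCast]
        exact ENNReal.ofReal_le_ofReal hcard
    _ = _ := by
        rw [← ENNReal.ofReal_mul]
        · rfl
        · exact le_trans (by positivity) hcard

instance : gm.IsNegInvariant := by
  constructor
  have h : (Measure.count : Measure ℤ).neg = Measure.count := Measure.neg_eq_self _
  have h' : (volume : Measure ℝ).neg = volume := Measure.neg_eq_self _
  unfold Measure.neg at h h' ⊢
  have := Measure.map_prod_map (Measure.count : Measure ℤ) (volume : Measure ℝ)
    (f := Neg.neg) (g := Neg.neg) measurable_neg measurable_neg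
  rw [h, h'] at this
  exact this.symm

/-- nonnegative-frequency part and negative-frequency part -/
noncomputable def fpos (f : ℤ × ℝ → ℝ≥0∞) : ℤ × ℝ → ℝ≥0∞ := fun z => if 0 < z.1 then f z else 0
noncomputable def fneg (f : ℤ × ℝ → ℝ≥0∞) : ℤ × ℝ → ℝ≥0∞ := fun z => if 0 < z.1 then 0 else f z

lemma conv_pp {α ξ₀ c₀ C₀ : ℝ} (hα : α ∈ Set.Icc (1:ℝ) 2) {p : ℝ → ℝ} (hp : Hyp1 α ξ₀ c₀ C₀ p)
    {N₁ N₂ L₁ L₂ : ℝ} (hN₁ : 1 ≤ N₁) (hN₂ : 1 ≤ N₂) (hL₁ : 1 ≤ L₁) (hL₂ : 1 ≤ L₂)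
    {f g : ℤ × ℝ → ℝ≥0∞} (hf : Measurable f) (hg : Measurable g)
    (sf : SuppIn p N₁ L₁ f) (sg : SuppIn p N₂ L₂ g)
    (pf : ∀ z, f z ≠ 0 → 0 < z.1) (pg : ∀ z, g z ≠ 0 → 0 < z.1) :
    ∫⁻ x, cnv gm f g x ^ 2 ∂gm ≤ ENNReal.ofReal (Kc α ξ₀ c₀ N₁ N₂ L₁ L₂) *
      ((∫⁻ x, f x ^ 2 ∂gm) * ∫⁻ x, g x ^ 2 ∂gm) :=
  conv_bound hf hg (meas_pos hα hp hN₁ hN₂ hL₁ hL₂ hf hg sf sg pf pg)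

lemma conv_nn {α ξ₀ c₀ C₀ : ℝ} (hα : α ∈ Set.Icc (1:ℝ) 2) {p : ℝ → ℝ} (hp : Hyp1 α ξ₀ c₀ C₀ p)
    {N₁ N₂ L₁ L₂ : ℝ} (hN₁ : 1 ≤ N₁) (hN₂ : 1 ≤ N₂) (hL₁ : 1 ≤ L₁) (hL₂ : 1 ≤ L₂)
    {f g : ℤ × ℝ → ℝ≥0∞} (hf : Measurable f) (hg : Measurable g)
    (sf : SuppIn p N₁ L₁ f) (sg : SuppIn p N₂ L₂ g)
    (pf : ∀ z, f z ≠ 0 → z.1 < 0) (pg : ∀ z, g z ≠ 0 → z.1 < 0) :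
    ∫⁻ x, cnv gm f g x ^ 2 ∂gm ≤ ENNReal.ofReal (Kc α ξ₀ c₀ N₁ N₂ L₁ L₂) *
      ((∫⁻ x, f x ^ 2 ∂gm) * ∫⁻ x, g x ^ 2 ∂gm) := by
  refine conv_bound hf hg fun x => ?_
  have h := meas_pos hα hp hN₁ hN₂ hL₁ hL₂ (f := fun z => f (-z)) (g := fun z => g (-z))
    (by fun_prop) (by fun_prop) (sf.neg hp.odd) (sg.neg hp.odd)
    (fun z hz => by simpa using pf _ hz) (fun z hz => by simpa using pg _ hz) (-x)
  rw [← Measure.measure_preimage_neg] at h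
  convert h using 2
  ext y
  simp only [mem_setOf_eq, mem_preimage, neg_neg, neg_sub, sub_neg_eq_add]
  rw [neg_add_eq_sub]

lemma conv_main {α ξ₀ c₀ C₀ : ℝ} (hα : α ∈ Set.Icc (1:ℝ) 2) {p : ℝ → ℝ} (hp : Hyp1 α ξ₀ c₀ C₀ p)
    {N₁ N₂ L₁ L₂ : ℝ} (hN₁ : 1 ≤ N₁) (hN₂ : 1 ≤ N₂) (hL₁ : 1 ≤ L₁) (hL₂ : 1 ≤ L₂)
    {f g : ℤ × ℝ → ℝ≥0∞} (hf : Measurable f) (hg : Measurable g)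
    (sf : SuppIn p N₁ L₁ f) (sg : SuppIn p N₂ L₂ g) :
    ∫⁻ x, cnv gm f g x ^ 2 ∂gm ≤ 16 * (ENNReal.ofReal (Kc α ξ₀ c₀ N₁ N₂ L₁ L₂) *
      ((∫⁻ x, f x ^ 2 ∂gm) * ∫⁻ x, g x ^ 2 ∂gm)) := by
  have hms : MeasurableSet {z : ℤ × ℝ | 0 < z.1} := measurableSet_lt measurable_const measurable_fst
  have mp : ∀ {h : ℤ × ℝ → ℝ≥0∞}, Measurable h → Measurable (fpos h) := fun hh =>
    Measurable.ite hms hh measurable_const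
  have mn : ∀ {h : ℤ × ℝ → ℝ≥0∞}, Measurable h → Measurable (fneg h) := fun hh =>
    Measurable.ite hms measurable_const hh
  have lep : ∀ (h : ℤ × ℝ → ℝ≥0∞) z, fpos h z ≤ h z := fun h z => by unfold fpos; split_ifs <;> simp
  have len : ∀ (h : ℤ × ℝ → ℝ≥0∞) z, fneg h z ≤ h z := fun h z => by unfold fneg; split_ifs <;> simp
  have sup : ∀ {N L : ℝ} {h h' : ℤ × ℝ → ℝ≥0∞}, SuppIn p N L h → (∀ z, h' z ≤ h z) →
      SuppIn p N L h' := fun hs hle z hz => hs z (fun h0 => hz (le_antisymm (h0 ▸ hle z) bot_le))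
  have pp : ∀ {h : ℤ × ℝ → ℝ≥0∞} z, fpos h z ≠ 0 → 0 < z.1 := fun z hz => by
    by_contra hc; exact hz (by simp [fpos, hc])
  have pn : ∀ {N L : ℝ} {h : ℤ × ℝ → ℝ≥0∞}, SuppIn p N L h → ∀ z, fneg h z ≠ 0 → z.1 < 0 :=
    fun hs z hz => by
      have h1 : ¬ 0 < z.1 := fun hc => hz (by simp [fneg, hc])
      have h2 := (sup hs (len _) z hz).2.1
      omega
  set E := ENNReal.ofReal (Kc α ξ₀ c₀ N₁ N₂ L₁ L₂) * ((∫⁻ x, f x ^ 2 ∂gm) * ∫⁻ x, g x ^ 2 ∂gm) with hE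
  have Ele : ∀ {f' g' : ℤ × ℝ → ℝ≥0∞}, (∀ z, f' z ≤ f z) → (∀ z, g' z ≤ g z) →
      ENNReal.ofReal (Kc α ξ₀ c₀ N₁ N₂ L₁ L₂) *
        ((∫⁻ x, f' x ^ 2 ∂gm) * ∫⁻ x, g' x ^ 2 ∂gm) ≤ E := by
    intro f' g' h1 h2
    rw [hE]
    gcongr with x x
    · exact h1 x
    · exact h2 x
  have negint : ∀ (h : ℤ × ℝ → ℝ≥0∞), ∫⁻ x, h (-x) ^ 2 ∂gm = ∫⁻ x, h x ^ 2 ∂gm := fun h =>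
    lintegral_neg_eq_self (fun x => h x ^ 2)
  have I1 : ∫⁻ x, cnv gm (fpos f) (fpos g) x ^ 2 ∂gm ≤ E :=
    (conv_pp hα hp hN₁ hN₂ hL₁ hL₂ (mp hf) (mp hg) (sup sf (lep f)) (sup sg (lep g)) pp pp).trans
      (Ele (lep f) (lep g))
  have I2 : ∫⁻ x, cnv gm (fneg f) (fneg g) x ^ 2 ∂gm ≤ E :=
    (conv_nn hα hp hN₁ hN₂ hL₁ hL₂ (mn hf) (mn hg) (sup sf (len f)) (sup sg (len g)) (pn sf) (pn sg)).trans
      (Ele (len f) (len g))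
  have I3 : ∫⁻ x, cnv gm (fpos f) (fneg g) x ^ 2 ∂gm ≤ E := by
    rw [conv_swap (mp hf) (mn hg)]
    refine (conv_pp hα hp hN₁ hN₂ hL₁ hL₂ (g := fun y => fneg g (-y)) (mp hf) ((mn hg).comp' measurable_neg)
      (sup sf (lep f)) ((sup sg (len g)).neg hp.odd) pp
      (fun z hz => by simpa using pn sg _ hz)).trans ?_
    rw [negint (fneg g)]
    exact Ele (lep f) (len g)
  have I4 : ∫⁻ x, cnv gm (fneg f) (fpos g) x ^ 2 ∂gm ≤ E := by
    rw [conv_swap (mn hf) (mp hg)]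
    refine (conv_nn hα hp hN₁ hN₂ hL₁ hL₂ (g := fun y => fpos g (-y)) (mn hf) ((mp hg).comp' measurable_neg)
      (sup sf (len f)) ((sup sg (lep g)).neg hp.odd) (pn sf)
      (fun z hz => by simpa using pp _ hz)).trans ?_
    rw [negint (fpos g)]
    exact Ele (len f) (lep g)
  have mc : ∀ {f' g' : ℤ × ℝ → ℝ≥0∞}, Measurable f' → Measurable g' →
      Measurable (fun x => cnv gm f' g' x ^ 2) := by
    intro f' g' h1 h2
    refine Measurable.pow_const ?_ 2
    exact Measurable.lintegral_prod_right'
      (f := fun q : (ℤ × ℝ) × (ℤ × ℝ) => f' q.2 * g' (q.1 - q.2)) (by fun_prop)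
  have hsum : ∀ x, cnv gm f g x = cnv gm (fpos f) (fpos g) x + cnv gm (fneg f) (fneg g) x +
      cnv gm (fpos f) (fneg g) x + cnv gm (fneg f) (fpos g) x := by
    intro x
    have m1 := mp hf; have m2 := mn hf; have m3 := mp hg; have m4 := mn hg
    unfold cnv
    rw [← lintegral_add_left (by fun_prop), ← lintegral_add_left (by fun_prop),
      ← lintegral_add_left (by fun_prop)]
    congr 1; ext y
    unfold fpos fneg
    split_ifs <;> simp
  have sq4 : ∀ a b c d : ℝ≥0∞, (a + b + c + d) ^ 2 ≤ 4 * (a ^ 2 + b ^ 2 + c ^ 2 + d ^ 2) := by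
    intro a b c d
    have h2 : ∀ u v : ℝ≥0∞, (u + v) ^ 2 ≤ 2 * (u ^ 2 + v ^ 2) := by
      intro u v
      have := ENNReal.rpow_add_le_mul_rpow_add_rpow u v (p := 2) (by norm_num)
      norm_num at this
      exact this
    calc (a + b + c + d) ^ 2 = ((a + b) + (c + d)) ^ 2 := by ring
      _ ≤ 2 * ((a + b) ^ 2 + (c + d) ^ 2) := h2 _ _
      _ ≤ 2 * (2 * (a ^ 2 + b ^ 2) + 2 * (c ^ 2 + d ^ 2)) := by gcongr <;> exact h2 _ _
      _ = _ := by ring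
  calc ∫⁻ x, cnv gm f g x ^ 2 ∂gm
      ≤ ∫⁻ x, 4 * (cnv gm (fpos f) (fpos g) x ^ 2 + cnv gm (fneg f) (fneg g) x ^ 2 +
          cnv gm (fpos f) (fneg g) x ^ 2 + cnv gm (fneg f) (fpos g) x ^ 2) ∂gm := by
        refine lintegral_mono fun x => ?_
        rw [hsum x]
        exact sq4 _ _ _ _
    _ = 4 * (∫⁻ x, cnv gm (fpos f) (fpos g) x ^ 2 ∂gm + ∫⁻ x, cnv gm (fneg f) (fneg g) x ^ 2 ∂gm +
          ∫⁻ x, cnv gm (fpos f) (fneg g) x ^ 2 ∂gm + ∫⁻ x, cnv gm (fneg f) (fpos g) x ^ 2 ∂gm) := by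
        have k1 := mc (mp hf) (mp hg)
        have k2 := mc (mn hf) (mn hg)
        have k3 := mc (mp hf) (mn hg)
        have k4 := mc (mn hf) (mp hg)
        rw [lintegral_const_mul _ (by fun_prop), lintegral_add_right _ k4, lintegral_add_right _ k3,
          lintegral_add_right _ k2]
    _ ≤ 4 * (E + E + E + E) := by gcongr
    _ = 16 * E := by ring

lemma FT_eq (g : ℝ → ℂ) (τ : ℝ) : FT g τ = 𝓕 g (τ / (2 * π)) := by
  unfold FT
  rw [Real.fourier_eq']
  congr 1
  ext t
  simp only [smul_eq_mul]
  congr 2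
  have : (π : ℂ) ≠ 0 := by exact_mod_cast Real.pi_ne_zero
  simp
  field_simp

lemma FT_continuous (g : ℝ → ℂ) : Continuous (FT g) := by
  by_cases h : Integrable g
  · have h2 : Continuous (𝓕 g) :=
      VectorFourier.fourierIntegral_continuous Real.continuous_fourierChar (by exact continuous_inner) h
    have : FT g = fun τ => 𝓕 g (τ / (2 * π)) := funext (FT_eq g)
    rw [this]
    fun_prop
  · have : FT g = fun _ => 0 := by
      ext τ
      unfold FT
      refine integral_undef ?_
      intro h3
      apply h
      have h4 : Integrable (fun t : ℝ => Complex.exp (Complex.I * τ * t) * (Complex.exp (-(Complex.I * τ * t)) * g t)) := by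
        refine h3.bdd_mul (c := 1) ?_ ?_
        · exact (by fun_prop : Continuous fun t : ℝ => Complex.exp (Complex.I * τ * t)).aestronglyMeasurable
        · refine Filter.Eventually.of_forall fun t => ?_
          rw [show Complex.I * τ * t = ((τ * t : ℝ) : ℂ) * Complex.I by push_cast; ring,
            Complex.norm_exp_ofReal_mul_I]
      refine h4.congr (Filter.Eventually.of_forall fun t => ?_)
      simp only
      rw [← mul_assoc, ← Complex.exp_add]
      simp
    rw [this]
    exact continuous_const

lemma IFT_eq (g : ℝ → ℂ) (t : ℝ) : IFT g t = 𝓕 (fun σ => g (-(2 * π) * σ)) t := by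
  unfold IFT
  rw [Real.fourier_eq']
  have h := Measure.integral_comp_mul_left (fun τ : ℝ => Complex.exp (Complex.I * τ * t) * g τ) (-(2 * π))
  have hp : |(-(2 * π))⁻¹| = (2 * π)⁻¹ := by
    rw [abs_inv, abs_neg, abs_of_pos (by positivity)]
  rw [hp] at h
  rw [← h]
  congr 1
  ext σ
  simp only [smul_eq_mul]
  congr 2
  simp
  ring

/-- The smooth truncation of the modulation at scale `1 / c`. -/
def JJ (χ : ℝ → ℝ) (F : ℝ → ℂ) (q c t : ℝ) : ℂ :=
  IFT (fun τ => (χ (c * (τ - q)) : ℂ) * F τ) t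

lemma chi_integrable {χ : ℝ → ℝ} (hχ : CutoffFun χ) {F : ℝ → ℂ} (hF : Continuous F) (q c : ℝ) (hc : 0 < c) :
    Continuous (fun τ => (χ (c * (τ - q)) : ℂ) * F τ) ∧
    HasCompactSupport (fun τ => (χ (c * (τ - q)) : ℂ) * F τ) := by
  have hχc : Continuous χ := hχ.smooth.continuous
  refine ⟨by fun_prop, ?_⟩
  refine HasCompactSupport.of_support_subset_isCompact (isCompact_Icc (a := q - 2 / c) (b := q + 2 / c)) ?_
  intro τ hτ
  have h1 : χ (c * (τ - q)) ≠ 0 := by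
    intro h
    apply hτ
    simp [h]
  obtain ⟨h2, h3⟩ := hχ.compact_supp _ h1
  have h4 : c * (2 / c) = 2 := by field_simp
  constructor <;> nlinarith

lemma JJ_sub {χ : ℝ → ℝ} (hχ : CutoffFun χ) {F : ℝ → ℂ} (hF : Continuous F) (q c d t : ℝ) (hc : 0 < c)
    (hd : 0 < d) :
    IFT (fun τ => ((χ (c * (τ - q)) - χ (d * (τ - q)) : ℝ) : ℂ) * F τ) t = JJ χ F q c t - JJ χ F q d t := by
  have hi : ∀ e : ℝ, 0 < e →
      Integrable (fun τ : ℝ => Complex.exp (Complex.I * τ * t) * ((χ (e * (τ - q)) : ℂ) * F τ)) := by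
    intro e he
    obtain ⟨h1, h2⟩ := chi_integrable hχ hF q e he
    have h3 : HasCompactSupport (fun τ : ℝ => Complex.exp (Complex.I * τ * t) * ((χ (e * (τ - q)) : ℂ) * F τ)) :=
      h2.mul_left
    refine Continuous.integrable_of_hasCompactSupport ?_ h3
    exact (by fun_prop : Continuous fun τ : ℝ => Complex.exp (Complex.I * τ * t)).mul h1
  unfold JJ IFT
  rw [← smul_sub, ← integral_sub (hi c hc) (hi d hd)]
  congr 2
  ext τ
  push_cast
  ring

lemma Qle_eq {χ : ℝ → ℝ} (hχ : CutoffFun χ) (p : ℝ → ℝ) (l : ℕ) (U : ℝ → ℤ → ℂ) (t : ℝ) (k : ℤ) :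
    Qle χ p l U t k = JJ χ (FT (fun s => U s k)) (p k) (1 / 2 ^ l) t := by
  have hF := FT_continuous (fun s => U s k)
  have hj : ∀ j : ℕ, QL χ p ((2:ℝ) ^ j) U t k =
      JJ χ (FT (fun s => U s k)) (p k) (1 / 2 ^ j) t - JJ χ (FT (fun s => U s k)) (p k) (2 / 2 ^ j) t := by
    intro j
    rw [← JJ_sub hχ hF _ _ _ _ (by positivity) (by positivity)]
    unfold QL lpSymb
    have : (2:ℝ) ^ j ≠ 0 := by positivity
    simp only [this, if_false]
    congr 1
    ext τ
    congr 5 <;> ring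
  have h0 : QL χ p 0 U t k = JJ χ (FT (fun s => U s k)) (p k) 2 t := by
    unfold QL lpSymb JJ
    simp
  unfold Qle
  rw [h0]
  induction l with
  | zero => simp [hj]
  | succ l ih =>
    rw [Finset.sum_range_succ, ← add_assoc, ih, hj]
    have : (2:ℝ) / 2 ^ (l + 1) = 1 / 2 ^ l := by
      rw [pow_succ]; field_simp
    rw [this]
    ring

/-- Fourier side representative of `Q_{≤ 2^l} P_{2^n} u`. -/
def hh (χ p : ℝ → ℝ) (n l : ℕ) (U : ℝ → ℤ → ℂ) (k : ℤ) (σ : ℝ) : ℂ :=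
  (χ (1 / 2 ^ l * (-(2 * π) * σ - p k)) : ℂ) * FT (fun s => PN χ ((2:ℝ) ^ n) (U s) k) (-(2 * π) * σ)

lemma Qle_fourier {χ : ℝ → ℝ} (hχ : CutoffFun χ) (p : ℝ → ℝ) (n l : ℕ) (U : ℝ → ℤ → ℂ) (t : ℝ) (k : ℤ) :
    Qle χ p l (fun s => PN χ ((2:ℝ) ^ n) (U s)) t k = 𝓕 (hh χ p n l U k) t := by
  rw [Qle_eq hχ]
  unfold JJ
  rw [IFT_eq]
  rfl

lemma hh_cont {χ : ℝ → ℝ} (hχ : CutoffFun χ) (p : ℝ → ℝ) (n l : ℕ) (U : ℝ → ℤ → ℂ) (k : ℤ) :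
    Continuous (hh χ p n l U k) := by
  have := (chi_integrable hχ (FT_continuous (fun s => PN χ ((2:ℝ) ^ n) (U s) k)) (p k) (1 / 2 ^ l) (by positivity)).1
  exact this.comp (by fun_prop : Continuous fun σ : ℝ => -(2 * π) * σ)

lemma hh_supp {χ : ℝ → ℝ} (hχ : CutoffFun χ) (p : ℝ → ℝ) (n l : ℕ) (U : ℝ → ℤ → ℂ) (k : ℤ) (σ : ℝ)
    (h : hh χ p n l U k σ ≠ 0) :
    |2 * π * σ + p k| ≤ 2 * 2 ^ l ∧ (2:ℝ) ^ n / 2 ≤ |(k:ℝ)| ∧ |(k:ℝ)| ≤ 2 * 2 ^ n ∧ k ≠ 0 := by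
  unfold hh at h
  have hl : (0:ℝ) < 2 ^ l := by positivity
  have hn : (0:ℝ) < 2 ^ n := by positivity
  refine ⟨?_, ?_⟩
  · have h1 : χ (1 / 2 ^ l * (-(2 * π) * σ - p k)) ≠ 0 := by
      intro h1; apply h; rw [h1]; simp
    obtain ⟨h2, h3⟩ := hχ.compact_supp _ h1
    rw [one_div, inv_mul_eq_div] at h2 h3
    rw [le_div_iff₀ hl] at h2
    rw [div_le_iff₀ hl] at h3
    rw [abs_le]
    constructor <;> linarith
  · have h1 : lpSymb χ ((2:ℝ) ^ n) k ≠ 0 := by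
      intro h1
      apply h
      simp [PN, h1, FT]
    unfold lpSymb at h1
    simp only [hn.ne', if_false] at h1
    have h2 : (2:ℝ) ^ n / 2 ≤ |(k:ℝ)| := by
      by_contra! hlt
      apply h1
      have a1 := abs_lt.1 hlt
      rw [hχ.eq_one, hχ.eq_one, sub_self]
      · constructor
        · rw [le_div_iff₀ hn]; linarith [a1.1]
        · rw [div_le_iff₀ hn]; linarith [a1.2]
      · constructor
        · rw [le_div_iff₀ hn]; linarith [a1.1]
        · rw [div_le_iff₀ hn]; linarith [a1.2]
    refine ⟨h2, ?_, ?_⟩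
    · by_contra! hlt
      apply h1
      have e1 : χ ((k:ℝ) / 2 ^ n) = 0 := by
        by_contra h4
        have := hχ.compact_supp _ h4
        obtain ⟨h5, h6⟩ := this
        rw [le_div_iff₀ hn] at h5
        rw [div_le_iff₀ hn] at h6
        have : |(k:ℝ)| ≤ 2 * 2 ^ n := abs_le.2 ⟨by linarith, by linarith⟩
        linarith
      have e2 : χ (2 * (k:ℝ) / 2 ^ n) = 0 := by
        by_contra h4
        have := hχ.compact_supp _ h4
        obtain ⟨h5, h6⟩ := this
        rw [le_div_iff₀ hn] at h5
        rw [div_le_iff₀ hn] at h6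
        have : |(k:ℝ)| ≤ 2 * 2 ^ n := abs_le.2 ⟨by linarith, by linarith⟩
        linarith
      rw [e1, e2, sub_zero]
    · rintro rfl
      simp at h2
      linarith

lemma hh_cpt {χ : ℝ → ℝ} (hχ : CutoffFun χ) (p : ℝ → ℝ) (n l : ℕ) (U : ℝ → ℤ → ℂ) (k : ℤ) :
    HasCompactSupport (hh χ p n l U k) := by
  have hpi : (0:ℝ) < 2 * π := by positivity
  refine HasCompactSupport.of_support_subset_isCompact
    (isCompact_Icc (a := (-p k - 2 * 2 ^ l) / (2 * π)) (b := (-p k + 2 * 2 ^ l) / (2 * π))) ?_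
  intro σ hσ
  obtain ⟨h1, h2⟩ := abs_le.1 (hh_supp hχ p n l U k σ hσ).1
  constructor
  · rw [div_le_iff₀ hpi]; linarith
  · rw [le_div_iff₀ hpi]; linarith

lemma planch_cc {g : ℝ → ℂ} (hc : Continuous g) (hs : HasCompactSupport g) :
    ∫⁻ t, ‖𝓕 g t‖ₑ ^ 2 = ∫⁻ t, ‖g t‖ₑ ^ 2 :=
  plancherel_aux (hc.integrable_of_hasCompactSupport hs) (hc.memLp_of_hasCompactSupport hs)

lemma fourier_cont_cc {g : ℝ → ℂ} (hc : Continuous g) (hs : HasCompactSupport g) : Continuous (𝓕 g) :=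
  VectorFourier.fourierIntegral_continuous Real.continuous_fourierChar (by exact continuous_inner)
    (hc.integrable_of_hasCompactSupport hs)

lemma lintegral_gm {F : ℤ × ℝ → ℝ≥0∞} (hF : Measurable F) :
    ∫⁻ z, F z ∂gm = ∑' k : ℤ, ∫⁻ t, F (k, t) := by
  rw [lintegral_prod _ hF.aemeasurable, lintegral_count]

lemma meas_slices {E : Type*} [MeasurableSpace E] {F : ℤ × ℝ → E} (h : ∀ k, Measurable fun t => F (k, t)) :
    Measurable F := measurable_from_prod_countable_right h

lemma planch_sum {h : ℤ → ℝ → ℂ} (hc : ∀ k, Continuous (h k)) (hs : ∀ k, HasCompactSupport (h k)) :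
    ∫⁻ t, ∑' k : ℤ, ‖𝓕 (h k) t‖ₑ ^ 2 = ∫⁻ z, ‖h z.1 z.2‖ₑ ^ 2 ∂gm := by
  rw [lintegral_tsum, lintegral_gm]
  · congr 1; ext k; exact planch_cc (hc k) (hs k)
  · exact meas_slices fun k => ((hc k).enorm.measurable.pow_const 2)
  · exact fun k => ((fourier_cont_cc (hc k) (hs k)).enorm.measurable.pow_const 2).aemeasurable

lemma planch_fin {h : ℤ → ℝ → ℂ} (hc : ∀ k, Continuous (h k)) (hs : ∀ k, HasCompactSupport (h k))
    {S : Finset ℤ} (hS : ∀ k, k ∉ S → h k = 0) :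
    ∫⁻ z, ‖h z.1 z.2‖ₑ ^ 2 ∂gm ≠ ∞ := by
  rw [lintegral_gm (meas_slices fun k => ((hc k).enorm.measurable.pow_const 2)),
    tsum_eq_sum (s := S) (by intro k hk; simp [hS k hk])]
  refine (ENNReal.sum_lt_top.2 fun k _ => ?_).ne
  have h2 := ((hc k).memLp_of_hasCompactSupport (p := 2) (μ := volume) (hs k)).eLpNorm_lt_top
  have := lintegral_rpow_enorm_lt_top_of_eLpNorm_lt_top (p := 2) (by norm_num) (by norm_num) h2
  simpa using this

/-- The Fourier side of the bilinear operator. -/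
def ww (a : ℝ → ℝ → ℂ) (S : Finset ℤ) (h₁ h₂ : ℤ → ℝ → ℂ) (k : ℤ) (σ : ℝ) : ℂ :=
  ∑ j ∈ S, a j ((k:ℝ) - j) * ((h₁ j) ⋆[ContinuousLinearMap.mul ℂ ℂ] (h₂ (k - j))) σ

lemma cc_conv {h₁ h₂ : ℤ → ℝ → ℂ}
    (hc₁ : ∀ k, Continuous (h₁ k)) (hs₁ : ∀ k, HasCompactSupport (h₁ k))
    (hc₂ : ∀ k, Continuous (h₂ k)) (hs₂ : ∀ k, HasCompactSupport (h₂ k))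
    (i j : ℤ) : Continuous ((h₁ i) ⋆[ContinuousLinearMap.mul ℂ ℂ] (h₂ j)) ∧
    HasCompactSupport ((h₁ i) ⋆[ContinuousLinearMap.mul ℂ ℂ] (h₂ j)) := by
  refine ⟨?_, ?_⟩
  · exact (hs₂ j).continuous_convolution_right _ ((hc₁ i).locallyIntegrable) (hc₂ j)
  · exact HasCompactSupport.convolution (ContinuousLinearMap.mul ℂ ℂ) (hs₁ i) (hs₂ j)

lemma ww_cc {a : ℝ → ℝ → ℂ} {S : Finset ℤ} {h₁ h₂ : ℤ → ℝ → ℂ}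
    (hc₁ : ∀ k, Continuous (h₁ k)) (hs₁ : ∀ k, HasCompactSupport (h₁ k))
    (hc₂ : ∀ k, Continuous (h₂ k)) (hs₂ : ∀ k, HasCompactSupport (h₂ k))
    (k : ℤ) : Continuous (ww a S h₁ h₂ k) ∧ HasCompactSupport (ww a S h₁ h₂ k) := by
  refine ⟨?_, ?_⟩
  · exact continuous_finsetSum _ fun j _ => continuous_const.mul (cc_conv hc₁ hs₁ hc₂ hs₂ j (k - j)).1
  · unfold ww
    induction S using Finset.induction_on with
    | empty => simp only [Finset.sum_empty]; exact HasCompactSupport.zero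
    | insert j S hj ih =>
      simp only [Finset.sum_insert hj]
      exact HasCompactSupport.add ((cc_conv hc₁ hs₁ hc₂ hs₂ j (k - j)).2.mul_left) ih

lemma Lam_fourier {a : ℝ → ℝ → ℂ} {S : Finset ℤ} {h₁ h₂ : ℤ → ℝ → ℂ}
    (hc₁ : ∀ k, Continuous (h₁ k)) (hs₁ : ∀ k, HasCompactSupport (h₁ k))
    (hc₂ : ∀ k, Continuous (h₂ k)) (hs₂ : ∀ k, HasCompactSupport (h₂ k))
    (hS : ∀ k, k ∉ S → h₁ k = 0) (t : ℝ) (k : ℤ) :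
    Lam a (fun k => 𝓕 (h₁ k) t) (fun k => 𝓕 (h₂ k) t) k = 𝓕 (ww a S h₁ h₂ k) t := by
  unfold Lam
  rw [tsum_eq_sum (s := S)]
  · have e : ∀ j, 𝓕 (h₁ j) t * 𝓕 (h₂ (k - j)) t = 𝓕 ((h₁ j) ⋆[ContinuousLinearMap.mul ℂ ℂ] (h₂ (k - j))) t :=
      fun j => (Real.fourier_mul_convolution_eq ((hc₁ j).integrable_of_hasCompactSupport (hs₁ j))
        ((hc₂ (k - j)).integrable_of_hasCompactSupport (hs₂ (k - j))) t).symm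
    simp only [mul_assoc, e]
    simp only [Real.fourier_eq', ww, smul_eq_mul, Finset.mul_sum]
    rw [integral_finsetSum]
    · refine Finset.sum_congr rfl fun j _ => ?_
      rw [← integral_const_mul]
      congr 1; ext σ; ring
    · intro j _
      have hcc := cc_conv hc₁ hs₁ hc₂ hs₂ j (k - j)
      refine Continuous.integrable_of_hasCompactSupport ?_ (hcc.2.mul_left.mul_left)
      have := hcc.1
      fun_prop
  · intro j hj
    simp only [hS j hj]
    simp [Real.fourier_eq']

lemma ww_le {a : ℝ → ℝ → ℂ} {S : Finset ℤ} {h₁ h₂ : ℤ → ℝ → ℂ}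
    (hc₁ : ∀ k, Continuous (h₁ k)) (hc₂ : ∀ k, Continuous (h₂ k))
    (ha : ∀ x y, ‖a x y‖ ≤ 1) (k : ℤ) (σ : ℝ) :
    ‖ww a S h₁ h₂ k σ‖ₑ ≤ cnv gm (fun z => ‖h₁ z.1 z.2‖ₑ) (fun z => ‖h₂ z.1 z.2‖ₑ) (k, σ) := by
  have hm : Measurable fun y : ℤ × ℝ => ‖h₁ y.1 y.2‖ₑ * ‖h₂ ((k, σ) - y).1 ((k, σ) - y).2‖ₑ := by
    refine meas_slices fun j => ?_
    have := hc₁ j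
    have := hc₂ (k - j)
    simp only [Prod.mk_sub_mk]
    fun_prop
  unfold cnv
  rw [lintegral_gm hm]
  refine (enorm_sum_le _ _).trans (le_trans ?_ (ENNReal.sum_le_tsum S))
  refine Finset.sum_le_sum fun j _ => ?_
  rw [enorm_mul]
  have h1 : ‖a j ((k:ℝ) - j)‖ₑ ≤ 1 := by
    rw [← ofReal_norm]
    exact ENNReal.ofReal_le_one.2 (ha _ _)
  refine (mul_le_of_le_one_left' h1).trans ?_
  rw [convolution]
  refine (enorm_integral_le_lintegral_enorm _).trans ?_
  refine lintegral_mono fun s => ?_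
  simp
lemma core_bound {α ξ₀ c₀ C₀ : ℝ} (hα : α ∈ Set.Icc (1:ℝ) 2) {p : ℝ → ℝ} (hp : Hyp1 α ξ₀ c₀ C₀ p)
    {N₁ N₂ L₁ L₂ : ℝ} (hN₁ : 1 ≤ N₁) (hN₂ : 1 ≤ N₂) (hL₁ : 1 ≤ L₁) (hL₂ : 1 ≤ L₂)
    {a : ℝ → ℝ → ℂ} (ha : ∀ x y, ‖a x y‖ ≤ 1) {S : Finset ℤ} {h₁ h₂ : ℤ → ℝ → ℂ}
    (hc₁ : ∀ k, Continuous (h₁ k)) (hs₁ : ∀ k, HasCompactSupport (h₁ k))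
    (hc₂ : ∀ k, Continuous (h₂ k)) (hs₂ : ∀ k, HasCompactSupport (h₂ k))
    (hS : ∀ k, k ∉ S → h₁ k = 0)
    (sf : SuppIn p N₁ L₁ (fun z => ‖h₁ z.1 z.2‖ₑ)) (sg : SuppIn p N₂ L₂ (fun z => ‖h₂ z.1 z.2‖ₑ)) :
    ∫⁻ t, ∑' k : ℤ, ‖Lam a (fun k => 𝓕 (h₁ k) t) (fun k => 𝓕 (h₂ k) t) k‖ₑ ^ 2 ≤
      16 * (ENNReal.ofReal (Kc α ξ₀ c₀ N₁ N₂ L₁ L₂) *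
      ((∫⁻ t, ∑' k : ℤ, ‖𝓕 (h₁ k) t‖ₑ ^ 2) * ∫⁻ t, ∑' k : ℤ, ‖𝓕 (h₂ k) t‖ₑ ^ 2)) := by
  simp only [Lam_fourier hc₁ hs₁ hc₂ hs₂ hS]
  rw [planch_sum hc₁ hs₁, planch_sum hc₂ hs₂, planch_sum (fun k => (ww_cc hc₁ hs₁ hc₂ hs₂ k).1)
    (fun k => (ww_cc hc₁ hs₁ hc₂ hs₂ k).2)]
  refine le_trans ?_ (conv_main hα hp hN₁ hN₂ hL₁ hL₂
    (meas_slices fun k => (hc₁ k).enorm.measurable) (meas_slices fun k => (hc₂ k).enorm.measurable) sf sg)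
  refine lintegral_mono fun z => ?_
  exact pow_le_pow_left' (ww_le hc₁ hc₂ ha z.1 z.2) 2

lemma l2_conv {W : ℝ → ℤ → ℂ} (hm : ∀ k, Measurable fun t => W t k) {S : Finset ℤ}
    (hS : ∀ t k, k ∉ S → W t k = 0) :
    ∫ t, l2sq (W t) = (∫⁻ t, ∑' k : ℤ, ‖W t k‖ₑ ^ 2).toReal := by
  have e : ∀ t, l2sq (W t) = ∑ k ∈ S, ‖W t k‖ ^ 2 := fun t =>
    tsum_eq_sum (fun k hk => by simp [hS t k hk])
  simp only [e]
  rw [integral_eq_lintegral_of_nonneg_ae]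
  · congr 1
    refine lintegral_congr fun t => ?_
    rw [tsum_eq_sum (s := S) (fun k hk => by simp [hS t k hk]),
      ENNReal.ofReal_sum_of_nonneg (fun _ _ => by positivity)]
    refine Finset.sum_congr rfl fun k _ => ?_
    rw [ENNReal.ofReal_pow (norm_nonneg _), ofReal_norm]
  · exact Filter.Eventually.of_forall fun t => Finset.sum_nonneg fun _ _ => by positivity
  · refine Measurable.aestronglyMeasurable ?_
    exact Finset.measurable_sum _ fun k _ => (hm k).norm.pow_const 2

lemma numerics {α ξ₀ c₀ N₁ N₂ L₁ L₂ : ℝ} (hα : α ∈ Set.Icc (1:ℝ) 2) (hξ : 0 < ξ₀) (hc : 0 < c₀)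
    (hN₁ : 1 ≤ N₁) (hL₁ : 1 ≤ L₁) (hL₂ : 1 ≤ L₂) :
    16 * Kc α ξ₀ c₀ N₁ N₂ L₁ L₂ ≤ (64 * (2 * ξ₀ + 2 + 4 * √(8 / c₀))) *
      (min L₁ L₂ * ((max L₁ L₂) ^ ((1:ℝ)/4) / (max N₁ N₂) ^ ((α - 1)/4) + 1) ^ 2) := by
  unfold Kc
  set M := max L₁ L₂ with hM
  set N := max N₁ N₂ with hN
  set B := M ^ ((1:ℝ)/4) / N ^ ((α - 1)/4) with hB
  have hM1 : 1 ≤ M := hL₁.trans (le_max_left _ _)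
  have hN1 : 1 ≤ N := hN₁.trans (le_max_left _ _)
  have hm : 1 ≤ min L₁ L₂ := le_min hL₁ hL₂
  have hB0 : 0 ≤ B := by positivity
  have hB4 : B ^ 4 = M / N ^ (α - 1) := by
    rw [hB, div_pow, ← Real.rpow_mul_natCast (by linarith), ← Real.rpow_mul_natCast (by linarith)]
    congr 1
    · norm_num
    · congr 1; push_cast; ring
  have hNp : 0 < N ^ (α - 1) := by positivity
  have hhalf : N ^ (α - 1) / 2 ≤ (N / 2) ^ (α - 1) := by
    rw [Real.div_rpow (by linarith) (by norm_num)]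
    have : (2:ℝ) ^ (α - 1) ≤ 2 := by
      calc (2:ℝ) ^ (α - 1) ≤ 2 ^ (1:ℝ) := Real.rpow_le_rpow_of_exponent_le (by norm_num) (by linarith [hα.2])
        _ = 2 := by norm_num
    gcongr
  have hs : √((2 * L₁ + 2 * L₂) / (c₀ * (N / 2) ^ (α - 1))) ≤ √(8 / c₀) * B ^ 2 := by
    have e : √(8 / c₀) * B ^ 2 = √(8 / c₀ * B ^ 4) := by
      rw [Real.sqrt_mul (by positivity), show B ^ 4 = (B ^ 2) ^ 2 by ring, Real.sqrt_sq (by positivity)]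
    rw [e, hB4]
    refine Real.sqrt_le_sqrt ?_
    calc (2 * L₁ + 2 * L₂) / (c₀ * (N / 2) ^ (α - 1)) ≤ (4 * M) / (c₀ * (N ^ (α - 1) / 2)) := by
          have : 2 * L₁ + 2 * L₂ ≤ 4 * M := by
            linarith [le_max_left L₁ L₂, le_max_right L₁ L₂]
          gcongr
      _ = _ := by field_simp; norm_num
  have h8 : 0 ≤ √(8 / c₀) := Real.sqrt_nonneg _
  have key : 2 * ξ₀ + 2 + 4 * √((2 * L₁ + 2 * L₂) / (c₀ * (N / 2) ^ (α - 1))) ≤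
      (2 * ξ₀ + 2 + 4 * √(8 / c₀)) * (B + 1) ^ 2 := by
    have h1 : (1:ℝ) ≤ (B + 1) ^ 2 := by nlinarith
    have h2 : B ^ 2 ≤ (B + 1) ^ 2 := by nlinarith
    nlinarith [mul_le_mul_of_nonneg_left h2 h8, mul_le_mul_of_nonneg_left h1 (by linarith : 0 ≤ 2 * ξ₀ + 2)]
  nlinarith [mul_le_mul_of_nonneg_right key (by linarith : 0 ≤ min L₁ L₂)]

lemma final_step {A B K D m x y z : ℝ} (hx : 0 ≤ x) (hy : 0 ≤ y) (hz : 0 ≤ z) (hD : 0 ≤ D) (hm : 0 ≤ m)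
    (hB : 0 ≤ B) (hA : A = D * (m * B ^ 2)) (hK : K ≤ A) (h : z ≤ K * (x * y)) :
    z ^ ((1:ℝ)/2) ≤ √D * m ^ ((1:ℝ)/2) * B * x ^ ((1:ℝ)/2) * y ^ ((1:ℝ)/2) := by
  simp only [← Real.sqrt_eq_rpow]
  have : √D * √m * B * √x * √y = √(A * (x * y)) := by
    rw [hA, Real.sqrt_mul (by positivity), Real.sqrt_mul hD, Real.sqrt_mul hm, Real.sqrt_sq hB,
      Real.sqrt_mul hx]
    ring
  rw [this]
  refine Real.sqrt_le_sqrt (h.trans ?_)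
  gcongr

lemma toReal_step {X Y Z : ℝ≥0∞} {K : ℝ} (hK : 0 ≤ K) (hX : X ≠ ∞) (hY : Y ≠ ∞)
    (h : Z ≤ 16 * (ENNReal.ofReal K * (X * Y))) : Z.toReal ≤ 16 * K * (X.toReal * Y.toReal) := by
  have ht : 16 * (ENNReal.ofReal K * (X * Y)) ≠ ∞ := by finiteness
  refine (ENNReal.toReal_mono ht h).trans (le_of_eq ?_)
  simp only [ENNReal.toReal_mul, ENNReal.toReal_ofReal hK]
  norm_num
  ring

/-- The finite set of spatial frequencies carrying `P_{2^n} u`. -/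
def SS (n : ℕ) : Finset ℤ := Finset.Icc (-(2 * 2 ^ n)) (2 * 2 ^ n)

lemma hh_SS {χ : ℝ → ℝ} (hχ : CutoffFun χ) (p : ℝ → ℝ) (n l : ℕ) (U : ℝ → ℤ → ℂ) (k : ℤ) (hk : k ∉ SS n) :
    hh χ p n l U k = 0 := by
  ext σ
  by_contra h
  obtain ⟨-, -, h3, -⟩ := hh_supp hχ p n l U k σ h
  apply hk
  obtain ⟨h4, h5⟩ := abs_le.1 h3
  refine Finset.mem_Icc.2 ⟨?_, ?_⟩
  · exact_mod_cast h4
  · exact_mod_cast h5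

lemma hh_SuppIn {χ : ℝ → ℝ} (hχ : CutoffFun χ) (p : ℝ → ℝ) (n l : ℕ) (U : ℝ → ℤ → ℂ) :
    SuppIn p (2 ^ n) (2 ^ l) (fun z => ‖hh χ p n l U z.1 z.2‖ₑ) := by
  intro z hz
  have h : hh χ p n l U z.1 z.2 ≠ 0 := by simpa using hz
  obtain ⟨h1, h2, h3, h4⟩ := hh_supp hχ p n l U _ _ h
  exact ⟨h2, h4, h1⟩

lemma fourier_zero_fun (t : ℝ) : 𝓕 (0 : ℝ → ℂ) t = 0 := by
  simp [Real.fourier_eq']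

lemma bil_aux {α ξ₀ c₀ C₀ : ℝ} (hα : α ∈ Set.Icc (1:ℝ) 2) {p : ℝ → ℝ} (hp : Hyp1 α ξ₀ c₀ C₀ p)
    {χ : ℝ → ℝ} (hχ : CutoffFun χ) {a : ℝ → ℝ → ℂ} (ha : ∀ x y : ℝ, ‖a x y‖ ≤ 1)
    (U₁ U₂ : ℝ → ℤ → ℂ) (n₁ n₂ l₁ l₂ : ℕ) :
    L2full (fun t => Lam a
        (Qle χ p l₁ (fun s => PN χ ((2:ℝ) ^ n₁) (U₁ s)) t)
        (Qle χ p l₂ (fun s => PN χ ((2:ℝ) ^ n₂) (U₂ s)) t)) ≤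
      √(64 * (2 * ξ₀ + 2 + 4 * √(8 / c₀))) * (min ((2:ℝ) ^ l₁) ((2:ℝ) ^ l₂)) ^ ((1:ℝ)/2) *
        ((max ((2:ℝ) ^ l₁) ((2:ℝ) ^ l₂)) ^ ((1:ℝ)/4) /
            (max ((2:ℝ) ^ n₁) ((2:ℝ) ^ n₂)) ^ ((α - 1)/4) + 1) *
        L2full (Qle χ p l₁ (fun s => PN χ ((2:ℝ) ^ n₁) (U₁ s))) *
        L2full (Qle χ p l₂ (fun s => PN χ ((2:ℝ) ^ n₂) (U₂ s))) := by
  have e₁ : ∀ t, Qle χ p l₁ (fun s => PN χ ((2:ℝ) ^ n₁) (U₁ s)) t = fun k => 𝓕 (hh χ p n₁ l₁ U₁ k) t :=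
    fun t => funext fun k => Qle_fourier hχ p n₁ l₁ U₁ t k
  have e₂ : ∀ t, Qle χ p l₂ (fun s => PN χ ((2:ℝ) ^ n₂) (U₂ s)) t = fun k => 𝓕 (hh χ p n₂ l₂ U₂ k) t :=
    fun t => funext fun k => Qle_fourier hχ p n₂ l₂ U₂ t k
  have hc₁ := hh_cont hχ p n₁ l₁ U₁
  have hc₂ := hh_cont hχ p n₂ l₂ U₂
  have hs₁ := hh_cpt hχ p n₁ l₁ U₁
  have hs₂ := hh_cpt hχ p n₂ l₂ U₂
  have hS₁ := hh_SS hχ p n₁ l₁ U₁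
  have hS₂ := hh_SS hχ p n₂ l₂ U₂
  have hpow : ∀ n : ℕ, (1:ℝ) ≤ 2 ^ n := fun n => one_le_pow₀ (by norm_num)
  have hξ := hp.xi0_pos
  have hc := hp.c_pos
  have core := core_bound hα hp (hpow n₁) (hpow n₂) (hpow l₁) (hpow l₂) ha hc₁ hs₁ hc₂ hs₂ hS₁
    (hh_SuppIn hχ p n₁ l₁ U₁) (hh_SuppIn hχ p n₂ l₂ U₂)
  have hX := planch_fin hc₁ hs₁ hS₁
  have hY := planch_fin hc₂ hs₂ hS₂
  rw [← planch_sum hc₁ hs₁] at hX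
  rw [← planch_sum hc₂ hs₂] at hY
  have hK0 : 0 ≤ Kc α ξ₀ c₀ (2 ^ n₁) (2 ^ n₂) (2 ^ l₁) (2 ^ l₂) := by
    unfold Kc
    positivity
  have core2 := toReal_step hK0 hX hY core
  unfold L2full
  simp only [e₁, e₂]
  have zero_of : ∀ {h : ℤ → ℝ → ℂ} {n : ℕ}, (∀ k, k ∉ SS n → h k = 0) → ∀ t k, k ∉ SS n →
      𝓕 (h k) t = 0 := by
    intro h n hh t k hk
    rw [hh k hk, fourier_zero_fun]
  rw [l2_conv (S := SS n₁) (fun k => (fourier_cont_cc (hc₁ k) (hs₁ k)).measurable) (zero_of hS₁),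
    l2_conv (S := SS n₂) (fun k => (fourier_cont_cc (hc₂ k) (hs₂ k)).measurable) (zero_of hS₂),
    l2_conv (W := fun t => Lam a (fun k => 𝓕 (hh χ p n₁ l₁ U₁ k) t) (fun k => 𝓕 (hh χ p n₂ l₂ U₂ k) t))
      (S := (SS n₁ ×ˢ SS n₂).image (fun q => q.1 + q.2))]
  · refine final_step ENNReal.toReal_nonneg ENNReal.toReal_nonneg ENNReal.toReal_nonneg ?_ ?_ ?_ rfl
      (numerics hα hξ hc (hpow n₁) (hpow l₁) (hpow l₂)) core2
    · positivity
    · positivity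
    · positivity
  · intro k
    simp only [Lam_fourier hc₁ hs₁ hc₂ hs₂ hS₁]
    exact (fourier_cont_cc (ww_cc hc₁ hs₁ hc₂ hs₂ k).1 (ww_cc hc₁ hs₁ hc₂ hs₂ k).2).measurable
  · intro t k hk
    unfold Lam
    rw [← tsum_zero (α := ℂ) (β := ℤ)]
    congr 1
    ext j
    by_cases hj : j ∈ SS n₁
    · have : k - j ∉ SS n₂ := fun h => hk (Finset.mem_image.2 ⟨(j, k - j), by simp [hj, h], by simp⟩)
      simp only [zero_of hS₂ t _ this, mul_zero]
    · simp only [zero_of hS₁ t _ hj, mul_zero, zero_mul]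


end BilinearProof



/-- Proposition `prop_stri1_2`, estimate (bil1):
bilinear estimate for `Λ_a(Q_{≤L₁}P_{N₁}u₁, Q_{≤L₂}P_{N₂}u₂)` in `L²(ℝ×𝕋)`,
for real-valued `u₁, u₂ ∈ L²(ℝ×𝕋)` and dyadic `N₁,N₂,L₁,L₂ ≥ 1`. -/
theorem bilinear_L2_estimate_I
    (α ξ₀ c₀ C₀ : ℝ) (hα : α ∈ Set.Icc (1:ℝ) 2)
    (p : ℝ → ℝ) (hp : Hyp1 α ξ₀ c₀ C₀ p)
    (χ : ℝ → ℝ) (hχ : CutoffFun χ)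
    (a : ℝ → ℝ → ℂ) (ha : ∀ x y : ℝ, ‖a x y‖ ≤ 1) :
    ∃ C : ℝ, 0 < C ∧
      ∀ (U₁ U₂ : ℝ → ℤ → ℂ),
        (∀ t : ℝ, ∀ ξ : ℤ, U₁ t (-ξ) = (starRingEnd ℂ) (U₁ t ξ)) →
        (∀ t : ℝ, ∀ ξ : ℤ, U₂ t (-ξ) = (starRingEnd ℂ) (U₂ t ξ)) →
        MemL2 U₁ → MemL2 U₂ →
        ∀ (n₁ n₂ l₁ l₂ : ℕ),
          L2full (fun t => Lam a
              (Qle χ p l₁ (fun s => PN χ ((2:ℝ) ^ n₁) (U₁ s)) t)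
              (Qle χ p l₂ (fun s => PN χ ((2:ℝ) ^ n₂) (U₂ s)) t)) ≤
            C * (min ((2:ℝ) ^ l₁) ((2:ℝ) ^ l₂)) ^ ((1:ℝ)/2) *
              ((max ((2:ℝ) ^ l₁) ((2:ℝ) ^ l₂)) ^ ((1:ℝ)/4) /
                  (max ((2:ℝ) ^ n₁) ((2:ℝ) ^ n₂)) ^ ((α - 1)/4) + 1) *
              L2full (Qle χ p l₁ (fun s => PN χ ((2:ℝ) ^ n₁) (U₁ s))) *
              L2full (Qle χ p l₂ (fun s => PN χ ((2:ℝ) ^ n₂) (U₂ s))) := by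
  have hD : 0 < 64 * (2 * ξ₀ + 2 + 4 * √(8 / c₀)) := by
    have := hp.xi0_pos
    positivity
  refine ⟨√(64 * (2 * ξ₀ + 2 + 4 * √(8 / c₀))), Real.sqrt_pos.2 hD, ?_⟩
  intro U₁ U₂ _ _ _ _ n₁ n₂ l₁ l₂
  exact bil_aux hα hp hχ ha U₁ U₂ n₁ n₂ l₁ l₂

end
end
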